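/- Let R be a commutative noetherian ring such that the character module M⁺ = Hom_ℤ(M, ℚ/ℤ) of every Gorenstein injective R-module M is Gorenstein flat. Then the class of Gorenstein injective complexes is covering in Ch(R): every unbounded chain complex of R-modules has a Gorenstein injective cover. -/

import Mathlib

open CategoryTheory CategoryTheory.Limits

universe u

section GenericDefs

variable {𝒜 : Type*} [Category 𝒜] [Abelian 𝒜]

/-- An object `G` of an abelian category is *Gorenstein injective* if it is a cycle object of
an exact (ℤ-indexed) complex of injective objects which stays exact under `Hom(I, -)` for
every injective object `I`. -/
def IsGorensteinInjective (G : 𝒜) : Prop :=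
  ∃ C : ChainComplex 𝒜 ℤ,
    (∀ n, Injective (C.X n)) ∧
    (∀ n, C.ExactAt n) ∧
    (∀ (I : 𝒜), Injective I → ∀ n,
      (((preadditiveCoyoneda.obj (Opposite.op I)).mapHomologicalComplex _).obj C).ExactAt n) ∧
    Nonempty (G ≅ kernel (C.d 0 (-1)))

/-- An object `G` is *Gorenstein projective* if it is a cycle object of an exact complex of
projectives which stays exact under `Hom(-, P)` for every projective `P`. -/
def IsGorensteinProjective (G : 𝒜) : Prop :=
  ∃ C : ChainComplex 𝒜 ℤ,
    (∀ n, Projective (C.X n)) ∧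
    (∀ n, C.ExactAt n) ∧
    (∀ (P : 𝒜), Projective P → ∀ n,
      (((preadditiveYoneda.obj P).mapHomologicalComplex _).obj C.op).ExactAt n) ∧
    Nonempty (G ≅ kernel (C.d 0 (-1)))

/-- `φ : G ⟶ X` is a `𝒞`-precover of `X`. -/
def IsPrecover (𝒞 : 𝒜 → Prop) {G X : 𝒜} (φ : G ⟶ X) : Prop :=
  𝒞 G ∧ ∀ (G' : 𝒜), 𝒞 G' → ∀ ψ : G' ⟶ X, ∃ h : G' ⟶ G, h ≫ φ = ψ

/-- `φ : G ⟶ X` is a `𝒞`-cover of `X`. -/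
def IsCover (𝒞 : 𝒜 → Prop) {G X : 𝒜} (φ : G ⟶ X) : Prop :=
  IsPrecover 𝒞 φ ∧ ∀ f : G ⟶ G, f ≫ φ = φ → IsIso f

/-- `φ : X ⟶ G` is a `𝒞`-preenvelope of `X`. -/
def IsPreenvelope (𝒞 : 𝒜 → Prop) {X G : 𝒜} (φ : X ⟶ G) : Prop :=
  𝒞 G ∧ ∀ (G' : 𝒜), 𝒞 G' → ∀ ψ : X ⟶ G', ∃ h : G ⟶ G', φ ≫ h = ψ

/-- `φ : X ⟶ G` is a `𝒞`-envelope of `X`. -/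
def IsEnvelope (𝒞 : 𝒜 → Prop) {X G : 𝒜} (φ : X ⟶ G) : Prop :=
  IsPreenvelope 𝒞 φ ∧ ∀ f : G ⟶ G, φ ≫ f = φ → IsIso f

/-- `Ext¹(X, Y) = 0`, expressed by the splitting of every extension of `X` by `Y`. -/
def Ext1Zero (X Y : 𝒜) : Prop :=
  ∀ (E : 𝒜) (i : Y ⟶ E) (p : E ⟶ X) (w : i ≫ p = 0),
    (ShortComplex.mk i p w).ShortExact → ∃ s : X ⟶ E, s ≫ p = 𝟙 X

/-- `ExtSucZero n X Y` says `Ext^(n+1)(X, Y) = 0`; defined by dimension shifting along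
short exact sequences `0 ⟶ Y ⟶ E ⟶ Y' ⟶ 0` with `E` injective. -/
def ExtSucZero : ℕ → 𝒜 → 𝒜 → Prop
  | 0, X, Y => Ext1Zero X Y
  | (n+1), X, Y => ∀ (E Y' : 𝒜) (i : Y ⟶ E) (p : E ⟶ Y') (w : i ≫ p = 0),
      (ShortComplex.mk i p w).ShortExact → Injective E → ExtSucZero n X Y'

/-- A special `𝒞`-precover: an epimorphism `φ : G ⟶ X` with `G ∈ 𝒞` arising in a short exact
sequence `0 ⟶ A ⟶ G ⟶ X ⟶ 0` with `Ext¹(G', A) = 0` for all `G' ∈ 𝒞`. -/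
def IsSpecialPrecover (𝒞 : 𝒜 → Prop) {G X : 𝒜} (φ : G ⟶ X) : Prop :=
  IsPrecover 𝒞 φ ∧ ∃ (A : 𝒜) (i : A ⟶ G) (w : i ≫ φ = 0),
    (ShortComplex.mk i φ w).ShortExact ∧ ∀ (G' : 𝒜), 𝒞 G' → Ext1Zero G' A

/-- The left `Ext¹`-orthogonal class `⊥𝒞` of a class of objects `𝒞`. -/
def leftOrthogonal {𝒜 : Type*} [Category 𝒜] [Abelian 𝒜] (𝒞 : 𝒜 → Prop) (X : 𝒜) : Prop :=
  ∀ Y : 𝒜, 𝒞 Y → Ext1Zero X Y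

/-- The right `Ext¹`-orthogonal class `𝒞⊥` of a class of objects `𝒞`. -/
def rightOrthogonal {𝒜 : Type*} [Category 𝒜] [Abelian 𝒜] (𝒞 : 𝒜 → Prop) (Y : 𝒜) : Prop :=
  ∀ X : 𝒜, 𝒞 X → Ext1Zero X Y

end GenericDefs

section GorensteinFlat

variable (R : Type u) [CommRing R]

/-- An `R`-module `N` is *Gorenstein flat* if it is a cycle module of an exact complex of flat
modules which stays exact under `I ⊗ -` for every injective module `I`. -/
def IsGorensteinFlat (N : ModuleCat.{u} R) : Prop :=
  ∃ C : ChainComplex (ModuleCat.{u} R) ℤ,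
    (∀ n, Module.Flat R (C.X n)) ∧
    (∀ n, C.ExactAt n) ∧
    (∀ (I : ModuleCat.{u} R), Injective I → ∀ n,
      (((MonoidalCategory.tensorLeft I).mapHomologicalComplex _).obj C).ExactAt n) ∧
    Nonempty (N ≅ kernel (C.d 0 (-1)))

end GorensteinFlat

section GorensteinClasses

variable {𝒜 : Type*} [Category 𝒜] [Abelian 𝒜]

/-- Every morphism from an injective object lifts through `p`. -/
def LiftsInjectives {E Q : 𝒜} (p : E ⟶ Q) : Prop :=
  ∀ I : 𝒜, Injective I → ∀ f : I ⟶ Q, ∃ g : I ⟶ E, g ≫ p = f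

/-- There is a short exact sequence `0 ⟶ B ⟶ E ⟶ A ⟶ 0` with `E` injective through which every
morphism from an injective object to `A` lifts. -/
def IsInjectiveStep (A B : 𝒜) : Prop :=
  ∃ (E : 𝒜) (i : B ⟶ E) (p : E ⟶ A) (w : i ≫ p = 0),
    (ShortComplex.mk i p w).ShortExact ∧ Injective E ∧ LiftsInjectives p

/-- A class of objects each of which can be continued on both sides by injective steps. -/
def IsGorensteinClass (P : 𝒜 → Prop) : Prop :=
  ∀ G, P G → (∃ G', P G' ∧ IsInjectiveStep G' G) ∧ (∃ G', P G' ∧ IsInjectiveStep G G')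

theorem exists_int_sequence {α : Type*} (r : α → α → Prop) (P : α → Prop)
    (hup : ∀ x, P x → ∃ y, P y ∧ r x y) (hdown : ∀ x, P x → ∃ y, P y ∧ r y x) (x : α) (hx : P x) :
    ∃ Z : ℤ → α, Z 1 = x ∧ ∀ n, r (Z n) (Z (n + 1)) := by
  choose u hu hru using hup
  choose v hv hrv using hdown
  let u' : {x // P x} → {x // P x} := fun x => ⟨u x.1 x.2, hu _ _⟩
  let v' : {x // P x} → {x // P x} := fun x => ⟨v x.1 x.2, hv _ _⟩
  let Z : ℤ → {x // P x} := fun n => match n with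
    | Int.ofNat n => u'^[n] ⟨x, hx⟩
    | Int.negSucc n => v'^[n+1] ⟨x, hx⟩
  have hZ : ∀ n : ℤ, r (Z n).1 (Z (n + 1)).1 := by
    rintro (n | n)
    · change r (u'^[n] ⟨x, hx⟩).1 (u'^[n+1] ⟨x, hx⟩).1
      rw [Function.iterate_succ_apply']
      exact hru _ _
    · cases n with
      | zero => exact hrv _ _
      | succ n =>
        change r (v'^[n+1+1] ⟨x, hx⟩).1 (v'^[n+1] ⟨x, hx⟩).1
        rw [Function.iterate_succ_apply']
        exact hrv _ _
  refine ⟨fun n => (Z (n - 1)).1, rfl, fun n => ?_⟩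
  have := hZ (n - 1)
  rwa [show n - 1 + 1 = n + 1 - 1 by ring] at this

lemma exact_hom_iff {𝒜 : Type*} [Category 𝒜] [Abelian 𝒜] (C : ChainComplex 𝒜 ℤ) (I : 𝒜) (n : ℤ) :
    (((preadditiveCoyoneda.obj (Opposite.op I)).mapHomologicalComplex _).obj C).ExactAt n ↔
      ∀ f : I ⟶ C.X n, f ≫ C.d n (n-1) = 0 → ∃ g : I ⟶ C.X (n+1), g ≫ C.d (n+1) n = f := by
  rw [HomologicalComplex.exactAt_iff' _ (n+1) n (n-1) (by simp) (by simp),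
    ShortComplex.ab_exact_iff]
  rfl

theorem isGorensteinInjective_of_class {P : 𝒜 → Prop} (hP : IsGorensteinClass P) {G : 𝒜}
    (hG : P G) : IsGorensteinInjective G := by
  obtain ⟨Z, hZ, hr⟩ := exists_int_sequence IsInjectiveStep P (fun x hx => (hP x hx).2)
    (fun x hx => (hP x hx).1) G hG
  choose E i p w hse hinj hl using hr
  have hmono : ∀ n, Mono (i n) := fun n => (hse n).mono_f
  have hepi : ∀ n, Epi (p n) := fun n => (hse n).epi_g
  let C : ChainComplex 𝒜 ℤ := ChainComplex.of E (fun n => p (n+1) ≫ i n) (fun n => by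
    simp [reassoc_of% (w (n+1))])
  have hd : ∀ n, C.d (n+1) n = p (n+1) ≫ i n := fun n => ChainComplex.of_d E (fun n => p (n+1) ≫ i n) n
  have hd' : ∀ n m, n = m + 1 → ∃ i' : Z n ⟶ E m, Mono i' ∧ C.d n m = p n ≫ i' ∧
      (∃ w : i' ≫ p m = 0, (ShortComplex.mk i' (p m) w).ShortExact) := by
    rintro _ n rfl
    exact ⟨i n, hmono n, hd n, w n, hse n⟩
  have hlift : ∀ n (I : 𝒜), Injective I → ∀ f : I ⟶ E n, f ≫ C.d n (n-1) = 0 →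
      ∃ g : I ⟶ E (n+1), g ≫ C.d (n+1) n = f := by
    intro n I hI f hf
    obtain ⟨j, hj, hdj, _⟩ := hd' n (n-1) (by ring)
    rw [hdj, ← Category.assoc, ← zero_comp (f := j), cancel_mono] at hf
    have hk := (hse n).exact.lift_f f hf
    obtain ⟨g, hg⟩ := hl (n+1) I hI ((hse n).exact.lift f hf)
    refine ⟨g, ?_⟩
    rw [hd, reassoc_of% hg]
    exact hk
  have hex : ∀ n, C.ExactAt n := by
    intro n
    rw [HomologicalComplex.exactAt_iff' _ (n+1) n (n-1) (by simp) (by simp)]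
    obtain ⟨j, hj, hdj, _⟩ := hd' n (n-1) (by ring)
    have h1 : (ShortComplex.mk (i n) (p n ≫ j) (by simp [reassoc_of% (w n)])).Exact := by
      let φ : ShortComplex.mk (i n) (p n) (w n) ⟶
          ShortComplex.mk (i n) (p n ≫ j) (by simp [reassoc_of% (w n)]) :=
        { τ₁ := 𝟙 _, τ₂ := 𝟙 _, τ₃ := j }
      have : Mono φ.τ₃ := hj
      have : Epi φ.τ₁ := by dsimp [φ]; infer_instance
      have : IsIso φ.τ₂ := by dsimp [φ]; infer_instance
      exact (ShortComplex.exact_iff_of_epi_of_isIso_of_mono φ).1 (hse n).exact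
    let φ : ShortComplex.mk (C.d (n+1) n) (C.d n (n-1)) (C.d_comp_d _ _ _) ⟶
          ShortComplex.mk (i n) (p n ≫ j) (by simp [reassoc_of% (w n)]) :=
        { τ₁ := p (n+1), τ₂ := 𝟙 _, τ₃ := 𝟙 _
          comm₁₂ := by simp [C]
          comm₂₃ := by simpa [C] using hdj.symm }
    have : Mono φ.τ₃ := by dsimp [φ]; exact inferInstanceAs (Mono (𝟙 (C.X (n-1))))
    have : Epi φ.τ₁ := hepi _
    have : IsIso φ.τ₂ := by dsimp [φ]; exact inferInstanceAs (IsIso (𝟙 (C.X n)))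
    exact (ShortComplex.exact_iff_of_epi_of_isIso_of_mono φ).2 h1
  refine ⟨C, hinj, hex, fun I hI n => (exact_hom_iff C I n).2 (hlift n I hI), ?_⟩
  obtain ⟨j, hj, hdj, _⟩ := hd' 0 (-1) rfl
  have hk := (hse 0).fIsKernel
  have e1 : Z 1 ≅ kernel (p 0) := hk.conePointUniqueUpToIso (limit.isLimit _)
  exact ⟨eqToIso hZ.symm ≪≫ e1 ≪≫ (kernelCompMono (p 0) j).symm ≪≫
    kernelIsoOfEq hdj.symm⟩

/-- The step given by a complex exact under `Hom(I, -)`. -/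
lemma isInjectiveStep_of_complex (C : ChainComplex 𝒜 ℤ) (hinj : ∀ n, Injective (C.X n))
    (hex : ∀ n, C.ExactAt n) (hI : ∀ (I : 𝒜), Injective I → ∀ n,
      (((preadditiveCoyoneda.obj (Opposite.op I)).mapHomologicalComplex _).obj C).ExactAt n)
    (n : ℤ) : IsInjectiveStep (kernel (C.d n (n-1))) (kernel (C.d (n+1) n)) := by
  have hn := hex n
  rw [HomologicalComplex.exactAt_iff' _ (n+1) n (n-1) (by simp) (by simp)] at hn
  let p : C.X (n+1) ⟶ kernel (C.d n (n-1)) := kernel.lift _ (C.d (n+1) n) (by simp)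
  have hp : Epi p := hn.epi_kernelLift
  have w : kernel.ι (C.d (n+1) n) ≫ p = 0 := by
    rw [← cancel_mono (kernel.ι _)]; simp [p]
  refine ⟨C.X (n+1), kernel.ι _, p, w, ?_, hinj _, ?_⟩
  · have : (ShortComplex.mk (kernel.ι (C.d (n+1) n)) p w).Exact := by
      refine ShortComplex.exact_of_f_is_kernel _ ?_
      refine KernelFork.IsLimit.ofι _ _ (fun g hg => kernel.lift _ g ?_) ?_ ?_
      · have := congrArg (· ≫ kernel.ι _) hg
        simpa [p] using this
      · intros; simp
      · intros _ _ _ _ h; rw [← cancel_mono (kernel.ι _)]; simp [h]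
    exact { exact := this }
  · intro I hI' f
    obtain ⟨g, hg⟩ := (exact_hom_iff C I n).1 (hI I hI' n) (f ≫ kernel.ι _) (by simp)
    refine ⟨g, ?_⟩
    rw [← cancel_mono (kernel.ι _)]; simp [p, hg]

lemma IsInjectiveStep.of_iso {A B A' B' : 𝒜} (h : IsInjectiveStep A B) (e : A ≅ A')
    (e' : B ≅ B') : IsInjectiveStep A' B' := by
  obtain ⟨E, i, p, w, hs, hE, hl⟩ := h
  refine ⟨E, e'.inv ≫ i, p ≫ e.hom, by simp [reassoc_of% w], ?_, hE, ?_⟩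
  · let φ : ShortComplex.mk i p w ≅ ShortComplex.mk (e'.inv ≫ i) (p ≫ e.hom)
        (by simp [reassoc_of% w]) :=
      ShortComplex.isoMk e' (Iso.refl _) e (by simp) (by simp)
    exact ShortComplex.shortExact_of_iso φ hs
  · intro I hI f
    obtain ⟨g, hg⟩ := hl I hI (f ≫ e.inv)
    exact ⟨g, by simp [reassoc_of% hg]⟩

theorem isGorensteinClass_isGorensteinInjective :
    IsGorensteinClass (fun G : 𝒜 => IsGorensteinInjective G) := by
  suffices ∃ P : 𝒜 → Prop, IsGorensteinClass P ∧ ∀ G, IsGorensteinInjective G → P G by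
    obtain ⟨P, hP, h⟩ := this
    intro G hG
    obtain ⟨⟨A, hA, hA'⟩, ⟨B, hB, hB'⟩⟩ := hP G (h G hG)
    exact ⟨⟨A, isGorensteinInjective_of_class hP hA, hA'⟩,
      ⟨B, isGorensteinInjective_of_class hP hB, hB'⟩⟩
  refine ⟨fun G => ∃ C : ChainComplex 𝒜 ℤ, (∀ n, Injective (C.X n)) ∧ (∀ n, C.ExactAt n) ∧
    (∀ (I : 𝒜), Injective I → ∀ n,
      (((preadditiveCoyoneda.obj (Opposite.op I)).mapHomologicalComplex _).obj C).ExactAt n) ∧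
    ∃ n, Nonempty (G ≅ kernel (C.d n (n-1))), ?_, ?_⟩
  · rintro G ⟨C, h1, h2, h3, n, ⟨e⟩⟩
    refine ⟨⟨kernel (C.d (n-1) (n-1-1)), ⟨C, h1, h2, h3, n-1, ⟨Iso.refl _⟩⟩, ?_⟩,
      ⟨kernel (C.d (n+1) (n+1-1)), ⟨C, h1, h2, h3, n+1, ⟨Iso.refl _⟩⟩, ?_⟩⟩
    · have := isInjectiveStep_of_complex C h1 h2 h3 (n-1)
      rw [sub_add_cancel] at this
      exact this.of_iso (Iso.refl _) e.symm
    · have := isInjectiveStep_of_complex C h1 h2 h3 n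
      rw [add_sub_cancel_right]
      exact this.of_iso e.symm (Iso.refl _)
  · rintro G ⟨C, h1, h2, h3, e⟩
    exact ⟨C, h1, h2, h3, 0, e⟩

theorem IsGorensteinInjective.of_iso {G G' : 𝒜} (h : IsGorensteinInjective G) (e : G ≅ G') :
    IsGorensteinInjective G' := by
  obtain ⟨C, h1, h2, h3, ⟨e'⟩⟩ := h
  exact ⟨C, h1, h2, h3, ⟨e.symm ≪≫ e'⟩⟩

end GorensteinClasses

section GorensteinInjectiveModules

variable {R : Type u} [CommRing R]
variable {A B C E E' G H K K' I M N : Type u}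
  [AddCommGroup A] [Module R A] [AddCommGroup B] [Module R B] [AddCommGroup C] [Module R C]
  [AddCommGroup E] [Module R E] [AddCommGroup E'] [Module R E'] [AddCommGroup G] [Module R G]
  [AddCommGroup H] [Module R H] [AddCommGroup K] [Module R K] [AddCommGroup K'] [Module R K']
  [AddCommGroup I] [Module R I] [AddCommGroup M] [Module R M] [AddCommGroup N] [Module R N]

variable (R M) in
/-- Gorenstein injectivity of an unbundled module. -/
def GI : Prop := IsGorensteinInjective (ModuleCat.of R M)

/-- Every linear map from an injective module to the target of `p` lifts through `p`. -/
def InjLift (p : E →ₗ[R] A) : Prop :=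
  ∀ (I : Type u) [AddCommGroup I] [Module R I], Module.Injective R I →
    ∀ f : I →ₗ[R] A, ∃ g : I →ₗ[R] E, p ∘ₗ g = f

/-- `0 → B → E → A → 0` is exact, with `E` injective, and maps from injectives to `A` lift. -/
structure InjStep (i : B →ₗ[R] E) (p : E →ₗ[R] A) : Prop where
  inj : Function.Injective i
  exact : Function.Exact i p
  surj : Function.Surjective p
  injective : Module.Injective R E
  lift : InjLift p

lemma GI.of_equiv (e : M ≃ₗ[R] N) (h : GI R M) : GI R N :=
  IsGorensteinInjective.of_iso h e.toModuleIso

lemma isInjectiveStep_iff (A B : ModuleCat.{u} R) : IsInjectiveStep A B ↔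
    ∃ (E : ModuleCat.{u} R) (i : B →ₗ[R] E) (p : E →ₗ[R] A), InjStep i p := by
  constructor
  · rintro ⟨E, i, p, w, hs, hE, hl⟩
    refine ⟨E, i.hom, p.hom, hs.moduleCat_injective_f,
      (ShortComplex.ShortExact.moduleCat_exact_iff_function_exact _).1 hs.exact,
      hs.moduleCat_surjective_g, (Module.injective_iff_injective_object R E).2 hE, ?_⟩
    intro I _ _ hI f
    have hI' := (Module.injective_iff_injective_object R I).1 hI
    obtain ⟨g, hg⟩ := hl _ hI' (ModuleCat.ofHom f)
    exact ⟨g.hom, by rw [← ModuleCat.hom_comp, hg]; rfl⟩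
  · rintro ⟨E, i, p, h⟩
    refine ⟨E, ModuleCat.ofHom i, ModuleCat.ofHom p, ?_, ?_,
      (Module.injective_iff_injective_object R E).1 h.injective, ?_⟩
    · ext x; exact h.exact.apply_apply_eq_zero x
    · exact ModuleCat.shortComplex_shortExact _ h.exact h.inj h.surj
    · intro I hI f
      obtain ⟨g, hg⟩ := h.lift I ((Module.injective_iff_injective_object R I).2 hI) f.hom
      exact ⟨ModuleCat.ofHom g, by ext x; exact LinearMap.congr_fun hg x⟩

lemma GI.of_class (P : ModuleCat.{u} R → Prop)
    (h1 : ∀ G, P G → ∃ (E G' : ModuleCat.{u} R) (i : G →ₗ[R] E) (p : E →ₗ[R] G'),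
      P G' ∧ InjStep i p)
    (h2 : ∀ G, P G → ∃ (E G' : ModuleCat.{u} R) (i : G' →ₗ[R] E) (p : E →ₗ[R] G),
      P G' ∧ InjStep i p) (hM : P (ModuleCat.of R M)) : GI R M := by
  refine isGorensteinInjective_of_class (P := P) (fun G hG => ⟨?_, ?_⟩) hM
  · obtain ⟨E, G', i, p, h, hs⟩ := h1 G hG
    exact ⟨G', h, (isInjectiveStep_iff _ _).2 ⟨E, i, p, hs⟩⟩
  · obtain ⟨E, G', i, p, h, hs⟩ := h2 G hG
    exact ⟨G', h, (isInjectiveStep_iff _ _).2 ⟨E, i, p, hs⟩⟩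

lemma GI.exists_coresolution (h : GI R M) :
    ∃ (E G' : ModuleCat.{u} R) (i : M →ₗ[R] E) (p : E →ₗ[R] G'), GI R G' ∧ InjStep i p := by
  obtain ⟨⟨G', h1, h2⟩, -⟩ := isGorensteinClass_isGorensteinInjective _ h
  obtain ⟨E, i, p, hs⟩ := (isInjectiveStep_iff _ _).1 h2
  exact ⟨E, G', i, p, h1, hs⟩

lemma GI.exists_resolution (h : GI R M) :
    ∃ (E G' : ModuleCat.{u} R) (i : G' →ₗ[R] E) (p : E →ₗ[R] M), GI R G' ∧ InjStep i p := by
  obtain ⟨-, ⟨G', h1, h2⟩⟩ := isGorensteinClass_isGorensteinInjective _ h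
  obtain ⟨E, i, p, hs⟩ := (isInjectiveStep_iff _ _).1 h2
  exact ⟨E, G', i, p, h1, hs⟩

lemma Module.Injective.of_linearEquiv (e : M ≃ₗ[R] N) (h : Module.Injective R M) :
    Module.Injective R N :=
  Module.Baer.injective ((Module.Baer.of_injective h).of_equiv e)

lemma Module.Injective.of_retract (i : N →ₗ[R] M) (r : M →ₗ[R] N) (hr : r ∘ₗ i = LinearMap.id)
    (h : Module.Injective R M) : Module.Injective R N where
  out X Y _ _ _ _ f hf g := by
    obtain ⟨k, hk⟩ := h.out f hf (i ∘ₗ g)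
    refine ⟨r ∘ₗ k, fun x => ?_⟩
    simp only [LinearMap.comp_apply, hk]
    exact LinearMap.congr_fun hr _

lemma Module.Injective.prod (h : Module.Injective R M) (h' : Module.Injective R N) :
    Module.Injective R (M × N) where
  out X Y _ _ _ _ f hf g := by
    obtain ⟨k, hk⟩ := h.out f hf (LinearMap.fst R M N ∘ₗ g)
    obtain ⟨k', hk'⟩ := h'.out f hf (LinearMap.snd R M N ∘ₗ g)
    exact ⟨k.prod k', fun x => by ext <;> simp [hk, hk']⟩

lemma LinearMap.exists_comp_eq_of_range_le (k : A →ₗ[R] B) (hk : Function.Injective k)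
    (f : C →ₗ[R] B) (h : ∀ x, f x ∈ LinearMap.range k) : ∃ g : C →ₗ[R] A, k ∘ₗ g = f := by
  refine ⟨(LinearEquiv.ofInjective k hk).symm.toLinearMap ∘ₗ f.codRestrict _ h, ?_⟩
  ext x
  have := (LinearEquiv.ofInjective k hk).apply_symm_apply (f.codRestrict _ h x)
  exact congrArg Subtype.val this

lemma LinearMap.exists_comp_eq_of_ker_le (p : B →ₗ[R] A) (hp : Function.Surjective p)
    (f : B →ₗ[R] C) (h : ∀ x, p x = 0 → f x = 0) : ∃ g : A →ₗ[R] C, g ∘ₗ p = f := by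
  have hle : LinearMap.ker p ≤ LinearMap.ker f :=
    fun x hx => LinearMap.mem_ker.2 (h x (LinearMap.mem_ker.1 hx))
  refine ⟨(LinearMap.ker p).liftQ f hle ∘ₗ (p.quotKerEquivOfSurjective hp).symm.toLinearMap, ?_⟩
  ext x
  simp only [LinearMap.comp_apply, LinearEquiv.coe_coe]
  rw [← LinearMap.quotKerEquivOfSurjective_apply_mk p hp x, LinearEquiv.symm_apply_apply,
    Submodule.liftQ_apply]

lemma InjLift.of_injStep (i : A →ₗ[R] B) (p : B →ₗ[R] C) (hi : Function.Injective i)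
    (hex : Function.Exact i p) (hp : Function.Surjective p) {j : A →ₗ[R] E} {q : E →ₗ[R] G}
    (h : InjStep j q) : InjLift p := by
  obtain ⟨φ, hφ⟩ := h.injective.out i hi j
  obtain ⟨ψ, hψ⟩ := p.exists_comp_eq_of_ker_le hp (q ∘ₗ φ) (fun x hx => by
    obtain ⟨a, rfl⟩ := (hex x).1 hx
    simp [hφ, h.exact.apply_apply_eq_zero])
  intro I _ _ hI f
  obtain ⟨g, hg⟩ := h.lift I hI (ψ ∘ₗ f)
  have hk : Function.Injective (p.prod φ) := by
    rw [injective_iff_map_eq_zero]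
    intro x hx
    obtain ⟨h1, h2⟩ := Prod.mk.inj hx
    obtain ⟨a, rfl⟩ := (hex x).1 h1
    rw [hφ] at h2
    rw [(injective_iff_map_eq_zero j).1 h.inj a h2, map_zero]
  obtain ⟨l, hl⟩ := (p.prod φ).exists_comp_eq_of_range_le hk (f.prod g) (fun x => by
    obtain ⟨b, hb⟩ := hp (f x)
    have h1 : q (φ b - g x) = 0 := by
      have h2 := LinearMap.congr_fun hψ b
      have h3 := LinearMap.congr_fun hg x
      simp only [LinearMap.comp_apply] at h2 h3
      rw [map_sub, ← h2, h3, hb, sub_self]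
    obtain ⟨a, ha⟩ := (h.exact _).1 h1
    refine ⟨b - i a, Prod.ext ?_ ?_⟩
    · simp [hb, hex.apply_apply_eq_zero]
    · simp [hφ, ha])
  refine ⟨l, ?_⟩
  ext x
  exact congrArg Prod.fst (LinearMap.congr_fun hl x)

/-- Epimorphisms with Gorenstein injective kernel lift maps from injectives. -/
lemma GI.injLift (h : GI R A) (i : A →ₗ[R] B) (p : B →ₗ[R] C) (hi : Function.Injective i)
    (hex : Function.Exact i p) (hp : Function.Surjective p) : InjLift p := by
  obtain ⟨E, G', j, q, -, hs⟩ := h.exists_coresolution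
  exact InjLift.of_injStep i p hi hex hp hs

lemma injStep_id (h : Module.Injective R M) : InjStep (LinearMap.id : M →ₗ[R] M)
    (0 : M →ₗ[R] PUnit.{u+1}) :=
  ⟨fun _ _ h => h, fun x => by simp, fun x => ⟨0, rfl⟩, h, fun I _ _ _ f => ⟨0, by ext⟩⟩

lemma injStep_id' (h : Module.Injective R M) : InjStep (0 : PUnit.{u+1} →ₗ[R] M)
    (LinearMap.id : M →ₗ[R] M) :=
  ⟨fun _ _ _ => rfl, fun x => ⟨fun h => ⟨0, by simpa using h.symm⟩,
    fun ⟨y, h⟩ => by rw [← h]; simp⟩, fun x => ⟨x, rfl⟩, h, fun I _ _ _ f => ⟨f, rfl⟩⟩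

lemma Module.Injective.gi (h : Module.Injective R M) : GI R M := by
  have h0 : Module.Injective R PUnit.{u+1} := ⟨fun X Y _ _ _ _ f hf g => ⟨0, fun x => rfl⟩⟩
  refine GI.of_class (fun G => Module.Injective R G) (fun G hG => ?_) (fun G hG => ?_) h
  · exact ⟨G, ModuleCat.of R PUnit.{u+1}, _, _, h0, injStep_id hG⟩
  · exact ⟨G, ModuleCat.of R PUnit.{u+1}, _, _, h0, injStep_id' hG⟩

lemma InjStep.pi {ι : Type u} {A B E : ι → Type u} [∀ k, AddCommGroup (A k)] [∀ k, Module R (A k)]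
    [∀ k, AddCommGroup (B k)] [∀ k, Module R (B k)] [∀ k, AddCommGroup (E k)]
    [∀ k, Module R (E k)] {i : ∀ k, B k →ₗ[R] E k} {p : ∀ k, E k →ₗ[R] A k}
    (h : ∀ k, InjStep (i k) (p k)) :
    InjStep (LinearMap.pi (fun k => i k ∘ₗ LinearMap.proj k))
      (LinearMap.pi (fun k => p k ∘ₗ LinearMap.proj k)) where
  inj x y hxy := funext fun k => (h k).inj (congrFun hxy k)
  exact x := by
    constructor
    · intro hx
      choose y hy using fun k => ((h k).exact (x k)).1 (congrFun hx k)
      exact ⟨y, funext hy⟩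
    · rintro ⟨y, rfl⟩
      funext k
      exact (h k).exact.apply_apply_eq_zero (y k)
  surj x := by
    choose y hy using fun k => (h k).surj (x k)
    exact ⟨y, funext hy⟩
  injective := by
    have := fun k => (h k).injective
    exact Module.Injective.pi ..
  lift I _ _ hI f := by
    choose g hg using fun k => (h k).lift I hI (LinearMap.proj k ∘ₗ f)
    refine ⟨LinearMap.pi g, ?_⟩
    ext x k
    exact LinearMap.congr_fun (hg k) x

lemma InjStep.congr {i : B →ₗ[R] E} {p : E →ₗ[R] A} (h : InjStep i p) {A' B' : Type u}
    [AddCommGroup A'] [Module R A'] [AddCommGroup B'] [Module R B'] (e : B' ≃ₗ[R] B)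
    (e' : A ≃ₗ[R] A') : InjStep (i ∘ₗ e.toLinearMap) (e'.toLinearMap ∘ₗ p) where
  inj := h.inj.comp e.injective
  exact x := by
    simp only [LinearMap.comp_apply, LinearEquiv.coe_coe, EmbeddingLike.map_eq_zero_iff]
    rw [h.exact x]
    constructor
    · rintro ⟨y, rfl⟩
      exact ⟨e.symm y, by simp⟩
    · rintro ⟨y, rfl⟩
      exact ⟨_, rfl⟩
  surj := e'.surjective.comp h.surj
  injective := h.injective
  lift I _ _ hI f := by
    obtain ⟨g, hg⟩ := h.lift I hI (e'.symm.toLinearMap ∘ₗ f)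
    refine ⟨g, ?_⟩
    rw [LinearMap.comp_assoc, hg]
    ext; simp

lemma GI.pi {ι : Type u} {M : ι → Type u} [∀ k, AddCommGroup (M k)] [∀ k, Module R (M k)]
    (h : ∀ k, GI R (M k)) : GI R (∀ k, M k) := by
  refine GI.of_class (fun G => ∃ M : ι → ModuleCat.{u} R, (∀ k, GI R (M k)) ∧
    Nonempty (G ≃ₗ[R] ∀ k, M k)) (fun G hG => ?_) (fun G hG => ?_)
    ⟨fun k => ModuleCat.of R (M k), h, ⟨LinearEquiv.refl _ _⟩⟩
  · obtain ⟨M, hM, ⟨e⟩⟩ := hG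
    choose E G' i p hG' hs using fun k => (hM k).exists_coresolution
    exact ⟨ModuleCat.of R (∀ k, E k), ModuleCat.of R (∀ k, G' k), _, _,
      ⟨G', hG', ⟨LinearEquiv.refl _ _⟩⟩, (InjStep.pi hs).congr e (LinearEquiv.refl _ _)⟩
  · obtain ⟨M, hM, ⟨e⟩⟩ := hG
    choose E G' i p hG' hs using fun k => (hM k).exists_resolution
    exact ⟨ModuleCat.of R (∀ k, E k), ModuleCat.of R (∀ k, G' k), _, _,
      ⟨G', hG', ⟨LinearEquiv.refl _ _⟩⟩, (InjStep.pi hs).congr (LinearEquiv.refl _ _) e.symm⟩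

lemma GI.prod (h : GI R M) (h' : GI R N) : GI R (M × N) := by
  let F : ULift.{u} Bool → ModuleCat.{u} R := fun b => if b.down then .of R M else .of R N
  have hF : ∀ b, GI R (F b) := by rintro ⟨_ | _⟩ <;> assumption
  let e : (∀ b, F b) ≃ₗ[R] M × N :=
    { toFun := fun x => (x ⟨true⟩, x ⟨false⟩)
      map_add' := fun _ _ => rfl
      map_smul' := fun _ _ => rfl
      invFun := fun x => fun b => match b with
        | ⟨true⟩ => x.1
        | ⟨false⟩ => x.2
      left_inv := fun x => by funext b; rcases b with ⟨_ | _⟩ <;> rfl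
      right_inv := fun x => rfl }
  exact GI.of_equiv e (GI.pi hF)

end GorensteinInjectiveModules

section Schanuel

variable {R : Type u} [CommRing R]
variable {A B C E E' G H K K' I M N : Type u}
  [AddCommGroup A] [Module R A] [AddCommGroup B] [Module R B] [AddCommGroup C] [Module R C]
  [AddCommGroup E] [Module R E] [AddCommGroup E'] [Module R E'] [AddCommGroup G] [Module R G]
  [AddCommGroup H] [Module R H] [AddCommGroup K] [Module R K] [AddCommGroup K'] [Module R K']
  [AddCommGroup I] [Module R I] [AddCommGroup M] [Module R M] [AddCommGroup N] [Module R N]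

lemma InjStep.ker (hE : Module.Injective R E) (p : E →ₗ[R] A) (hp : Function.Surjective p)
    (hl : InjLift p) : InjStep (LinearMap.ker p).subtype p :=
  ⟨Subtype.val_injective, fun x => by simp, hp, hE, hl⟩

/-- An exact sequence with injective left map and its kernel. -/
noncomputable def kerEquivOfExact (i : B →ₗ[R] E) (p : E →ₗ[R] A) (hi : Function.Injective i)
    (hex : Function.Exact i p) : B ≃ₗ[R] LinearMap.ker p :=
  LinearEquiv.ofBijective (i.codRestrict (LinearMap.ker p) fun x => hex.apply_apply_eq_zero x)
    ⟨fun x y h => hi (congrArg Subtype.val h), fun ⟨x, hx⟩ => by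
      obtain ⟨y, rfl⟩ := (hex x).1 hx
      exact ⟨y, rfl⟩⟩

lemma nonempty_equiv_of_surjective (p : A →ₗ[R] B) (hp : Function.Surjective p)
    (q : A →ₗ[R] C) (hq : Function.Surjective q) (h : ∀ x, p x = 0 ↔ q x = 0) :
    ∃ e : B ≃ₗ[R] C, ∀ x, e (p x) = q x := by
  obtain ⟨f, hf⟩ := p.exists_comp_eq_of_ker_le hp q (fun x => (h x).1)
  obtain ⟨g, hg⟩ := q.exists_comp_eq_of_ker_le hq p (fun x => (h x).2)
  have hf' := fun x => LinearMap.congr_fun hf x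
  have hg' := fun x => LinearMap.congr_fun hg x
  simp only [LinearMap.comp_apply] at hf' hg'
  refine ⟨LinearEquiv.ofLinearMap f g ?_ ?_, hf'⟩
  · ext x; obtain ⟨y, rfl⟩ := hq x; simp [hf', hg']
  · ext x; obtain ⟨y, rfl⟩ := hp x; simp [hf', hg']

lemma schanuel_ker (p : E →ₗ[R] G) (p' : E' →ₗ[R] G) (s : E →ₗ[R] E') (t : E' →ₗ[R] E)
    (hs : p' ∘ₗ s = p) (ht : p ∘ₗ t = p') :
    Nonempty ((LinearMap.ker p × E') ≃ₗ[R] (LinearMap.ker p' × E)) := by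
  have hs' := fun x => LinearMap.congr_fun hs x
  have ht' := fun x => LinearMap.congr_fun ht x
  simp only [LinearMap.comp_apply] at hs' ht'
  let f : (LinearMap.ker p × E') →ₗ[R] E := (LinearMap.ker p).subtype.coprod t
  let f' : (LinearMap.ker p' × E) →ₗ[R] E' := (LinearMap.ker p').subtype.coprod s
  have hf : ∀ x, p (f x) = p' x.2 := fun x => by
    simp [f, ht', LinearMap.mem_ker.1 x.1.2]
  have hf' : ∀ x, p' (f' x) = p x.2 := fun x => by
    simp [f', hs', LinearMap.mem_ker.1 x.1.2]
  let φ : (LinearMap.ker p × E') →ₗ[R] (LinearMap.ker p' × E) :=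
    (LinearMap.codRestrict _ (LinearMap.snd R _ _ - s ∘ₗ f) (fun x => by
      simp [hs', hf])).prod f
  let ψ : (LinearMap.ker p' × E) →ₗ[R] (LinearMap.ker p × E') :=
    (LinearMap.codRestrict _ (LinearMap.snd R _ _ - t ∘ₗ f') (fun x => by
      simp [ht', hf'])).prod f'
  have h1 : ∀ x, ((φ x).1 : E') = x.2 - s (f x) := fun _ => rfl
  have h2 : ∀ x, (φ x).2 = f x := fun _ => rfl
  have h3 : ∀ x, ((ψ x).1 : E) = x.2 - t (f' x) := fun _ => rfl
  have h4 : ∀ x, (ψ x).2 = f' x := fun _ => rfl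
  have h5 : ∀ x, f x = x.1 + t x.2 := fun _ => rfl
  have h6 : ∀ x, f' x = x.1 + s x.2 := fun _ => rfl
  refine ⟨LinearEquiv.ofLinearMap φ ψ ?_ ?_⟩
  · apply LinearMap.ext
    intro x
    have h7 : f (ψ x) = x.2 := by rw [h5, h3, h4]; abel
    refine Prod.ext (Subtype.ext ?_) ?_
    · change ((φ (ψ x)).1 : E') = x.1
      rw [h1, h7, h4, h6]; abel
    · exact h7
  · apply LinearMap.ext
    intro x
    have h7 : f' (φ x) = x.2 := by rw [h6, h1, h2]; abel
    refine Prod.ext (Subtype.ext ?_) ?_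
    · change ((ψ (φ x)).1 : E) = x.1
      rw [h3, h7, h2, h5]; abel
    · exact h7

lemma schanuel_coker (i : G →ₗ[R] E) (i' : G →ₗ[R] E') (p : E →ₗ[R] K) (p' : E' →ₗ[R] K')
    (hp : Function.Surjective p) (hp' : Function.Surjective p') (hex : Function.Exact i p)
    (hex' : Function.Exact i' p') (s : E →ₗ[R] E') (t : E' →ₗ[R] E)
    (hs : s ∘ₗ i = i') (ht : t ∘ₗ i' = i) : Nonempty ((K × E') ≃ₗ[R] (K' × E)) := by
  have hs' := fun x => LinearMap.congr_fun hs x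
  have ht' := fun x => LinearMap.congr_fun ht x
  simp only [LinearMap.comp_apply] at hs' ht'
  obtain ⟨e, -⟩ := nonempty_equiv_of_surjective (p.prodMap (LinearMap.id : E' →ₗ[R] E'))
    (hp.prodMap Function.surjective_id)
    ((p' ∘ₗ (LinearMap.snd R E E' + s ∘ₗ LinearMap.fst R E E')).prod
      (LinearMap.fst R E E' - t ∘ₗ (LinearMap.snd R E E' + s ∘ₗ LinearMap.fst R E E')))
    (by
      rintro ⟨k, x⟩
      obtain ⟨y, rfl⟩ := hp' k
      refine ⟨(x + t y, y - s (x + t y)), ?_⟩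
      simp)
    (by
      rintro ⟨x, y⟩
      change (p x, y) = 0 ↔ (p' (y + s x), x - t (y + s x)) = 0
      simp only [Prod.mk_eq_zero]
      constructor
      · rintro ⟨h, rfl⟩
        obtain ⟨g, rfl⟩ := (hex x).1 h
        simp [hs', ht', hex'.apply_apply_eq_zero]
      · rintro ⟨h, h2⟩
        obtain ⟨g, hg⟩ := (hex' _).1 h
        rw [← hg, ht', sub_eq_zero] at h2
        subst h2
        rw [hs'] at hg
        exact ⟨hex.apply_apply_eq_zero g, by simpa using hg.symm⟩)
  exact ⟨e⟩

lemma GI.of_prod (h : GI R (M × N)) : GI R M := by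
  refine GI.of_class (fun G => ∃ H : ModuleCat.{u} R, GI R (G × H)) (fun G hG => ?_)
    (fun G hG => ?_) ⟨ModuleCat.of R N, h⟩
  · obtain ⟨H, hGH⟩ := hG
    obtain ⟨E, K, i, p, hK, hs⟩ := hGH.exists_coresolution
    let j : G →ₗ[R] E := i ∘ₗ LinearMap.inl R G H
    let j' : H →ₗ[R] E := i ∘ₗ LinearMap.inr R G H
    have hj : Function.Injective j := hs.inj.comp LinearMap.inl_injective
    have hj' : Function.Injective j' := hs.inj.comp LinearMap.inr_injective
    let q := (LinearMap.range j).mkQ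
    let q' := (LinearMap.range j').mkQ
    have hq : Function.Exact j q := LinearMap.exact_map_mkQ_range j
    have hq' : Function.Exact j' q' := LinearMap.exact_map_mkQ_range j'
    have hex : Function.Exact (j.prodMap j') (q.prodMap q') := by
      rintro ⟨x, y⟩
      simp only [LinearMap.prodMap_apply, Prod.mk_eq_zero]
      rw [hq x, hq' y]
      constructor
      · rintro ⟨⟨a, rfl⟩, ⟨b, rfl⟩⟩; exact ⟨(a, b), rfl⟩
      · rintro ⟨⟨a, b⟩, h⟩
        obtain ⟨rfl, rfl⟩ := Prod.mk.inj h
        exact ⟨⟨a, rfl⟩, ⟨b, rfl⟩⟩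
    have hsurj : Function.Surjective (q.prodMap q') :=
      (Submodule.mkQ_surjective _).prodMap (Submodule.mkQ_surjective _)
    have hE2 := hs.injective.prod hs.injective
    have hl : InjLift (q.prodMap q') := hGH.injLift _ _ (hj.prodMap hj') hex hsurj
    refine ⟨E, ModuleCat.of R (E ⧸ LinearMap.range j), j, q,
      ⟨ModuleCat.of R ((E ⧸ LinearMap.range j') × E), ?_⟩,
      hj, hq, Submodule.mkQ_surjective _, hs.injective, ?_⟩
    · obtain ⟨s, hs1⟩ := hE2.out i hs.inj (j.prodMap j')
      obtain ⟨t, ht1⟩ := hs.injective.out (j.prodMap j') (hj.prodMap hj') i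
      obtain ⟨e⟩ := schanuel_coker i (j.prodMap j') p (q.prodMap q') hs.surj hsurj hs.exact hex
        s t (LinearMap.ext hs1) (LinearMap.ext ht1)
      exact GI.of_equiv (e.trans (LinearEquiv.prodAssoc R _ _ _)) (hK.prod hE2.gi)
    · intro I _ _ hI f
      obtain ⟨g, hg⟩ := hl I hI (LinearMap.inl R _ _ ∘ₗ f)
      refine ⟨LinearMap.fst R _ _ ∘ₗ g, ?_⟩
      ext x
      exact congrArg Prod.fst (LinearMap.congr_fun hg x)
  · obtain ⟨H, hGH⟩ := hG
    obtain ⟨E, K, i, p, hK, hs⟩ := hGH.exists_resolution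
    let q : E →ₗ[R] G := LinearMap.fst R G H ∘ₗ p
    let q' : E →ₗ[R] H := LinearMap.snd R G H ∘ₗ p
    have hE2 := hs.injective.prod hs.injective
    have hq : InjLift q := by
      intro I _ _ hI f
      obtain ⟨g, hg⟩ := hs.lift I hI (LinearMap.inl R _ _ ∘ₗ f)
      refine ⟨g, ?_⟩
      ext x
      exact congrArg Prod.fst (LinearMap.congr_fun hg x)
    have hq' : InjLift q' := by
      intro I _ _ hI f
      obtain ⟨g, hg⟩ := hs.lift I hI (LinearMap.inr R _ _ ∘ₗ f)
      refine ⟨g, ?_⟩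
      ext x
      exact congrArg Prod.snd (LinearMap.congr_fun hg x)
    have hsq : Function.Surjective q := Prod.fst_surjective.comp hs.surj
    refine ⟨E, ModuleCat.of R (LinearMap.ker q), _, q,
      ⟨ModuleCat.of R (LinearMap.ker q' × E), ?_⟩, InjStep.ker hs.injective q hsq hq⟩
    obtain ⟨s, hs1⟩ := hq _ hs.injective q
    have hl2 : InjLift (q.prodMap q') := by
      intro I _ _ hI f
      obtain ⟨g, hg⟩ := hq I hI (LinearMap.fst R _ _ ∘ₗ f)
      obtain ⟨g', hg'⟩ := hq' I hI (LinearMap.snd R _ _ ∘ₗ f)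
      refine ⟨g.prod g', ?_⟩
      apply LinearMap.ext
      intro x
      exact Prod.ext (LinearMap.congr_fun hg x) (LinearMap.congr_fun hg' x)
    obtain ⟨s, hs1⟩ := hl2 _ hs.injective p
    obtain ⟨t, ht1⟩ := hs.lift _ hE2 (q.prodMap q')
    obtain ⟨e⟩ := schanuel_ker p (q.prodMap q') s t hs1 ht1
    have e1 : (LinearMap.ker q × LinearMap.ker q') ≃ₗ[R] LinearMap.ker (q.prodMap q') :=
      kerEquivOfExact ((LinearMap.ker q).subtype.prodMap (LinearMap.ker q').subtype) _
        (Subtype.val_injective.prodMap Subtype.val_injective) (by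
          rintro ⟨x, y⟩
          simp only [LinearMap.prodMap_apply, Prod.mk_eq_zero]
          constructor
          · rintro ⟨hx, hy⟩; exact ⟨(⟨x, hx⟩, ⟨y, hy⟩), rfl⟩
          · rintro ⟨⟨a, b⟩, h⟩
            obtain ⟨rfl, rfl⟩ := Prod.mk.inj h
            exact ⟨a.2, b.2⟩)
    have e2 : LinearMap.ker p ≃ₗ[R] K := (kerEquivOfExact i p hs.inj hs.exact).symm
    exact GI.of_equiv ((((e2.symm.prodCongr (LinearEquiv.refl R (E × E))).trans e).trans
      (e1.symm.prodCongr (LinearEquiv.refl R E))).trans (LinearEquiv.prodAssoc R _ _ _))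
      (hK.prod hE2.gi)

lemma GI.of_retract (i : N →ₗ[R] M) (r : M →ₗ[R] N) (hr : r ∘ₗ i = LinearMap.id)
    (h : GI R M) : GI R N := by
  have hr' := fun x => LinearMap.congr_fun hr x
  simp only [LinearMap.comp_apply, LinearMap.id_apply] at hr'
  let e : M ≃ₗ[R] N × LinearMap.ker r := LinearEquiv.ofLinearMap
    (r.prod ((LinearMap.id - i ∘ₗ r).codRestrict _ (fun x => by simp [hr'])))
    (i.coprod (LinearMap.ker r).subtype)
    (by
      apply LinearMap.ext
      intro x
      refine Prod.ext ?_ (Subtype.ext ?_) <;>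
      simp [hr', LinearMap.mem_ker.1 x.2.2])
    (by ext x; simp)
  exact GI.of_prod (h.of_equiv e)

lemma GI.coker (h : GI R G) (hE : Module.Injective R E) (i : G →ₗ[R] E) (p : E →ₗ[R] K)
    (hi : Function.Injective i) (hex : Function.Exact i p) (hp : Function.Surjective p) :
    GI R K := by
  obtain ⟨E', K', i', p', hK, hs⟩ := h.exists_coresolution
  obtain ⟨s, hs1⟩ := hs.injective.out i hi i'
  obtain ⟨t, ht1⟩ := hE.out i' hs.inj i
  obtain ⟨e⟩ := schanuel_coker i i' p p' hp hs.surj hex hs.exact s t (LinearMap.ext hs1)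
    (LinearMap.ext ht1)
  exact GI.of_prod (GI.of_equiv e.symm (hK.prod hE.gi))

lemma GI.ker (h : GI R G) (hE : Module.Injective R E) (p : E →ₗ[R] G)
    (hp : InjLift p) : GI R (LinearMap.ker p) := by
  obtain ⟨E', K', i', p', hK, hs⟩ := h.exists_resolution
  obtain ⟨s, hs1⟩ := hs.lift _ hE p
  obtain ⟨t, ht1⟩ := hp _ hs.injective p'
  obtain ⟨e⟩ := schanuel_ker p p' s t hs1 ht1
  exact GI.of_prod (GI.of_equiv e.symm
    (GI.prod (hK.of_equiv (kerEquivOfExact i' p' hs.inj hs.exact)) hE.gi))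

end Schanuel

section GorensteinInjectiveComplexes

variable {R : Type u} [CommRing R]

/-- The contractible complex with `E × E` in each degree and differential `(x, y) ↦ (0, x)`. -/
noncomputable def diskComplex (E : ModuleCat.{u} R) : ChainComplex (ModuleCat.{u} R) ℤ where
  X _ := ModuleCat.of R (E × E)
  d i j := if i = j + 1 then ModuleCat.ofHom (LinearMap.inr R E E ∘ₗ LinearMap.fst R E E) else 0
  shape i j h := if_neg fun h' => h h'.symm
  d_comp_d' i j k _ _ := by
    split_ifs <;> simp
    ext : 3 <;> simp

lemma diskComplex_d (E : ModuleCat.{u} R) (i j : ℤ) (h : i = j + 1) (x y : E) :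
    (diskComplex E).d i j (x, y) = (0, x) := by
  simp only [diskComplex, if_pos h]
  rfl

/-- The map out of a disk complex given by its components on the first factor. -/
noncomputable def diskOut {E : ModuleCat.{u} R} {K : ChainComplex (ModuleCat.{u} R) ℤ}
    (φ : ∀ m, E →ₗ[R] K.X m) : diskComplex E ⟶ K where
  f m := ModuleCat.ofHom ((φ m).coprod ((K.d (m + 1) m).hom ∘ₗ φ (m + 1)))
  comm' i j h := by
    obtain rfl : j + 1 = i := h
    ext x
    obtain ⟨x, y⟩ : E × E := x
    change K.d (j+1) j (φ (j+1) x + K.d (j+1+1) (j+1) (φ (j+1+1) y)) =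
      ((φ j).coprod ((K.d (j + 1) j).hom ∘ₗ φ (j + 1))) ((diskComplex E).d (j+1) j (x, y))
    rw [diskComplex_d _ _ _ rfl, map_add, ← ModuleCat.comp_apply, K.d_comp_d]
    simp

lemma diskOut_f {E : ModuleCat.{u} R} {K : ChainComplex (ModuleCat.{u} R) ℤ}
    (φ : ∀ m, E →ₗ[R] K.X m) (m : ℤ) (x y : E) :
    (diskOut φ).f m (x, y) = φ m x + K.d (m+1) m (φ (m+1) y) := rfl

/-- The map into a disk complex given by its components on the second factor. -/
noncomputable def diskIn {E : ModuleCat.{u} R} {K : ChainComplex (ModuleCat.{u} R) ℤ}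
    (ψ : ∀ m, K.X m →ₗ[R] E) : K ⟶ diskComplex E where
  f m := ModuleCat.ofHom ((ψ (m - 1) ∘ₗ (K.d m (m - 1)).hom).prod (ψ m))
  comm' i j h := by
    obtain rfl : j + 1 = i := h
    have key : ∀ l, l = j → ∀ x, ψ l (K.d (j+1) l x) = ψ j (K.d (j+1) j x) := by
      rintro l rfl x; rfl
    ext x
    change (diskComplex E).d (j+1) j (ψ (j+1-1) (K.d (j+1) (j+1-1) x), ψ (j+1) x) =
      (ψ (j-1) (K.d j (j-1) (K.d (j+1) j x)), ψ j (K.d (j+1) j x))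
    rw [diskComplex_d _ _ _ rfl, ← ModuleCat.comp_apply (K.d (j+1) j), K.d_comp_d,
      key _ (by ring)]
    simp
    rfl

lemma diskOut_ext {E : ModuleCat.{u} R} {K : ChainComplex (ModuleCat.{u} R) ℤ}
    {f g : diskComplex E ⟶ K} (h : ∀ m (x : E), f.f m (x, 0) = g.f m (x, 0)) : f = g := by
  have hd : ∀ (f : diskComplex E ⟶ K) m (y : E),
      f.f m ((0, y) : E × E) = K.d (m+1) m (f.f (m+1) ((y, 0) : E × E)) := by
    intro f m y
    have := congrArg (fun k => k ((y, 0) : E × E)) (congrArg ModuleCat.Hom.hom (f.comm (m+1) m))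
    change K.d (m+1) m (f.f (m+1) ((y, 0) : E × E)) =
      f.f m ((diskComplex E).d (m+1) m ((y, 0) : E × E)) at this
    rw [this, diskComplex_d _ _ _ rfl]
  ext m z
  obtain ⟨x, y⟩ : E × E := z
  have e : (x, y) = ((x, 0) : E × E) + (0, y) := by simp
  change f.f m ((x, y) : E × E) = g.f m ((x, y) : E × E)
  rw [e]
  refine (map_add (f.f m).hom _ _).trans (Eq.trans ?_ (map_add (g.f m).hom _ _).symm)
  refine congr_arg₂ _ (h m x) ?_
  exact (hd f m y).trans ((congrArg _ (h (m+1) y)).trans (hd g m y).symm)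

lemma diskIn_ext {E : ModuleCat.{u} R} {K : ChainComplex (ModuleCat.{u} R) ℤ}
    {f g : K ⟶ diskComplex E}
    (h : ∀ m (x : K.X m), (f.f m x : E × E).2 = (g.f m x : E × E).2) : f = g := by
  have hd : ∀ (f : K ⟶ diskComplex E) m (x : K.X m),
      (f.f m x : E × E).1 = (f.f (m-1) (K.d m (m-1) x) : E × E).2 := by
    intro f m x
    have := congrArg (fun k => k x) (congrArg ModuleCat.Hom.hom (f.comm m (m-1)))
    change (diskComplex E).d m (m-1) ((f.f m x : E × E).1, (f.f m x : E × E).2) =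
      f.f (m-1) (K.d m (m-1) x) at this
    rw [diskComplex_d _ _ _ (by ring)] at this
    exact congrArg (fun z : E × E => z.2) this
  ext m z
  refine Prod.ext ?_ (h m z)
  exact (hd f m z).trans ((h (m-1) _).trans (hd g m z).symm)

lemma HomologicalComplex.mono_iff_injective {K L : ChainComplex (ModuleCat.{u} R) ℤ} (f : K ⟶ L) :
    Mono f ↔ ∀ m, Function.Injective (f.f m) := by
  constructor
  · intro h m
    exact (ModuleCat.mono_iff_injective _).1 inferInstance
  · intro h
    have := fun m => (ModuleCat.mono_iff_injective _).2 (h m)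
    exact HomologicalComplex.mono_of_mono_f f this

lemma HomologicalComplex.epi_iff_surjective {K L : ChainComplex (ModuleCat.{u} R) ℤ} (f : K ⟶ L) :
    Epi f ↔ ∀ m, Function.Surjective (f.f m) := by
  constructor
  · intro h m
    exact (ModuleCat.epi_iff_surjective _).1 inferInstance
  · intro h
    have := fun m => (ModuleCat.epi_iff_surjective _).2 (h m)
    exact HomologicalComplex.epi_of_epi_f f this

lemma injective_diskComplex {E : ModuleCat.{u} R} (hE : Module.Injective R E) :
    Injective (diskComplex E) where
  factors {K L} g i hi := by
    have hi' := (HomologicalComplex.mono_iff_injective i).1 hi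
    choose ψ hψ using fun m => hE.out (i.f m).hom (hi' m) (LinearMap.snd R E E ∘ₗ (g.f m).hom)
    refine ⟨diskIn ψ, diskIn_ext fun m x => ?_⟩
    exact hψ m x

lemma injective_X_of_injective {J : ChainComplex (ModuleCat.{u} R) ℤ} (hJ : Injective J) (n : ℤ) :
    Module.Injective R (J.X n) where
  out X Y _ _ _ _ f hf g := by
    let i : diskComplex (ModuleCat.of R X) ⟶ diskComplex (ModuleCat.of R Y) :=
      diskOut (fun m => LinearMap.inl R Y Y ∘ₗ f)
    have hi : Mono i := by
      rw [HomologicalComplex.mono_iff_injective]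
      rintro m ⟨x, y⟩ ⟨x', y'⟩ h
      have key : ∀ x y : X, i.f m ((x, y) : X × X) = ((f x, f y) : Y × Y) := by
        intro x y
        refine (diskOut_f _ _ _ _).trans ?_
        have := diskComplex_d (ModuleCat.of R Y) (m+1) m rfl (f y) 0
        refine (congrArg _ this).trans ?_
        exact Prod.ext (add_zero _) (zero_add _)
      have h' := (key x y).symm.trans (h.trans (key x' y'))
      exact Prod.ext (hf (congrArg (fun z : Y × Y => z.1) h'))
        (hf (congrArg (fun z : Y × Y => z.2) h'))
    let φ : ∀ m, X →ₗ[R] J.X m := Function.update 0 n g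
    obtain ⟨k, hk⟩ := hJ.factors (diskOut (E := ModuleCat.of R X) φ) i
    refine ⟨(k.f n).hom ∘ₗ LinearMap.inl R Y Y, fun x => ?_⟩
    have h1 := congrArg (fun k => k ((x, 0) : X × X))
      (congrArg ModuleCat.Hom.hom (HomologicalComplex.congr_hom hk n))
    have h2 : (diskOut (E := ModuleCat.of R X) φ).f n ((x, 0) : X × X) = g x := by
      refine (diskOut_f _ _ _ _).trans ?_
      rw [map_zero, map_zero, add_zero]
      simp [φ]
    refine Eq.trans ?_ (h1.trans h2)
    change k.f n ((f x, 0) : Y × Y) = k.f n (i.f n ((x, 0) : X × X))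
    have h3 : i.f n ((x, 0) : X × X) = ((f x, 0) : Y × Y) := by
      refine (diskOut_f (K := diskComplex (ModuleCat.of R Y)) (E := ModuleCat.of R X)
        (fun m => LinearMap.inl R Y Y ∘ₗ f) n x 0).trans ?_
      rw [map_zero, map_zero, add_zero]
      rfl
    rw [h3]

lemma exists_mono_diskComplex (K : ChainComplex (ModuleCat.{u} R) ℤ) :
    ∃ (E : ModuleCat.{u} R) (_ : Module.Injective R E) (i : K ⟶ diskComplex E), Mono i := by
  let P : ModuleCat.{u} R := ModuleCat.of R (∀ k : ℤ, K.X k)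
  let E := Injective.under P
  have hE : Injective E := inferInstanceAs (Injective (Injective.under P))
  refine ⟨E, (Module.injective_iff_injective_object R E).2 hE,
    diskIn (fun m => (Injective.ι P).hom ∘ₗ LinearMap.single R (fun k => K.X k) m), ?_⟩
  rw [HomologicalComplex.mono_iff_injective]
  intro m x y h
  have h' := congrArg (fun z : E × E => z.2) h
  have hι := (ModuleCat.mono_iff_injective (Injective.ι P)).1 inferInstance
  exact Pi.single_injective m (hι h')

lemma liftsInjectives_of_injLift {B C : ChainComplex (ModuleCat.{u} R) ℤ} (p : B ⟶ C)
    (h : ∀ m, InjLift (p.f m).hom) : LiftsInjectives p := by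
  intro J hJ f
  obtain ⟨E, hE, i, hi⟩ := exists_mono_diskComplex J
  obtain ⟨r, hr⟩ := hJ.factors (𝟙 J) i
  choose φ hφ using fun m => h m _ hE (((r ≫ f).f m).hom ∘ₗ LinearMap.inl R E E)
  refine ⟨i ≫ diskOut φ, ?_⟩
  have : diskOut φ ≫ p = r ≫ f := by
    refine diskOut_ext fun m x => ?_
    refine Eq.trans ?_ (LinearMap.congr_fun (hφ m) x)
    change p.f m ((diskOut φ).f m ((x, 0) : E × E)) = p.f m (φ m x)
    refine congrArg _ ?_
    refine (diskOut_f _ _ _ _).trans ?_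
    rw [map_zero, map_zero, add_zero]
  rw [Category.assoc, this, reassoc_of% hr]

lemma LiftsInjectives.injLift {B C : ChainComplex (ModuleCat.{u} R) ℤ} {p : B ⟶ C}
    (h : LiftsInjectives p) (n : ℤ) : InjLift (p.f n).hom := by
  intro I _ _ hI f
  let φ : ∀ m, I →ₗ[R] C.X m := Function.update 0 n f
  obtain ⟨g, hg⟩ := h _ (injective_diskComplex (E := ModuleCat.of R I) hI)
    (diskOut (E := ModuleCat.of R I) φ)
  refine ⟨(g.f n).hom ∘ₗ LinearMap.inl R I I, ?_⟩
  ext x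
  have h1 := congrArg (fun k => k ((x, 0) : I × I))
      (congrArg ModuleCat.Hom.hom (HomologicalComplex.congr_hom hg n))
  refine h1.trans ?_
  refine (diskOut_f _ _ _ _).trans ?_
  rw [map_zero, map_zero, add_zero]
  simp [φ]

lemma shortExact_iff_function {K L M : ChainComplex (ModuleCat.{u} R) ℤ} (f : K ⟶ L) (g : L ⟶ M)
    (w : f ≫ g = 0) : (ShortComplex.mk f g w).ShortExact ↔
      ∀ n, Function.Injective (f.f n).hom ∧ Function.Exact (f.f n).hom (g.f n).hom ∧
        Function.Surjective (g.f n).hom := by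
  rw [HomologicalComplex.shortExact_iff_degreewise_shortExact]
  refine forall_congr' fun n => ⟨fun h => ⟨h.moduleCat_injective_f,
    (ShortComplex.ShortExact.moduleCat_exact_iff_function_exact _).1 h.exact,
    h.moduleCat_surjective_g⟩, fun h => ModuleCat.shortComplex_shortExact _ h.2.1 h.1 h.2.2⟩

theorem isGorensteinInjective_complex_iff (K : ChainComplex (ModuleCat.{u} R) ℤ) :
    IsGorensteinInjective K ↔ ∀ n, GI R (K.X n) := by
  constructor
  · intro hK n
    have step : ∀ (G G' : ChainComplex (ModuleCat.{u} R) ℤ) (n : ℤ), IsInjectiveStep G' G →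
        ∃ (E : ModuleCat.{u} R) (i : G.X n →ₗ[R] E) (p : E →ₗ[R] G'.X n), InjStep i p := by
      rintro G G' n ⟨E, i, p, w, hs, hE, hl⟩
      have hs' := (shortExact_iff_function i p w).1 hs n
      exact ⟨E.X n, (i.f n).hom, (p.f n).hom, hs'.1, hs'.2.1, hs'.2.2,
        injective_X_of_injective hE n, hl.injLift n⟩
    refine GI.of_class (fun M => ∃ G : ChainComplex (ModuleCat.{u} R) ℤ, IsGorensteinInjective G ∧
      ∃ n, M = G.X n) ?_ ?_ ⟨K, hK, n, rfl⟩
    · rintro _ ⟨G, hG, n, rfl⟩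
      obtain ⟨⟨G', h1, h2⟩, -⟩ := isGorensteinClass_isGorensteinInjective _ hG
      obtain ⟨E, i, p, h⟩ := step _ _ n h2
      exact ⟨E, _, i, p, ⟨G', h1, n, rfl⟩, h⟩
    · rintro _ ⟨G, hG, n, rfl⟩
      obtain ⟨-, ⟨G', h1, h2⟩⟩ := isGorensteinClass_isGorensteinInjective _ hG
      obtain ⟨E, i, p, h⟩ := step _ _ n h2
      exact ⟨E, _, i, p, ⟨G', h1, n, rfl⟩, h⟩
  · intro hK
    refine isGorensteinInjective_of_class
      (P := fun K : ChainComplex (ModuleCat.{u} R) ℤ => ∀ n, GI R (K.X n)) ?_ hK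
    intro K hK
    constructor
    · obtain ⟨E, hE, i, hi⟩ := exists_mono_diskComplex K
      have hs : (ShortComplex.mk i (cokernel.π i) (cokernel.condition i)).ShortExact :=
        { exact := ShortComplex.exact_cokernel i }
      have hs' := (shortExact_iff_function _ _ _).1 hs
      refine ⟨cokernel i, fun n => ?_, diskComplex E, i, cokernel.π i, cokernel.condition i, hs,
        injective_diskComplex hE, liftsInjectives_of_injLift _ fun n => ?_⟩
      · exact (hK n).coker (injective_X_of_injective (injective_diskComplex hE) n) _ _ (hs' n).1
          (hs' n).2.1 (hs' n).2.2
      · exact (hK n).injLift _ _ (hs' n).1 (hs' n).2.1 (hs' n).2.2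
    · choose E G' i p hG hs using fun n => (hK n).exists_resolution
      let F : ModuleCat.{u} R := ModuleCat.of R (∀ n, E n)
      have hF : Module.Injective R F := by
        have := fun n => (hs n).injective
        exact Module.Injective.pi ..
      let q : diskComplex F ⟶ K := diskOut (fun n => p n ∘ₗ LinearMap.proj n)
      have hq : ∀ n (x : F), q.f n ((x, 0) : F × F) = p n (x n) := by
        intro n x
        refine (diskOut_f _ _ _ _).trans ?_
        rw [map_zero, map_zero, add_zero]
        rfl
      have hql : ∀ n, InjLift (q.f n).hom := by
        intro n I _ _ hI f
        obtain ⟨g, hg⟩ := (hs n).lift I hI f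
        refine ⟨LinearMap.inl R F F ∘ₗ LinearMap.single R (fun n => E n) n ∘ₗ g, ?_⟩
        ext x
        refine (hq n _).trans ?_
        change p n ((Pi.single n (g x) : ∀ n, E n) n) = f x
        rw [Pi.single_eq_same]
        exact LinearMap.congr_fun hg x
      have hqs : Epi q := by
        rw [HomologicalComplex.epi_iff_surjective]
        intro n y
        obtain ⟨x, hx⟩ := (hs n).surj y
        refine ⟨((Pi.single n x : ∀ n, E n), 0), (hq n _).trans ?_⟩
        rw [Pi.single_eq_same, hx]
      have hs2 : (ShortComplex.mk (kernel.ι q) q (kernel.condition q)).ShortExact :=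
        { exact := ShortComplex.exact_kernel q }
      have hs' := (shortExact_iff_function _ _ _).1 hs2
      refine ⟨kernel q, fun n => ?_, diskComplex F, kernel.ι q, q, kernel.condition q, hs2,
        injective_diskComplex hF, liftsInjectives_of_injLift _ hql⟩
      exact ((hK n).ker (injective_X_of_injective (injective_diskComplex hF) n) _
        (hql n)).of_equiv (kerEquivOfExact _ _ (hs' n).1 (hs' n).2.1).symm

end GorensteinInjectiveComplexes

section Purity

variable {R : Type u} [CommRing R]
variable {M M' Y : Type u} [AddCommGroup M] [Module R M] [AddCommGroup M'] [Module R M']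
  [AddCommGroup Y] [Module R Y]

/-- Every finite linear system with constants in `N` that is solvable in `M` is solvable in `N`. -/
def IsPure (N : Submodule R M) : Prop :=
  ∀ (k l : ℕ) (r : Fin k → Fin l → R) (x : Fin l → M), (∀ a, ∑ b, r a b • x b ∈ N) →
    ∃ y : Fin l → M, (∀ b, y b ∈ N) ∧ ∀ a, ∑ b, r a b • y b = ∑ b, r a b • x b

lemma isPure_bot : IsPure (⊥ : Submodule R M) := fun k l r x h =>
  ⟨0, fun _ => rfl, fun a => by rw [(Submodule.mem_bot R).1 (h a)]; simp⟩

/-- The preimage of a pure submodule along a surjection with pure kernel is pure. -/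
lemma IsPure.comap (f : M →ₗ[R] M') (hf : Function.Surjective f) (h : IsPure (LinearMap.ker f))
    {N : Submodule R M'} (hN : IsPure N) : IsPure (N.comap f) := by
  intro k l r x hx
  obtain ⟨y, hy, hxy⟩ := hN k l r (fun b => f (x b)) (fun a => by simpa using hx a)
  choose z hz using fun b => hf (y b)
  obtain ⟨w, hw, hxw⟩ := h k l r (fun b => x b - z b) (fun a => by
    simpa [smul_sub, hz, sub_eq_zero] using (hxy a).symm)
  refine ⟨fun b => z b + w b, fun b => ?_, fun a => ?_⟩
  · have := LinearMap.mem_ker.1 (hw b)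
    simpa [hz, this] using hy b
  · simp only [smul_add, Finset.sum_add_distrib, hxw a, smul_sub, Finset.sum_sub_distrib]
    abel

/-- The union of a chain of pure submodules is pure. -/
lemma IsPure.iSup_of_directed {ι : Type*} [Nonempty ι] (N : ι → Submodule R M)
    (hd : Directed (· ≤ ·) N) (h : ∀ i, IsPure (N i)) : IsPure (⨆ i, N i) := by
  intro k l r x hx
  choose j hj using fun a => (Submodule.mem_iSup_of_directed N hd).1 (hx a)
  obtain ⟨i, hi⟩ := hd.finite_le j
  obtain ⟨y, hy, hxy⟩ := h i k l r x (fun a => hi a (hj a))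
  exact ⟨y, fun b => Submodule.mem_iSup_of_mem i (hy b), hxy⟩

/-- The inclusion of a pure submodule stays injective after tensoring. -/
lemma IsPure.lTensor_injective {N : Submodule R M} (hN : IsPure N) :
    Function.Injective (N.subtype.lTensor Y) := by
  rw [injective_iff_map_eq_zero]
  intro x hx
  obtain ⟨k, y, n, rfl⟩ := TensorProduct.exists_sum_tmul_eq x
  have h0 : (Submodule.span R (Set.range y)).FG := Submodule.fg_span (Set.finite_range y)
  let y' : Fin k → Submodule.span R (Set.range y) :=
    fun j => ⟨y j, Submodule.subset_span ⟨j, rfl⟩⟩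
  obtain ⟨J, hJ, hle, he⟩ := h0.exists_rTensor_fg_inclusion_eq
    (x := ∑ j, y' j ⊗ₜ[R] (n j : M)) (y := 0) (by simpa [map_sum] using hx)
  obtain ⟨l, m, hm⟩ := Submodule.fg_iff_exists_fin_generating_family.1 hJ
  have hmJ : ∀ b, m b ∈ J := fun b => hm ▸ Submodule.subset_span ⟨b, rfl⟩
  let m' : Fin l → J := fun b => ⟨m b, hmJ b⟩
  have hm' : Submodule.span R (Set.range m') = ⊤ := by
    apply Submodule.map_injective_of_injective J.subtype_injective
    rw [Submodule.map_span, Submodule.map_top, Submodule.range_subtype, ← Set.range_comp]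
    exact hm
  have hyJ : ∀ j, y j ∈ J := fun j => hle (y' j).2
  choose c hc using fun j => (Submodule.mem_span_range_iff_exists_fun R).1
    (hm' ▸ Submodule.mem_top : (⟨y j, hyJ j⟩ : J) ∈ Submodule.span R (Set.range m'))
  have hc' : ∀ j, y j = ∑ b, c j b • m b := fun j => by
    simpa using congrArg J.subtype (hc j).symm
  have he' : ∑ b, m' b ⊗ₜ[R] (∑ j, c j b • (n j : M)) = 0 := by
    rw [map_zero, map_sum] at he
    rw [← he]
    have : ∀ j, (LinearMap.rTensor M (Submodule.inclusion hle)) (y' j ⊗ₜ[R] (n j : M)) =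
        ∑ b, m' b ⊗ₜ[R] (c j b • (n j : M)) := fun j => by
      rw [LinearMap.rTensor_tmul]
      change (⟨y j, hyJ j⟩ : J) ⊗ₜ[R] _ = _
      rw [← hc j, TensorProduct.sum_tmul]
      simp only [TensorProduct.smul_tmul]
    simp only [this, TensorProduct.tmul_sum]
    exact Finset.sum_comm
  obtain ⟨q, a, z, hz, ha⟩ := TensorProduct.vanishesTrivially_of_sum_tmul_eq_zero R hm' he'
  obtain ⟨w, hw, hwz⟩ := hN l q (fun b t => a b t) z (fun b => by
    rw [← hz b]; exact Submodule.sum_mem _ fun j _ => Submodule.smul_mem _ _ (n j).2)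
  have h1 : ∀ b, ∑ j, c j b • n j = ∑ t, a b t • (⟨w t, hw t⟩ : N) := fun b => by
    apply N.subtype_injective
    simp only [map_sum, map_smul, Submodule.subtype_apply]
    rw [hwz b, ← hz b]
  have h2 : ∑ j, y j ⊗ₜ[R] n j = ∑ b, m b ⊗ₜ[R] (∑ j, c j b • n j) := by
    simp only [hc', TensorProduct.sum_tmul, TensorProduct.tmul_sum, TensorProduct.smul_tmul]
    exact Finset.sum_comm
  rw [h2]
  refine TensorProduct.sum_tmul_eq_zero_of_vanishesTrivially R ⟨q, a, fun t => ⟨w t, hw t⟩, h1, ?_⟩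
  intro t
  simpa [m'] using congrArg J.subtype (ha t)

/-- Maps from a pure submodule to a character module extend. -/
lemma IsPure.exists_extend {N : Submodule R M} (hN : IsPure N) (f : N →ₗ[R] CharacterModule Y) :
    ∃ g : M →ₗ[R] CharacterModule Y, g ∘ₗ N.subtype = f := by
  have := hN.lTensor_injective (Y := Y)
  rw [LinearMap.lTensor_inj_iff_rTensor_inj, rTensor_injective_iff_lcomp_surjective] at this
  exact this f

/-- Pure submodules of injective modules over a noetherian ring are injective. -/
lemma IsPure.injective [IsNoetherianRing R] {N : Submodule R M} (hN : IsPure N)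
    (hM : Module.Injective R M) : Module.Injective R N := by
  apply Module.Baer.injective
  intro I g
  obtain ⟨l, m, hm⟩ := Submodule.fg_iff_exists_fin_generating_family.1 (IsNoetherian.noetherian I)
  obtain ⟨h, hh⟩ := Module.Baer.of_injective hM I (N.subtype ∘ₗ g)
  have hmI : ∀ b, m b ∈ I := fun b => hm ▸ Submodule.subset_span ⟨b, rfl⟩
  have key : ∀ b, m b • h 1 = g ⟨m b, hmI b⟩ := fun b => by
    rw [← map_smul, smul_eq_mul, mul_one]; exact hh _ (hmI b)
  obtain ⟨y, hy, hxy⟩ := hN l 1 (fun b _ => m b) (fun _ => h 1) (fun b => by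
    simp [key b])
  refine ⟨LinearMap.toSpanSingleton R N ⟨y 0, hy 0⟩, fun x hx => ?_⟩
  rw [LinearMap.toSpanSingleton_apply]
  have hx' := hx
  rw [← hm] at hx'
  obtain ⟨c, hc⟩ := (Submodule.mem_span_range_iff_exists_fun R).1 hx'
  have : (⟨x, hx⟩ : I) = ∑ b, c b • (⟨m b, hmI b⟩ : I) := by
    apply I.subtype_injective; simpa using hc.symm
  apply N.subtype_injective
  rw [this, map_sum]
  simp only [map_smul, map_sum, Submodule.subtype_apply, ← key, ← hc]
  rw [Finset.sum_smul]
  refine Finset.sum_congr rfl fun b _ => ?_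
  have := hxy b
  simp at this
  rw [smul_assoc, this]

end Purity

section LowenheimSkolem

open Cardinal

lemma Cardinal.mk_sigma_le_of_le {κ : Cardinal.{u}} (hκ : ℵ₀ ≤ κ) {ι : Type u} {f : ι → Type u}
    (hι : #ι ≤ κ) (hf : ∀ i, #(f i) ≤ κ) : #(Σ i, f i) ≤ κ := by
  rw [mk_sigma]
  refine (sum_le_mk_mul_iSup _).trans (mul_le_of_le hκ hι (ciSup_le' hf))

lemma Cardinal.mk_fin_fun_le {κ : Cardinal.{u}} (hκ : ℵ₀ ≤ κ) {α : Type u} (hα : #α ≤ κ) (n : ℕ) :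
    #(Fin n → α) ≤ κ := by
  have : #(Fin n → α) = #α ^ n := by simp
  rw [this]
  exact (Cardinal.power_le_power_right hα).trans (power_nat_le hκ)

variable {R : Type u} [CommRing R] {M : Type u} [AddCommGroup M] [Module R M]

variable (R) in
/-- The function symbols choosing solutions of linear systems, together with `ι` further symbols. -/
def systemLanguage (ι : Type u) : FirstOrder.Language.{u, 0} where
  Functions n := (Σ k l : ULift.{u} ℕ, (Fin k.down → Fin l.down → R) × (Fin k.down → Fin n → R) ×
    ULift.{u} (Fin l.down)) ⊕ ι
  Relations _ := Empty

open Classical in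
/-- A module with endofunctions `T i` as a structure for `systemLanguage`. -/
noncomputable abbrev systemStructure {ι : Type u} (T : ι → M → M) :
    (systemLanguage R ι).Structure M where
  funMap f c := match f with
    | .inl ⟨k, l, r, s, j⟩ =>
      if h : ∃ x : Fin l.down → M, ∀ a : Fin k.down, ∑ b, r a b • x b = ∑ j, s a j • c j
        then h.choose j.down else 0
    | .inr i => T i (∑ j, c j)
  RelMap r := r.elim

lemma card_systemLanguage_functions_le {R ι : Type u} {κ : Cardinal.{u}} (hκ : ℵ₀ ≤ κ)
    (hR : #R ≤ κ) (hι : #ι ≤ κ) : #(Σ n, (systemLanguage R ι).Functions n) ≤ κ := by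
  have hN : #(ULift.{u} ℕ) ≤ κ := by simpa using hκ
  have e : #(Σ n, (systemLanguage R ι).Functions n) =
      #(Σ n : ULift.{u} ℕ, (systemLanguage R ι).Functions n.down) :=
    mk_congr (Equiv.sigmaCongrLeft' Equiv.ulift.symm)
  rw [e]
  refine mk_sigma_le_of_le hκ hN fun n => ?_
  change #((_ ⊕ _ : Type u)) ≤ κ
  rw [mk_sum, lift_id, lift_id]
  refine add_le_of_le hκ (mk_sigma_le_of_le hκ hN fun k => mk_sigma_le_of_le hκ hN fun l => ?_) hι
  simp only [mk_prod, lift_id]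
  have h1 : #(ULift.{u} (Fin l.down)) ≤ κ := by
    simpa using natCast_lt_aleph0.le.trans hκ
  exact mul_le_of_le hκ (mk_fin_fun_le hκ (mk_fin_fun_le hκ hR _) _)
    (mul_le_of_le hκ (mk_fin_fun_le hκ (mk_fin_fun_le hκ hR _) _) h1)

lemma exists_isPure_card_le {ι : Type u} (T : ι → M → M) {κ : Cardinal.{u}} (hκ : ℵ₀ ≤ κ)
    (hR : #R ≤ κ) (hι : #ι ≤ κ) (S : Set M) (hS : #S ≤ κ) :
    ∃ N : Submodule R M, S ⊆ N ∧ IsPure N ∧ (∀ i, ∀ x ∈ N, T i x ∈ N) ∧ #N ≤ κ := by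
  classical
  let _ := systemStructure (R := R) T
  let C := FirstOrder.Language.Substructure.closure (systemLanguage R ι) S
  have hsys : ∀ (n k l : ℕ) (r : Fin k → Fin l → R) (s : Fin k → Fin n → R) (c : Fin n → M),
      (∀ j, c j ∈ C) → (∃ x : Fin l → M, ∀ a, ∑ b, r a b • x b = ∑ j, s a j • c j) →
      ∃ x : Fin l → M, (∀ b, x b ∈ C) ∧ ∀ a, ∑ b, r a b • x b = ∑ j, s a j • c j := by
    intro n k l r s c hc h
    refine ⟨h.choose, fun b => ?_, h.choose_spec⟩
    have := C.fun_mem (Sum.inl ⟨⟨k⟩, ⟨l⟩, r, s, ⟨b⟩⟩) c hc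
    change (if h : ∃ x : Fin l → M, ∀ a, ∑ b, r a b • x b = ∑ j, s a j • c j
        then h.choose b else 0) ∈ C at this
    rwa [dif_pos h] at this
  have hone : ∀ (n : ℕ) (s : Fin n → R) (c : Fin n → M), (∀ j, c j ∈ C) → ∑ j, s j • c j ∈ C := by
    intro n s c hc
    obtain ⟨x, hx, h⟩ := hsys n 1 1 (fun _ _ => 1) (fun _ => s) c hc
      ⟨fun _ => ∑ j, s j • c j, fun _ => by simp⟩
    have := h 0
    simp only [Finset.univ_unique, one_smul, Finset.sum_singleton] at this
    rw [← this]
    exact hx _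
  let N : Submodule R M :=
    { carrier := C
      zero_mem' := by simpa using hone 0 (fun _ => 0) (fun _ => 0) (fun j => j.elim0)
      add_mem' := fun {a b} ha hb => by
        simpa using hone 2 (fun _ => 1) ![a, b] (fun j => by fin_cases j <;> assumption)
      smul_mem' := fun r a ha => by simpa using hone 1 (fun _ => r) (fun _ => a) (fun _ => ha) }
  refine ⟨N, FirstOrder.Language.Substructure.subset_closure, ?_, ?_, ?_⟩
  · intro k l r x hx
    obtain ⟨y, hy, h⟩ := hsys k k l r (fun a j => if a = j then 1 else 0)
      (fun a => ∑ b, r a b • x b) hx ⟨x, fun a => by simp⟩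
    exact ⟨y, hy, fun a => by simpa using h a⟩
  · intro i x hx
    have := C.fun_mem (n := 1) (Sum.inr i) (fun _ => x) (fun _ => hx)
    change T i (∑ _j : Fin 1, x) ∈ C at this
    rw [Fin.sum_const, one_smul] at this
    exact this
  · have h := FirstOrder.Language.Substructure.lift_card_closure_le (L := systemLanguage R ι) (s := S)
    rw [lift_id, lift_id, lift_id] at h
    exact h.trans (max_le hκ (add_le_of_le hκ hS (card_systemLanguage_functions_le hκ hR hι)))

end LowenheimSkolem

section SmallModules

open Cardinal

variable (R : Type u) [CommRing R]

/-- The cardinality bound for small modules. -/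
noncomputable def smallCard : Cardinal.{u} := max ℵ₀ #R

/-- Every small module is a quotient of this free module. -/
abbrev SmallFree : Type u := (smallCard R).out →₀ R

variable {R}
variable {M N I : Type u} [AddCommGroup M] [Module R M] [AddCommGroup N] [Module R N]
  [AddCommGroup I] [Module R I]

lemma exists_smallFree_surjective (h : #M ≤ smallCard R) :
    ∃ p : SmallFree R →ₗ[R] M, Function.Surjective p := by
  rw [← mk_out (smallCard R), le_def] at h
  obtain ⟨e⟩ := h
  refine ⟨Finsupp.linearCombination R (Function.invFun e), ?_⟩
  intro x
  obtain ⟨y, rfl⟩ := Function.invFun_surjective e.injective x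
  exact ⟨Finsupp.single y 1, by simp⟩

lemma exists_isPure_small {ι : Type u} (T : ι → M → M) (hι : #ι ≤ ℵ₀) (x : M) :
    ∃ N : Submodule R M, x ∈ N ∧ IsPure N ∧ (∀ i, ∀ y ∈ N, T i y ∈ N) ∧ #N ≤ smallCard R := by
  obtain ⟨N, h1, h2, h3, h4⟩ := exists_isPure_card_le (R := R) T
    (κ := smallCard R) (le_max_left _ _) (le_max_right _ _) (hι.trans (le_max_left _ _)) {x}
    (by rw [mk_singleton]; exact one_le_aleph0.trans (le_max_left _ _))
  exact ⟨N, h1 rfl, h2, h3, h4⟩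

/-- It suffices to lift maps from small injective modules. -/
lemma InjLift.of_small [IsNoetherianRing R] (p : M →ₗ[R] N)
    (h : ∀ K : Submodule R (SmallFree R), Module.Injective R (SmallFree R ⧸ K) →
      ∀ f : (SmallFree R ⧸ K) →ₗ[R] N, ∃ g, p ∘ₗ g = f) : InjLift p := by
  intro I _ _ hI f
  let S : Set (LinearPMap (RingHom.id R) I M) := {g | IsPure g.domain ∧ ∀ x, p (g x) = f x}
  obtain ⟨g, -, hg⟩ := zorn_le_nonempty₀ S (fun c hc hchain y hy => by
    have hd := hchain.directedOn
    refine ⟨LinearPMap.sSup c hd, ⟨?_, fun x => ?_⟩, fun z hz => LinearPMap.le_sSup hd hz⟩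
    · rw [LinearPMap.domain_sSup, sSup_image']
      have : Nonempty c := ⟨⟨y, hy⟩⟩
      refine IsPure.iSup_of_directed _ ?_ fun i => (hc i.2).1
      exact fun a b => by
        obtain ⟨z, hz, h1, h2⟩ := hd a a.2 b b.2
        exact ⟨⟨z, hz⟩, h1.1, h2.1⟩
    · obtain ⟨z, hz, hx⟩ := (LinearPMap.mem_domain_sSup_iff ⟨y, hy⟩ hd).1 x.2
      rw [← (hc hz).2 ⟨x, hx⟩]
      exact congrArg p ((LinearPMap.le_sSup hd hz).2 (x := ⟨x, hx⟩) (y := x) rfl).symm)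
    (⟨⊥, 0⟩) ⟨isPure_bot, fun x => by
      obtain ⟨x, hx⟩ := x
      obtain rfl := (Submodule.mem_bot R).1 hx
      simp⟩
  have hpure := hg.prop.1
  have hinj := hpure.injective hI
  obtain ⟨r, hr⟩ := hinj.out g.domain.subtype g.domain.subtype_injective LinearMap.id
  have htop : g.domain = ⊤ := by
    by_contra hne
    obtain ⟨x, -, hx⟩ := SetLike.exists_of_lt (lt_top_iff_ne_top.2 hne)
    obtain ⟨q, hqv⟩ : ∃ q : I →ₗ[R] LinearMap.ker r, ∀ y, (q y : I) = y - r y :=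
      ⟨(LinearMap.id - g.domain.subtype ∘ₗ r).codRestrict _ fun x => by
        have := hr (r x)
        simp only [Submodule.subtype_apply, LinearMap.id_apply] at this
        simp [this], fun y => rfl⟩
    have hqs : ∀ y : LinearMap.ker r, q y = y := fun y => by
      apply Subtype.ext
      rw [hqv, LinearMap.mem_ker.1 y.2, ZeroMemClass.coe_zero, sub_zero]
    have hqk : ∀ y, q y = 0 ↔ y ∈ g.domain := by
      intro y
      rw [Subtype.ext_iff, hqv]
      constructor
      · intro hy
        rw [sub_eq_zero.1 hy]; exact (r y).2
      · intro hy
        have : r y = ⟨y, hy⟩ := hr ⟨y, hy⟩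
        simp [this]
    have hqk' : LinearMap.ker q = g.domain := Submodule.ext fun y => by
      rw [LinearMap.mem_ker, hqk]
    have hqk'' : IsPure (LinearMap.ker q) := by rw [hqk']; exact hpure
    have hkinj : Module.Injective R (LinearMap.ker r) :=
      Module.Injective.of_retract (LinearMap.ker r).subtype q (LinearMap.ext hqs) hI
    obtain ⟨A, hxA, hA, -, hAc⟩ := exists_isPure_small (R := R)
      (fun i : PEmpty.{u+1} => i.elim) (by simp) (q x)
    obtain ⟨s, hs⟩ := exists_smallFree_surjective hAc
    let e := s.quotKerEquivOfSurjective hs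
    obtain ⟨l, hl⟩ := h _ ((hA.injective hkinj).of_linearEquiv e.symm)
      (f ∘ₗ (LinearMap.ker r).subtype ∘ₗ A.subtype ∘ₗ e.toLinearMap)
    have hAI : Function.Injective ((LinearMap.ker r).subtype ∘ₗ A.subtype) :=
      (LinearMap.ker r).subtype_injective.comp A.subtype_injective
    let B : Submodule R I := LinearMap.range ((LinearMap.ker r).subtype ∘ₗ A.subtype)
    let eB := LinearEquiv.ofInjective _ hAI
    let g' : LinearPMap (RingHom.id R) I M :=
      ⟨B, l ∘ₗ e.symm.toLinearMap ∘ₗ eB.symm.toLinearMap⟩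
    have hg' : ∀ x, p (g' x) = f x := fun x => by
      obtain ⟨y, rfl⟩ := eB.surjective x
      have := LinearMap.congr_fun hl (e.symm y)
      simp only [LinearMap.comp_apply, LinearEquiv.coe_coe, e.apply_symm_apply] at this
      change p (l (e.symm (eB.symm (eB y)))) = _
      rw [eB.symm_apply_apply, this]
      rfl
    have hdisj : Disjoint g.domain g'.domain := by
      rw [Submodule.disjoint_def]
      rintro y hy ⟨a, rfl⟩
      have := (hqk _).2 hy
      simp only [LinearMap.comp_apply, Submodule.subtype_apply] at this ⊢
      rw [hqs] at this
      rw [this]; rfl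
    have H := LinearPMap.sup_h_of_disjoint g g' hdisj
    have hdom : (g.sup g' H).domain = A.comap q := by
      rw [LinearPMap.domain_sup]
      apply le_antisymm
      · apply sup_le
        · intro y hy
          rw [Submodule.mem_comap, (hqk _).2 hy]
          exact A.zero_mem
        · rintro _ ⟨a, rfl⟩
          change q ((a : LinearMap.ker r) : I) ∈ A
          rw [hqs]; exact a.2
      · intro y hy
        have : y = (r y : I) + (q y : I) := by rw [hqv]; abel
        rw [this]
        exact Submodule.add_mem_sup (r y).2 ⟨⟨q y, hy⟩, rfl⟩
    have hmem : g.sup g' H ∈ S := by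
      refine ⟨?_, fun y => ?_⟩
      · rw [hdom]
        exact IsPure.comap q (fun y => ⟨y, hqs y⟩) hqk'' hA
      · obtain ⟨y, hy⟩ := y
        obtain ⟨a, ha, b, hb, rfl⟩ := Submodule.mem_sup.1 hy
        have h1 := LinearPMap.sup_apply H ⟨a, ha⟩ ⟨b, hb⟩ ⟨_, hy⟩ rfl
        refine (congrArg p h1).trans ?_
        rw [map_add, map_add, hg.prop.2, hg']
    have hle := (hg.le_of_ge hmem (LinearPMap.left_le_sup g g' H)).1
    apply hx
    apply hle
    rw [hdom]
    exact hxA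
  refine ⟨g.toFun ∘ₗ (LinearEquiv.ofTop _ htop).symm.toLinearMap, ?_⟩
  ext x
  exact hg.prop.2 ⟨x, _⟩

end SmallModules

section SmallObjectArgument

open MorphismProperty

universe w v'

variable {𝒞 : Type v'} [Category.{w} 𝒞] [Abelian 𝒞] [IsGrothendieckAbelian.{w} 𝒞]

lemma hasSmallObjectArgument_ofHoms_mono {T : Type w} {A B : T → 𝒞} (f : ∀ t, A t ⟶ B t)
    [∀ t, Mono (f t)] : HasSmallObjectArgument.{w} (ofHoms f) := by
  obtain ⟨κ, hκ', hκ⟩ := HasCardinalLT.exists_regular_cardinal_forall.{w} (fun t => Subobject (A t))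
  have : Fact κ.IsRegular := ⟨hκ'⟩
  have : Nonempty κ.ord.ToType := by simpa using hκ'.ne_zero
  have := WellFoundedLT.toOrderBot κ.ord.ToType
  have hle : ofHoms f ≤ monomorphisms 𝒞 := by
    rintro _ _ _ ⟨t⟩
    exact monomorphisms.infer_property _
  exact ⟨κ, inferInstance, inferInstance,
    { preservesColimit {A' B' X Y} i hi g hg := by
        let hf' : (monomorphisms 𝒞).TransfiniteCompositionOfShape κ.ord.ToType g :=
          { toTransfiniteCompositionOfShape := hg.toTransfiniteCompositionOfShape
            map_mem j hj := by
              have := (hg.attachCells j hj).pushouts_coproducts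
              simp only [ofHoms_homFamily] at this
              refine (?_ : _ ≤ monomorphisms 𝒞) _ this
              simp only [pushouts_le_iff, coproducts_le_iff]
              exact hle }
        have (j j' : κ.ord.ToType) (φ : j ⟶ j') : Mono (hf'.F.map φ) := hf'.mem_map φ
        apply IsGrothendieckAbelian.preservesColimit_coyoneda_obj_of_mono (Y := hf'.F) (κ := κ)
        obtain ⟨t⟩ := hi
        exact hκ t }⟩

lemma exists_factorization_ofHoms_mono {T : Type w} {A B : T → 𝒞} (f : ∀ t, A t ⟶ B t)
    [∀ t, Mono (f t)] {X Y : 𝒞} (g : X ⟶ Y) :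
    ∃ (Z : 𝒞) (i : X ⟶ Z) (p : Z ⟶ Y), (ofHoms f).rlp.llp i ∧ (ofHoms f).rlp p ∧ i ≫ p = g := by
  have := hasSmallObjectArgument_ofHoms_mono f
  let d := factorizationData (ofHoms f).rlp.llp (ofHoms f).rlp g
  exact ⟨d.Z, d.i, d.p, d.hi, d.hp, d.fac⟩

/-- Relative cell complexes built from a set of maps in a class with enough closure properties
stay in this class. -/
lemma llp_rlp_ofHoms_mono_le {T : Type w} {A B : T → 𝒞} (f : ∀ t, A t ⟶ B t)
    [∀ t, Mono (f t)] (W : MorphismProperty 𝒞) (hf : ∀ t, W (f t))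
    [W.IsStableUnderCobaseChange] [IsStableUnderCoproducts.{w} W]
    [IsStableUnderTransfiniteComposition.{w} W] [W.IsStableUnderRetracts] :
    (ofHoms f).rlp.llp ≤ W := by
  have := hasSmallObjectArgument_ofHoms_mono f
  rw [llp_rlp_of_hasSmallObjectArgument]
  have hle : ofHoms f ≤ W := by rintro _ _ _ ⟨t⟩; exact hf t
  trans (transfiniteCompositions.{w} (coproducts.{w} W).pushouts).retracts
  · apply retracts_monotone
    apply transfiniteCompositions_monotone
    apply pushouts_monotone
    apply coproducts_monotone
    exact hle
  · simp

lemma mono_of_llp_rlp_ofHoms {T : Type w} {A B : T → 𝒞} (f : ∀ t, A t ⟶ B t)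
    [∀ t, Mono (f t)] {X Y : 𝒞} (i : X ⟶ Y) (hi : (ofHoms f).rlp.llp i) : Mono i :=
  llp_rlp_ofHoms_mono_le f (monomorphisms 𝒞) (fun _ => monomorphisms.infer_property _) i hi

end SmallObjectArgument

section SpecialPreenvelope

variable {R : Type u} [CommRing R]

/-- The complex with `A` in each degree and zero differential. -/
noncomputable def sphereComplex (A : ModuleCat.{u} R) : ChainComplex (ModuleCat.{u} R) ℤ where
  X _ := A
  d _ _ := 0

/-- The map out of a sphere complex given by a family of maps into cycles. -/
noncomputable def sphereOut {A : ModuleCat.{u} R} {K : ChainComplex (ModuleCat.{u} R) ℤ}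
    (a : ∀ m, A →ₗ[R] K.X m) (ha : ∀ j x, K.d (j+1) j (a (j+1) x) = 0) : sphereComplex A ⟶ K where
  f m := ModuleCat.ofHom (a m)
  comm' i j h := by
    obtain rfl : j + 1 = i := h
    ext x
    refine (ha j x).trans ?_
    exact (map_zero (a j)).symm

lemma sphereComplex_cycle {A : ModuleCat.{u} R} {K : ChainComplex (ModuleCat.{u} R) ℤ}
    (f : sphereComplex A ⟶ K) (i j : ℤ) (x : A) : K.d i j (f.f i x) = 0 := by
  have := congrArg (fun k => k x) (congrArg ModuleCat.Hom.hom (f.comm i j))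
  refine this.trans ?_
  exact map_zero (f.f j).hom

/-- The inclusion of the cycles of a disk complex. -/
noncomputable def sphereToDisk (A : ModuleCat.{u} R) : sphereComplex A ⟶ diskComplex A :=
  sphereOut (fun _ => LinearMap.inr R A A) fun j x => diskComplex_d A (j+1) j rfl 0 x

instance mono_sphereToDisk (A : ModuleCat.{u} R) : Mono (sphereToDisk A) := by
  rw [HomologicalComplex.mono_iff_injective]
  intro m x y h
  exact congrArg (fun z : A × A => z.2) h

/-- The map of disk complexes induced by a linear map. -/
noncomputable def diskMap {A B : ModuleCat.{u} R} (f : A →ₗ[R] B) : diskComplex A ⟶ diskComplex B :=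
  diskOut fun _ => LinearMap.inl R B B ∘ₗ f

lemma diskMap_f {A B : ModuleCat.{u} R} (f : A →ₗ[R] B) (m : ℤ) (x y : A) :
    (diskMap f).f m (x, y) = ((f x, f y) : B × B) := by
  refine (diskOut_f _ _ _ _).trans ?_
  have := diskComplex_d B (m+1) m rfl (f y) 0
  refine (congrArg _ this).trans ?_
  exact Prod.ext (add_zero _) (zero_add _)

lemma mono_diskMap {A B : ModuleCat.{u} R} (f : A →ₗ[R] B) (hf : Function.Injective f) :
    Mono (diskMap f) := by
  rw [HomologicalComplex.mono_iff_injective]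
  rintro m ⟨x, y⟩ ⟨x', y'⟩ h
  have h' := (diskMap_f f m x y).symm.trans (h.trans (diskMap_f f m x' y'))
  exact Prod.ext (hf (congrArg (fun z : B × B => z.1) h'))
    (hf (congrArg (fun z : B × B => z.2) h'))

/-- The maps `0 → Hom(A, C_n)` form an exact complex. -/
def HomExact (C : ChainComplex (ModuleCat.{u} R) ℤ) (A : Type u) [AddCommGroup A] [Module R A] :
    Prop :=
  ∀ (j : ℤ) (f : A →ₗ[R] C.X (j+1)), (∀ x, C.d (j+1) j (f x) = 0) →
    ∃ g : A →ₗ[R] C.X (j+1+1), ∀ x, C.d (j+1+1) (j+1) (g x) = f x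

lemma diskComplex_cycle (E : ModuleCat.{u} R) (m : ℤ) (z : E × E)
    (h : (diskComplex E).d m (m-1) z = 0) : z.1 = 0 := by
  have := (diskComplex_d E m (m-1) (by ring) z.1 z.2).symm.trans h
  exact congrArg (fun z : E × E => z.2) this

lemma diskOut_f_zero {E : ModuleCat.{u} R} {K : ChainComplex (ModuleCat.{u} R) ℤ}
    (φ : ∀ m, E →ₗ[R] K.X m) (m : ℤ) (x : E) :
    (diskOut φ).f m ((x, 0) : E × E) = φ m x := by
  refine (diskOut_f _ _ _ _).trans ?_
  rw [map_zero, map_zero, add_zero]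

lemma diskOut_f_zero' {E : ModuleCat.{u} R} {K : ChainComplex (ModuleCat.{u} R) ℤ}
    (φ : ∀ m, E →ₗ[R] K.X m) (m : ℤ) (x : E) :
    (diskOut φ).f m ((0, x) : E × E) = K.d (m+1) m (φ (m+1) x) := by
  refine (diskOut_f _ _ _ _).trans ?_
  rw [map_zero, zero_add]

/-- The product of all components of a complex. -/
abbrev totalModule (C : ChainComplex (ModuleCat.{u} R) ℤ) : ModuleCat.{u} R :=
  ModuleCat.of R (∀ n, C.X n)

/-- The componentwise split surjection from a disk complex. -/
noncomputable def diskCover (C : ChainComplex (ModuleCat.{u} R) ℤ) :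
    diskComplex (totalModule C) ⟶ C :=
  diskOut fun m => LinearMap.proj m

lemma diskCover_f (C : ChainComplex (ModuleCat.{u} R) ℤ) (m : ℤ) (x y : ∀ n, C.X n) :
    (diskCover C).f m ((x, y) : totalModule C × totalModule C) = x m + C.d (m+1) m (y (m+1)) := rfl

lemma hasLiftingProperty_diskMap_diskCover (C : ChainComplex (ModuleCat.{u} R) ℤ)
    (hC : ∀ n, Module.Injective R (C.X n)) {A B : ModuleCat.{u} R} (k : A →ₗ[R] B)
    (hk : Function.Injective k) : HasLiftingProperty (diskMap k) (diskCover C) := by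
  refine ⟨fun {f g} sq => ?_⟩
  let P := totalModule C
  have hP : Module.Injective R (P × P) := by
    have : Module.Injective R P := Module.Injective.pi ..
    exact this.prod this
  choose φ hφ using fun m => hP.out k hk ((f.f m).hom ∘ₗ LinearMap.inl R A A : A →ₗ[R] P × P)
  have hw : ∀ m a, (diskCover C).f m (f.f m ((a, 0) : A × A)) = g.f m ((k a, 0) : B × B) := by
    intro m a
    have := congrArg (fun k => k ((a, 0) : A × A))
      (congrArg ModuleCat.Hom.hom (HomologicalComplex.congr_hom sq.w m))
    refine this.trans (congrArg (g.f m) ?_)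
    refine (diskMap_f _ _ _ _).trans ?_
    rw [map_zero]
  let δ : ∀ m, B →ₗ[R] C.X m := fun m =>
    ((g.f m).hom ∘ₗ LinearMap.inl R B B : B →ₗ[R] C.X m) -
      ((((diskCover C).f m).hom : P × P →ₗ[R] C.X m) ∘ₗ φ m)
  have hδ : ∀ m b, δ m b = g.f m ((b, 0) : B × B) - (diskCover C).f m (φ m b) := fun m b => rfl
  let Φ : ∀ m, B →ₗ[R] P × P := fun m =>
    φ m + LinearMap.inl R P P ∘ₗ LinearMap.single R (fun n => C.X n) m ∘ₗ δ m
  have hΦ : ∀ m b, Φ m b = φ m b + ((Pi.single m (δ m b) : ∀ n, C.X n), 0) := fun m b => rfl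
  refine ⟨⟨{ l := diskOut (E := B) (K := diskComplex P) Φ, fac_left := ?_, fac_right := ?_ }⟩⟩
  · refine diskOut_ext fun m a => ?_
    change (diskOut (E := B) (K := diskComplex P) Φ).f m ((diskMap k).f m ((a, 0) : A × A)) = _
    refine (congrArg _ (diskMap_f k m a 0)).trans ?_
    rw [map_zero]
    refine (diskOut_f_zero (E := B) (K := diskComplex P) Φ m (k a)).trans ?_
    refine (hΦ _ _).trans ?_
    have h1 : φ m (k a) = f.f m ((a, 0) : A × A) := hφ m a
    have h2 : δ m (k a) = 0 := by
      rw [hδ]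
      refine sub_eq_zero.2 ((hw m a).symm.trans ?_)
      exact congrArg _ h1.symm
    rw [h2, Pi.single_zero]
    exact (add_zero _).trans h1
  · refine diskOut_ext fun m b => ?_
    refine (congrArg ((diskCover C).f m)
      (diskOut_f_zero (E := B) (K := diskComplex P) Φ m b)).trans ?_
    refine (congrArg ((diskCover C).f m) (hΦ m b)).trans ?_
    refine (map_add ((diskCover C).f m).hom _ _).trans ?_
    have h1 : (diskCover C).f m (((Pi.single m (δ m b) : ∀ n, C.X n), 0) : P × P) = δ m b := by
      refine (diskCover_f C m _ _).trans ?_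
      rw [Pi.single_eq_same]
      refine (congrArg _ (map_zero (C.d (m+1) m).hom)).trans (add_zero _)
    refine (congrArg _ h1).trans ?_
    rw [hδ]
    exact add_sub_cancel _ _

lemma hasLiftingProperty_sphereToDisk_diskCover (C : ChainComplex (ModuleCat.{u} R) ℤ)
    {A : ModuleCat.{u} R} (hA : HomExact C A) :
    HasLiftingProperty (sphereToDisk A) (diskCover C) := by
  refine ⟨fun {f g} sq => ?_⟩
  let P := totalModule C
  let y : ℤ → (A →ₗ[R] P) := fun m => LinearMap.snd R P P ∘ₗ (f.f m).hom
  have hy : ∀ m x, f.f m x = ((0, y m x) : P × P) := fun m x =>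
    Prod.ext (diskComplex_cycle P m _ (sphereComplex_cycle f m (m-1) x)) rfl
  let ψ : ∀ m, A →ₗ[R] C.X m := fun m => (g.f m).hom ∘ₗ LinearMap.inl R A A
  have hg : g = diskOut ψ := diskOut_ext fun m x => (diskOut_f_zero ψ m x).symm
  have hw : ∀ m x, C.d (m+1) m (y m x (m+1)) = C.d (m+1) m (ψ (m+1) x) := by
    intro m a
    have := congrArg (fun k => k a)
      (congrArg ModuleCat.Hom.hom (HomologicalComplex.congr_hom sq.w m))
    have h1 : (diskCover C).f m (f.f m a) = g.f m ((0, a) : A × A) := this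
    rw [hg] at h1
    have h2 := (congrArg ((diskCover C).f m) (hy m a)).symm.trans
      (h1.trans (diskOut_f_zero' ψ m a))
    refine Eq.trans ?_ h2
    refine ((diskCover_f C m _ _).trans ?_).symm
    exact zero_add _
  have hv : ∀ m j, m = j + 1 → ∃ v : A →ₗ[R] C.X (m+1), ∀ x,
      y j x m + C.d (m+1) m (v x) = ψ m x := by
    rintro _ j rfl
    obtain ⟨v, hv⟩ := hA j (ψ (j+1) - LinearMap.proj (j+1) ∘ₗ y j) fun x => by
      refine (map_sub (C.d (j+1) j).hom _ _).trans (sub_eq_zero.2 (hw j x).symm)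
    refine ⟨v, fun x => ?_⟩
    rw [hv]
    exact add_sub_cancel _ _
  choose v hv using fun m => hv m (m-1) (by ring)
  let Φ : ∀ m, A →ₗ[R] P × P := fun m =>
    (y (m-1)).prod (LinearMap.single R (fun n => C.X n) (m+1) ∘ₗ v m)
  have hΦ : ∀ m x, Φ m x = (y (m-1) x, (Pi.single (m+1) (v m x) : ∀ n, C.X n)) := fun m x => rfl
  refine ⟨⟨{ l := diskOut (E := A) (K := diskComplex P) Φ, fac_left := ?_, fac_right := ?_ }⟩⟩
  · ext m a
    refine (diskOut_f_zero' (E := A) (K := diskComplex P) Φ m a).trans ?_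
    refine Eq.trans ?_ (hy m a).symm
    refine (congrArg _ (hΦ (m+1) a)).trans ?_
    refine (diskComplex_d P (m+1) m rfl _ _).trans ?_
    rw [show m + 1 - 1 = m by ring]
  · refine diskOut_ext fun m x => ?_
    refine (congrArg ((diskCover C).f m)
      (diskOut_f_zero (E := A) (K := diskComplex P) Φ m x)).trans ?_
    refine (congrArg ((diskCover C).f m) (hΦ m x)).trans ?_
    refine (diskCover_f C m _ _).trans ?_
    rw [Pi.single_eq_same]
    exact hv m x

end SpecialPreenvelope

section SpecialPreenvelope

variable {R : Type u} [CommRing R]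

open scoped ZeroObject

lemma diskComplex_hom_snd {A : ModuleCat.{u} R} {K : ChainComplex (ModuleCat.{u} R) ℤ}
    (f : diskComplex A ⟶ K) (m : ℤ) (y : A) :
    f.f m ((0, y) : A × A) = K.d (m+1) m (f.f (m+1) ((y, 0) : A × A)) := by
  let ψ : ∀ m, A →ₗ[R] K.X m := fun m => (f.f m).hom ∘ₗ LinearMap.inl R A A
  have hf : f = diskOut ψ := diskOut_ext fun m x => (diskOut_f_zero ψ m x).symm
  exact (congrArg (fun g : diskComplex A ⟶ K => g.f m ((0, y) : A × A)) hf).trans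
    (diskOut_f_zero' ψ m y)

lemma homExact_of_hasLiftingProperty {T : ChainComplex (ModuleCat.{u} R) ℤ} (A : ModuleCat.{u} R)
    (h : HasLiftingProperty (sphereToDisk A) (0 : T ⟶ 0)) : HomExact T A := by
  intro j f hf
  let a : ∀ m, A →ₗ[R] T.X m := Function.update 0 (j+1) f
  have ha : a (j+1) = f := Function.update_self ..
  have ha' : ∀ k x, T.d (k+1) k (a (k+1) x) = 0 := by
    intro k x
    by_cases hk : k = j
    · subst hk; rw [ha]; exact hf x
    · have : a (k+1) = 0 := Function.update_of_ne (by simpa using hk) ..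
      rw [this]; exact map_zero (T.d (k+1) k).hom
  have sq : CommSq (sphereOut a ha') (sphereToDisk A) (0 : T ⟶ 0) 0 := ⟨by simp⟩
  let l := sq.lift
  refine ⟨(l.f (j+1+1)).hom ∘ₗ LinearMap.inl R A A, fun x => ?_⟩
  refine (diskComplex_hom_snd l (j+1) x).symm.trans ?_
  have := congrArg (fun k => k x)
    (congrArg ModuleCat.Hom.hom (HomologicalComplex.congr_hom sq.fac_left (j+1)))
  refine Eq.trans this ?_
  exact LinearMap.congr_fun ha x

lemma injective_of_hasLiftingProperty {T : ChainComplex (ModuleCat.{u} R) ℤ}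
    (h : ∀ I : Ideal R, HasLiftingProperty
      (diskMap (A := ModuleCat.of R I) (B := ModuleCat.of R R) I.subtype) (0 : T ⟶ 0)) (n : ℤ) :
    Module.Injective R (T.X n) := by
  refine Module.Baer.injective fun I g => ?_
  have := h I
  let φ : ∀ m, I →ₗ[R] T.X m := Function.update 0 n g
  have hφ : φ n = g := Function.update_self ..
  have sq : CommSq (diskOut (E := ModuleCat.of R I) φ)
    (diskMap (A := ModuleCat.of R I) (B := ModuleCat.of R R) I.subtype) (0 : T ⟶ 0) 0 := ⟨by simp⟩
  let l := sq.lift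
  refine ⟨(l.f n).hom ∘ₗ LinearMap.inl R R R, fun x hx => ?_⟩
  have h1 := congrArg (fun k => k (((⟨x, hx⟩ : I), 0) : I × I))
    (congrArg ModuleCat.Hom.hom (HomologicalComplex.congr_hom sq.fac_left n))
  have h2 := diskOut_f_zero (E := ModuleCat.of R I) φ n ⟨x, hx⟩
  rw [hφ] at h2
  refine Eq.trans (congrArg (l.f n) ?_) (h1.trans h2)
  refine Eq.trans ?_ (diskMap_f (A := ModuleCat.of R I) (B := ModuleCat.of R R) I.subtype n
    ⟨x, hx⟩ 0).symm
  rw [map_zero]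
  rfl

/-- An exact complex of injectives, exact under maps from injectives. -/
structure TotallyAcyclic (C : ChainComplex (ModuleCat.{u} R) ℤ) : Prop where
  injective : ∀ n, Module.Injective R (C.X n)
  homExact_ring : HomExact C R
  homExact : ∀ (I : Type u) [AddCommGroup I] [Module R I], Module.Injective R I → HomExact C I

lemma TotallyAcyclic.exact {C : ChainComplex (ModuleCat.{u} R) ℤ} (h : TotallyAcyclic C) (j : ℤ)
    (x : C.X (j+1)) (hx : C.d (j+1) j x = 0) : ∃ y, C.d (j+1+1) (j+1) y = x := by
  obtain ⟨g, hg⟩ := h.homExact_ring j (LinearMap.toSpanSingleton R _ x) fun r => by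
    simp [hx]
  exact ⟨g 1, (hg 1).trans (by simp)⟩

/-- The index type of generating maps: inclusions of ideals and maps from spheres on the ring or
on a small injective module. -/
abbrev SpecialIndex (R : Type u) [CommRing R] : Type u :=
  Ideal R ⊕ Option {K : Submodule R (SmallFree R) // Module.Injective R (SmallFree R ⧸ K)}

/-- The modules on which spheres are placed. -/
noncomputable def sphereModule (R : Type u) [CommRing R] :
    Option {K : Submodule R (SmallFree R) // Module.Injective R (SmallFree R ⧸ K)} → ModuleCat.{u} R
  | none => ModuleCat.of R R
  | some K => ModuleCat.of R (SmallFree R ⧸ K.1)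

/-- The source of a generating map. -/
noncomputable def specialSource (R : Type u) [CommRing R] :
    SpecialIndex R → ChainComplex (ModuleCat.{u} R) ℤ
  | .inl I => diskComplex (ModuleCat.of R I)
  | .inr K => sphereComplex (sphereModule R K)

/-- The target of a generating map. -/
noncomputable def specialTarget (R : Type u) [CommRing R] :
    SpecialIndex R → ChainComplex (ModuleCat.{u} R) ℤ
  | .inl _ => diskComplex (ModuleCat.of R R)
  | .inr K => diskComplex (sphereModule R K)

/-- The generating maps. -/
noncomputable def specialMap (R : Type u) [CommRing R] :
    ∀ t : SpecialIndex R, specialSource R t ⟶ specialTarget R t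
  | .inl I => diskMap (A := ModuleCat.of R I) (B := ModuleCat.of R R) I.subtype
  | .inr K => sphereToDisk (sphereModule R K)

instance mono_specialMap (t : SpecialIndex R) : Mono (specialMap R t) := by
  rcases t with I | K
  · exact mono_diskMap (A := ModuleCat.of R I) (B := ModuleCat.of R R) _ I.subtype_injective
  · exact mono_sphereToDisk _

lemma rlp_specialMap_diskCover {C : ChainComplex (ModuleCat.{u} R) ℤ} (hC : TotallyAcyclic C) :
    (MorphismProperty.ofHoms (specialMap R)).rlp (diskCover C) := by
  rintro _ _ _ ⟨I | _ | K⟩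
  · exact hasLiftingProperty_diskMap_diskCover C hC.injective (A := ModuleCat.of R I)
      (B := ModuleCat.of R R) _ I.subtype_injective
  · exact hasLiftingProperty_sphereToDisk_diskCover C (A := ModuleCat.of R R) hC.homExact_ring
  · exact hasLiftingProperty_sphereToDisk_diskCover C (A := ModuleCat.of R (SmallFree R ⧸ K.1))
      (hC.homExact _ K.2)

lemma totallyAcyclic_of_rlp [IsNoetherianRing R] {T : ChainComplex (ModuleCat.{u} R) ℤ}
    (h : (MorphismProperty.ofHoms (specialMap R)).rlp (0 : T ⟶ 0)) : TotallyAcyclic T := by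
  have h1 := fun t => h _ (MorphismProperty.ofHoms.mk (f := specialMap R) t)
  refine ⟨injective_of_hasLiftingProperty fun I => h1 (.inl I),
    homExact_of_hasLiftingProperty (ModuleCat.of R R) (h1 (.inr none)), ?_⟩
  intro I _ _ hI j f hf
  let p : T.X (j+1+1) →ₗ[R] LinearMap.ker (T.d (j+1) j).hom :=
    (T.d (j+1+1) (j+1)).hom.codRestrict _ fun x => by
      change (T.d (j+1+1) (j+1) ≫ T.d (j+1) j) x = 0
      rw [T.d_comp_d]; rfl
  have hp : InjLift p := InjLift.of_small p fun K hK f => by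
    obtain ⟨g, hg⟩ := homExact_of_hasLiftingProperty (ModuleCat.of R (SmallFree R ⧸ K))
      (h1 (.inr (some ⟨K, hK⟩))) j (Submodule.subtype _ ∘ₗ f) fun x => (f x).2
    exact ⟨g, LinearMap.ext fun x => Subtype.ext (hg x)⟩
  obtain ⟨g, hg⟩ := hp I hI (f.codRestrict _ hf)
  exact ⟨g, fun x => congrArg Subtype.val (LinearMap.congr_fun hg x)⟩

/-- The differential as a map onto the cycles. -/
noncomputable def toKer (T : ChainComplex (ModuleCat.{u} R) ℤ) (a b c : ℤ) :
    T.X a →ₗ[R] LinearMap.ker (T.d b c).hom :=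
  (T.d a b).hom.codRestrict _ fun x => by
    change (T.d a b ≫ T.d b c) x = 0
    rw [T.d_comp_d]; rfl

lemma TotallyAcyclic.injStep {T : ChainComplex (ModuleCat.{u} R) ℤ} (h : TotallyAcyclic T) (j : ℤ) :
    InjStep (LinearMap.ker (T.d (j+1+1) (j+1)).hom).subtype (toKer T (j+1+1) (j+1) j) where
  inj := Submodule.subtype_injective _
  exact x := ⟨fun hx => ⟨⟨x, congrArg Subtype.val hx⟩, rfl⟩, fun ⟨y, hy⟩ => by
    rw [← hy]; exact Subtype.ext y.2⟩
  surj x := by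
    obtain ⟨y, hy⟩ := h.exact j x.1 x.2
    exact ⟨y, Subtype.ext hy⟩
  injective := h.injective _
  lift I _ _ hI f := by
    obtain ⟨g, hg⟩ := h.homExact I hI j (Submodule.subtype _ ∘ₗ f) fun x => (f x).2
    exact ⟨g, LinearMap.ext fun x => Subtype.ext (hg x)⟩

lemma TotallyAcyclic.gi_ker {T : ChainComplex (ModuleCat.{u} R) ℤ} (h : TotallyAcyclic T) (j : ℤ) :
    GI R (LinearMap.ker (T.d (j+1) j).hom) := by
  refine GI.of_class (fun G => ∃ j, Nonempty (G ≃ₗ[R] LinearMap.ker (T.d (j+1) j).hom))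
    ?_ ?_ ⟨j, ⟨LinearEquiv.refl _ _⟩⟩
  · rintro G ⟨j, ⟨e⟩⟩
    obtain ⟨c, rfl⟩ : ∃ c, j = c + 1 := ⟨j - 1, by ring⟩
    exact ⟨T.X (c+1+1), ModuleCat.of R (LinearMap.ker (T.d (c+1) c).hom), _, _,
      ⟨c, ⟨LinearEquiv.refl _ _⟩⟩, (h.injStep c).congr e (LinearEquiv.refl _ _)⟩
  · rintro G ⟨j, ⟨e⟩⟩
    exact ⟨T.X (j+1+1), ModuleCat.of R (LinearMap.ker (T.d (j+1+1) (j+1)).hom), _, _,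
      ⟨j+1, ⟨LinearEquiv.refl _ _⟩⟩, (h.injStep j).congr (LinearEquiv.refl _ _) e.symm⟩

lemma GI.exists_totallyAcyclic {A : Type u} [AddCommGroup A] [Module R A] (h : GI R A) :
    ∃ C : ChainComplex (ModuleCat.{u} R) ℤ, TotallyAcyclic C ∧
      Nonempty (A ≃ₗ[R] LinearMap.ker (C.d 0 (-1)).hom) := by
  obtain ⟨C, h1, h2, h3, ⟨e⟩⟩ := h
  refine ⟨C, ⟨fun n => (Module.injective_iff_injective_object R _).2 (h1 n), ?_, ?_⟩, ?_⟩
  · intro j f hf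
    have := (HomologicalComplex.exactAt_iff' C (j+1+1) (j+1) j (by simp) (by simp)).1 (h2 (j+1))
    rw [ShortComplex.moduleCat_exact_iff] at this
    obtain ⟨y, hy⟩ := this (f 1) (hf 1)
    refine ⟨LinearMap.toSpanSingleton R _ y, fun r => ?_⟩
    refine ((C.d (j+1+1) (j+1)).hom.map_smul r y).trans ?_
    refine (congrArg _ hy).trans ?_
    rw [← map_smul, smul_eq_mul, mul_one]
  · intro I _ _ hI j f hf
    obtain ⟨g, hg⟩ := (exact_hom_iff C (ModuleCat.of R I) (j+1)).1
      (h3 _ ((Module.injective_iff_injective_object R I).1 hI) (j+1)) (ModuleCat.ofHom f) (by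
        rw [show j + 1 - 1 = j by ring]
        ext x
        exact hf x)
    exact ⟨g.hom, fun x => congrArg (fun k => k x) (congrArg ModuleCat.Hom.hom hg)⟩
  · exact ⟨(e ≪≫ ModuleCat.kernelIsoKer _).toLinearEquiv⟩

end SpecialPreenvelope

section SpecialPreenvelope

variable {R : Type u} [CommRing R]

open scoped ZeroObject

lemma TotallyAcyclic.exists_extend {T C : ChainComplex (ModuleCat.{u} R) ℤ} (hT : TotallyAcyclic T)
    (hC : TotallyAcyclic C) (f : LinearMap.ker (T.d 0 (-1)).hom →ₗ[R] C.X 0)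
    (hf : ∀ z, C.d 0 (-1) (f z) = 0) : ∃ F : T ⟶ C, ∀ z, F.f 0 z.1 = f z := by
  have hdd : ∀ (K : ChainComplex (ModuleCat.{u} R) ℤ) (i j k : ℤ) (x : K.X i),
      K.d j k (K.d i j x) = 0 := by
    intro K i j k x
    change (K.d i j ≫ K.d j k) x = 0
    rw [K.d_comp_d]; rfl
  let α := (∀ n, T.X n →ₗ[R] C.X n) × ℤ
  let P : α → Prop := fun a => ∀ j, a.2 = j + 1 → ∀ t, T.d a.2 j t = 0 → C.d a.2 j (a.1 a.2 t) = 0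
  let r : α → α → Prop := fun a b => b.2 = a.2 + 1 ∧
    ∀ t, C.d (a.2+1) a.2 (b.1 (a.2+1) t) = a.1 a.2 (T.d (a.2+1) a.2 t)
  have hup : ∀ a, P a → ∃ b, P b ∧ r a b := by
    rintro ⟨F, n⟩ hP
    obtain ⟨j, rfl⟩ : ∃ j, n = j + 1 := ⟨n - 1, by ring⟩
    obtain ⟨g, hg⟩ := hC.homExact _ (hT.injective (j+1+1)) j
      (F (j+1) ∘ₗ (T.d (j+1+1) (j+1)).hom) fun x => hP j rfl _ (hdd T _ _ _ x)
    refine ⟨⟨Function.update 0 (j+1+1) g, j+1+1⟩, ?_, rfl, fun t => ?_⟩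
    · intro k hk t ht
      obtain rfl : k = j + 1 := by simp only at hk; omega
      simp only [Function.update_self] at ht ⊢
      refine (hg t).trans ((congrArg (F (j+1)) ht).trans (map_zero _))
    · simp only [Function.update_self]
      exact hg t
  have hdown : ∀ a, P a → ∃ b, P b ∧ r b a := by
    rintro ⟨F, n⟩ hP
    obtain ⟨j, rfl⟩ : ∃ j, n = j + 1 := ⟨n - 1, by ring⟩
    let d := (T.d (j+1) j).hom
    obtain ⟨g₀, hg₀⟩ := d.rangeRestrict.exists_comp_eq_of_ker_le d.surjective_rangeRestrict
      ((C.d (j+1) j).hom ∘ₗ F (j+1)) fun x hx => hP j rfl x (congrArg Subtype.val hx)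
    obtain ⟨g, hg⟩ := (hC.injective j).out (LinearMap.range d).subtype
      (Submodule.subtype_injective _) g₀
    have hgd : ∀ t, g (T.d (j+1) j t) = C.d (j+1) j (F (j+1) t) := fun t =>
      (hg (d.rangeRestrict t)).trans (LinearMap.congr_fun hg₀ t)
    refine ⟨⟨Function.update 0 j g, j⟩, ?_, rfl, fun t => ?_⟩
    · intro k hk t ht
      simp only at hk
      subst hk
      obtain ⟨s, rfl⟩ := hT.exact k t ht
      simp only [Function.update_self]
      refine (congrArg _ (hgd s)).trans (hdd C _ _ _ _)
    · simp only [Function.update_self]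
      exact (hgd t).symm
  obtain ⟨F₀, hF₀⟩ := (hC.injective 0).out (LinearMap.ker (T.d 0 (-1)).hom).subtype
      (Submodule.subtype_injective _) f
  obtain ⟨Z, hZ1, hZ⟩ := exists_int_sequence r P hup hdown ⟨Function.update 0 0 F₀, 0⟩ (by
    intro j hj t ht
    obtain rfl : j = -1 := by simp only at hj; omega
    simp only [Function.update_self]
    exact (congrArg _ (hF₀ ⟨t, ht⟩)).trans (hf ⟨t, ht⟩))
  have hZ2 : ∀ n, (Z (n + 1)).2 = n := by
    have h : ∀ n, (Z (n + 1)).2 = (Z n).2 + 1 := fun n => (hZ n).1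
    have h1 : (Z (0 + 1)).2 = 0 := by rw [zero_add, hZ1]
    intro n
    induction n using Int.induction_on with
    | zero => exact h1
    | succ n ih => rw [h, ih]
    | pred n ih =>
      have := h (-n)
      rw [sub_add_cancel]
      rw [ih] at this
      have := h (-(n:ℤ))
      omega
  have key : ∀ n t, C.d (n+1) n ((Z (n+1+1)).1 (n+1) t) = (Z (n+1)).1 n (T.d (n+1) n t) := by
    intro n
    have := (hZ (n+1)).2
    rw [hZ2] at this
    exact this
  refine ⟨{ f := fun n => ModuleCat.ofHom ((Z (n+1)).1 n), comm' := ?_ }, fun z => ?_⟩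
  · rintro i j hij
    obtain rfl : j + 1 = i := hij
    ext t
    exact key j t
  · change (Z (0 + 1)).1 0 z.1 = f z
    rw [zero_add, hZ1]
    simp only [Function.update_self]
    exact hF₀ z

lemma exists_special_complex [IsNoetherianRing R] (M : ModuleCat.{u} R) :
    ∃ (T : ChainComplex (ModuleCat.{u} R) ℤ) (i : M →ₗ[R] T.X 0), TotallyAcyclic T ∧
      Function.Injective i ∧ (∀ x, T.d 0 (-1) (i x) = 0) ∧
      ∀ (C : ChainComplex (ModuleCat.{u} R) ℤ), TotallyAcyclic C → ∀ F : T ⟶ C,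
        (∀ x, F.f 0 (i x) = 0) → ∃ Φ : T ⟶ diskComplex (totalModule C),
          Φ ≫ diskCover C = F ∧ ∀ x, Φ.f 0 (i x) = 0 := by
  let S := (HomologicalComplex.single (ModuleCat.{u} R) (ComplexShape.down ℤ) 0).obj M
  let e : S.X 0 ≅ M := HomologicalComplex.singleObjXSelf (ComplexShape.down ℤ) 0 M
  obtain ⟨T, k, p, hk, hp, -⟩ := exists_factorization_ofHoms_mono (specialMap R) (0 : S ⟶ 0)
  obtain rfl : p = 0 := (isZero_zero _).eq_of_tgt _ _
  have hmono := mono_of_llp_rlp_ofHoms _ _ hk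
  refine ⟨T, (e.inv ≫ k.f 0).hom, totallyAcyclic_of_rlp hp, ?_, ?_, ?_⟩
  · exact (ModuleCat.mono_iff_injective (e.inv ≫ k.f 0)).1 inferInstance
  · intro x
    have : (e.inv ≫ k.f 0) ≫ T.d 0 (-1) = 0 := by
      rw [Category.assoc, k.comm, HomologicalComplex.single_obj_d, zero_comp, comp_zero]
    exact congrArg (fun k => k x) (congrArg ModuleCat.Hom.hom this)
  · intro C hC F hF
    have hkF : k ≫ F = 0 := by
      refine HomologicalComplex.from_single_hom_ext ?_
      rw [← cancel_epi e.inv]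
      ext x
      exact hF x
    have := hk _ (rlp_specialMap_diskCover hC)
    have sq : CommSq (0 : S ⟶ diskComplex (totalModule C)) k (diskCover C) F := ⟨by simp [hkF]⟩
    refine ⟨sq.lift, sq.fac_right, fun x => ?_⟩
    have h1 := congrArg (fun g => e.inv ≫ g)
      (HomologicalComplex.congr_hom sq.fac_left 0)
    have h2 := congrArg (fun k => k x) (congrArg ModuleCat.Hom.hom h1)
    refine Eq.trans h2 ?_
    simp

lemma exists_special_preenvelope [IsNoetherianRing R] (M : Type u) [AddCommGroup M] [Module R M] :
    ∃ (G : ModuleCat.{u} R) (i : M →ₗ[R] G), GI R G ∧ Function.Injective i ∧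
      ∀ (A I : ModuleCat.{u} R) (q : I →ₗ[R] A), GI R A → InjLift q →
        ∀ f : G →ₗ[R] A, f ∘ₗ i = 0 → ∃ g : G →ₗ[R] I, q ∘ₗ g = f ∧ g ∘ₗ i = 0 := by
  obtain ⟨T, i, hT, hi, hdi, hlift⟩ := exists_special_complex (ModuleCat.of R M)
  refine ⟨ModuleCat.of R (LinearMap.ker (T.d 0 (-1)).hom), i.codRestrict _ hdi, by simpa using hT.gi_ker (-1),
    fun x y h => hi (congrArg Subtype.val h), ?_⟩
  intro A I q hA hq f hfi
  obtain ⟨C, hC, ⟨e⟩⟩ := hA.exists_totallyAcyclic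
  obtain ⟨F, hF⟩ := hT.exists_extend hC (Submodule.subtype _ ∘ₗ e.toLinearMap ∘ₗ f)
    fun z => (e (f z)).2
  obtain ⟨Φ, hΦF, hΦi⟩ := hlift C hC F fun x => by
    refine (hF ⟨i x, hdi x⟩).trans ?_
    have := LinearMap.congr_fun hfi x
    exact congrArg Subtype.val ((congrArg e this).trans (map_zero e))
  let P := totalModule C
  let g : LinearMap.ker (T.d 0 (-1)).hom →ₗ[R] C.X (0+1) :=
    LinearMap.proj (0+1) ∘ₗ LinearMap.snd R P P ∘ₗ (Φ.f 0).hom ∘ₗ Submodule.subtype _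
  have hg : ∀ z, C.d (0+1) 0 (g z) = (e (f z)).1 := by
    intro z
    refine Eq.trans ?_ (hF z)
    have h1 : (Φ.f 0 z.1 : P × P).1 = 0 := by
      refine diskComplex_cycle P 0 _ ?_
      have := congrArg (fun k => k z.1) (congrArg ModuleCat.Hom.hom (Φ.comm 0 (0-1)))
      have hz : T.d 0 (0-1) z.1 = 0 := z.2
      refine Eq.trans this ((congrArg (Φ.f (0-1)) hz).trans ?_)
      exact map_zero (Φ.f (0-1)).hom
    have h2 := congrArg (fun k => k z.1)
      (congrArg ModuleCat.Hom.hom (HomologicalComplex.congr_hom hΦF 0))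
    refine Eq.trans ?_ h2
    refine Eq.trans ?_ (diskCover_f C 0 _ _).symm
    have h3 := congrArg (fun w : ∀ n, C.X n => w 0 + C.d (0+1) 0 (g z)) h1
    exact ((zero_add _).symm.trans h3.symm)
  let p : C.X (0+1) →ₗ[R] A := e.symm.toLinearMap ∘ₗ toKer C (0+1) 0 (-1)
  obtain ⟨l, hl⟩ := hq _ (hC.injective (0+1)) p
  refine ⟨l ∘ₗ g, ?_, ?_⟩
  · ext z
    refine (LinearMap.congr_fun hl (g z)).trans ?_
    change e.symm (toKer C (0+1) 0 (-1) (g z)) = f z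
    rw [LinearEquiv.symm_apply_eq]
    exact Subtype.ext (hg z)
  · ext x
    have : g (i.codRestrict _ hdi x) = 0 := by
      have h := hΦi x
      exact congrArg (fun z : P × P => z.2 (0+1)) h
    exact (congrArg l this).trans (map_zero l)

end SpecialPreenvelope

section SpecialPreenvelope

variable {R : Type u} [CommRing R] [IsNoetherianRing R]

/-- Every module embeds in a Gorenstein injective module by a map with the left lifting property
against surjections with Gorenstein injective kernel. -/
theorem exists_embedding_gi (M : Type u) [AddCommGroup M] [Module R M] :
    ∃ (G : ModuleCat.{u} R) (i : M →ₗ[R] G), GI R G ∧ Function.Injective i ∧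
      ∀ (A B C : ModuleCat.{u} R) (j : A →ₗ[R] B) (p : B →ₗ[R] C), GI R A →
        Function.Injective j → Function.Exact j p → Function.Surjective p →
        ∀ (f : M →ₗ[R] B) (v : G →ₗ[R] C), p ∘ₗ f = v ∘ₗ i →
          ∃ h : G →ₗ[R] B, h ∘ₗ i = f ∧ p ∘ₗ h = v := by
  obtain ⟨G, i, hG, hi, hlift⟩ := exists_special_preenvelope (R := R) M
  refine ⟨G, i, hG, hi, ?_⟩
  intro A B C j p hA hj hex hp f v hfv
  obtain ⟨I, A', a, q, hA', hs⟩ := hA.exists_coresolution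
  obtain ⟨φ, hφ⟩ := hs.injective.out j hj a
  obtain ⟨ψ, hψ⟩ := p.exists_comp_eq_of_ker_le hp (q ∘ₗ φ) fun x hx => by
    obtain ⟨a, rfl⟩ := (hex x).1 hx
    simp [hφ, hs.exact.apply_apply_eq_zero]
  obtain ⟨h₀, hh₀⟩ := hs.injective.out i hi (φ ∘ₗ f)
  obtain ⟨g, hg, hgi⟩ := hlift A' I q hA' hs.lift (ψ ∘ₗ v - q ∘ₗ h₀) (by
    ext x
    have h1 := LinearMap.congr_fun hfv x
    have h2 := LinearMap.congr_fun hψ (f x)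
    simp only [LinearMap.comp_apply] at h1 h2
    simp only [LinearMap.comp_apply, LinearMap.sub_apply, LinearMap.zero_apply, hh₀]
    rw [← h1, h2, sub_self])
  have hk : Function.Injective (φ.prod p) := by
    rw [injective_iff_map_eq_zero]
    intro x hx
    obtain ⟨y, rfl⟩ := (hex x).1 (congrArg Prod.snd hx)
    have h1 : φ (j y) = 0 := congrArg Prod.fst hx
    rw [hφ] at h1
    rw [(injective_iff_map_eq_zero a).1 hs.inj y h1, map_zero]
  obtain ⟨h, hh⟩ := (φ.prod p).exists_comp_eq_of_range_le hk ((h₀ + g).prod v) fun x => by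
    obtain ⟨b, hb⟩ := hp (v x)
    have h1 : q (h₀ x + g x - φ b) = 0 := by
      have h2 := LinearMap.congr_fun hψ b
      have h3 := LinearMap.congr_fun hg x
      simp only [LinearMap.comp_apply, LinearMap.sub_apply] at h2 h3
      rw [map_sub, map_add, h3, ← h2, hb]; abel
    obtain ⟨y, hy⟩ := (hs.exact _).1 h1
    refine ⟨b + j y, Prod.ext ?_ ?_⟩
    · simp [hφ, hy]
    · simp [hb, hex.apply_apply_eq_zero]
  have e1 : ∀ x, φ (h x) = h₀ x + g x := fun x => congrArg Prod.fst (LinearMap.congr_fun hh x)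
  have e2 : ∀ x, p (h x) = v x := fun x => congrArg Prod.snd (LinearMap.congr_fun hh x)
  refine ⟨h, LinearMap.ext fun x => hk (Prod.ext ?_ ?_), LinearMap.ext e2⟩
  · change φ (h (i x)) = φ (f x)
    have h1 := LinearMap.congr_fun hgi x
    simp only [LinearMap.comp_apply, LinearMap.zero_apply] at h1
    rw [e1, hh₀, h1, add_zero]; rfl
  · exact (e2 (i x)).trans (LinearMap.congr_fun hfv x).symm

variable {A B C : Type u} [AddCommGroup A] [Module R A] [AddCommGroup B] [Module R B]
  [AddCommGroup C] [Module R C]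

theorem GI.extension (i : A →ₗ[R] B) (p : B →ₗ[R] C) (hi : Function.Injective i)
    (hex : Function.Exact i p) (hp : Function.Surjective p) (hA : GI R A) (hC : GI R C) :
    GI R B := by
  obtain ⟨G, k, hG, hk, hlift⟩ := exists_embedding_gi (R := R) B
  have h0 : Module.Injective R PUnit.{u+1} := ⟨fun X Y _ _ _ _ f hf g => ⟨0, fun x => rfl⟩⟩
  obtain ⟨v, hv, -⟩ := hlift (ModuleCat.of R C) (ModuleCat.of R C) (ModuleCat.of R PUnit.{u+1})
    LinearMap.id 0 hC Function.injective_id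
    (fun x => ⟨fun _ => ⟨x, rfl⟩, fun _ => rfl⟩) (fun x => ⟨0, rfl⟩) p 0 rfl
  obtain ⟨r, hr, -⟩ := hlift (ModuleCat.of R A) (ModuleCat.of R B) (ModuleCat.of R C) i p hA hi hex
    hp LinearMap.id v (by rw [hv]; rfl)
  exact GI.of_retract k r hr hG

end SpecialPreenvelope

section ShortExactSequences

variable {R : Type u} [CommRing R]
variable {A B C D M N : Type u} [AddCommGroup A] [Module R A] [AddCommGroup B] [Module R B]
  [AddCommGroup C] [Module R C] [AddCommGroup D] [Module R D] [AddCommGroup M] [Module R M]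
  [AddCommGroup N] [Module R N]

/-- `0 → A → B → C → 0` is exact. -/
structure ShortExactMaps (i : A →ₗ[R] B) (p : B →ₗ[R] C) : Prop where
  inj : Function.Injective i
  exact : Function.Exact i p
  surj : Function.Surjective p

lemma ShortExactMaps.mkQ (N : Submodule R M) : ShortExactMaps N.subtype N.mkQ :=
  ⟨N.subtype_injective, LinearMap.exact_subtype_mkQ N, N.mkQ_surjective⟩

lemma ShortExactMaps.range_mkQ (i : A →ₗ[R] B) (hi : Function.Injective i) :
    ShortExactMaps i (LinearMap.range i).mkQ :=
  ⟨hi, LinearMap.exact_map_mkQ_range i, Submodule.mkQ_surjective _⟩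

lemma ShortExactMaps.ker (p : B →ₗ[R] C) (hp : Function.Surjective p) :
    ShortExactMaps (LinearMap.ker p).subtype p :=
  ⟨Subtype.val_injective, fun x => by simp, hp⟩

variable (R A B) in
/-- `A` is a retract of `B`. -/
def IsRetract : Prop := ∃ (i : A →ₗ[R] B) (r : B →ₗ[R] A), r ∘ₗ i = LinearMap.id

lemma IsRetract.gi (h : IsRetract R A B) (hB : GI R B) : GI R A :=
  let ⟨i, r, hr⟩ := h
  GI.of_retract i r hr hB

lemma IsRetract.injective (h : IsRetract R A B) (hB : Module.Injective R B) :
    Module.Injective R A :=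
  let ⟨i, r, hr⟩ := h
  Module.Injective.of_retract i r hr hB

lemma IsRetract.dual (h : IsRetract R A B) :
    IsRetract R (CharacterModule A) (CharacterModule B) := by
  obtain ⟨i, r, hr⟩ := h
  refine ⟨CharacterModule.dual r, CharacterModule.dual i, ?_⟩
  rw [← CharacterModule.dual_comp, hr]
  rfl

lemma ShortExactMaps.exists_section_of_retraction {i : A →ₗ[R] B} {p : B →ₗ[R] C}
    (h : ShortExactMaps i p) (r : B →ₗ[R] A) (hr : r ∘ₗ i = LinearMap.id) :
    ∃ s : C →ₗ[R] B, p ∘ₗ s = LinearMap.id := by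
  obtain ⟨s, hs⟩ := p.exists_comp_eq_of_ker_le h.surj (LinearMap.id - i ∘ₗ r) fun x hx => by
    obtain ⟨a, rfl⟩ := (h.exact x).1 hx
    have := LinearMap.congr_fun hr a
    simp only [LinearMap.comp_apply, LinearMap.id_apply] at this
    simp [this]
  refine ⟨s, ?_⟩
  ext x
  obtain ⟨y, rfl⟩ := h.surj x
  have := LinearMap.congr_fun hs y
  simp only [LinearMap.comp_apply, LinearMap.id_apply, LinearMap.sub_apply] at this ⊢
  rw [this, map_sub, h.exact.apply_apply_eq_zero, sub_zero]

lemma ShortExactMaps.exists_retraction_of_section {i : A →ₗ[R] B} {p : B →ₗ[R] C}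
    (h : ShortExactMaps i p) (s : C →ₗ[R] B) (hs : p ∘ₗ s = LinearMap.id) :
    ∃ r : B →ₗ[R] A, r ∘ₗ i = LinearMap.id := by
  have hs' := LinearMap.congr_fun hs
  simp only [LinearMap.comp_apply, LinearMap.id_apply] at hs'
  obtain ⟨r, hr⟩ := i.exists_comp_eq_of_range_le h.inj (LinearMap.id - s ∘ₗ p) fun x =>
    (h.exact _).1 (by simp [hs'])
  refine ⟨r, LinearMap.ext fun x => h.inj ?_⟩
  have := LinearMap.congr_fun hr (i x)
  simp only [LinearMap.comp_apply, LinearMap.id_apply, LinearMap.sub_apply] at this ⊢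
  rw [this, h.exact.apply_apply_eq_zero, map_zero, sub_zero]

lemma ShortExactMaps.dual {i : A →ₗ[R] B} {p : B →ₗ[R] C} (h : ShortExactMaps i p) :
    ShortExactMaps (CharacterModule.dual p) (CharacterModule.dual i) where
  inj := CharacterModule.dual_injective_of_surjective p h.surj
  surj := CharacterModule.dual_surjective_of_injective i h.inj
  exact c := by
    constructor
    · intro hc
      have hc' : ∀ a, c (i a) = 0 := fun a => congrArg (fun c : CharacterModule A => c a) hc
      have hker : p.toAddMonoidHom.ker ≤ AddMonoidHom.ker c := by
        intro x hx
        obtain ⟨a, rfl⟩ := (h.exact x).1 hx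
        exact hc' a
      refine ⟨p.toAddMonoidHom.liftOfSurjective h.surj ⟨c, hker⟩, ?_⟩
      ext x
      exact AddMonoidHom.liftOfRightInverse_comp_apply _ _
        (Function.rightInverse_surjInv h.surj) _ _
    · rintro ⟨c, rfl⟩
      ext a
      change c (p (i a)) = 0
      rw [h.exact.apply_apply_eq_zero]
      exact c.map_zero

/-- Swap the arguments of a pairing with values in the rational circle. -/
def charSwap (f : A →ₗ[R] CharacterModule B) : B →ₗ[R] CharacterModule A where
  toFun b :=
    { toFun := fun a => f a b
      map_zero' := by rw [map_zero]; rfl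
      map_add' := fun x y => by rw [map_add]; rfl }
  map_add' x y := by ext a; exact (f a).map_add x y
  map_smul' r x := by
    ext a
    exact (congrArg (fun c : CharacterModule B => c x) (f.map_smul r a)).symm

variable (R M) in
/-- The evaluation map into the double character module. -/
def charEval : M →ₗ[R] CharacterModule (CharacterModule M) := charSwap LinearMap.id

lemma charEval_injective : Function.Injective (charEval R M) := by
  rw [injective_iff_map_eq_zero]
  intro m hm
  exact CharacterModule.eq_zero_of_character_apply fun c =>
    congrArg (fun x : CharacterModule (CharacterModule M) => x c) hm

/-- If the evaluation map of `A` extends along `A → B`, then the dual sequence splits. -/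
lemma ShortExactMaps.isRetract_dual_dual {i : A →ₗ[R] B} {p : B →ₗ[R] C}
    (h : ShortExactMaps i p) (f : B →ₗ[R] CharacterModule (CharacterModule A))
    (hf : f ∘ₗ i = charEval R A) :
    IsRetract R (CharacterModule (CharacterModule A)) (CharacterModule (CharacterModule B)) ∧
    IsRetract R (CharacterModule (CharacterModule C)) (CharacterModule (CharacterModule B)) := by
  have hs : CharacterModule.dual i ∘ₗ charSwap f = LinearMap.id := by
    ext c a
    exact congrArg (fun x : CharacterModule (CharacterModule A) => x c) (LinearMap.congr_fun hf a)
  obtain ⟨r, hr⟩ := h.dual.exists_retraction_of_section _ hs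
  exact ⟨IsRetract.dual ⟨_, _, hs⟩, IsRetract.dual ⟨_, _, hr⟩⟩

lemma InjLift.exists_section {p : B →ₗ[R] C} (h : InjLift p) (hC : Module.Injective R C) :
    ∃ s : C →ₗ[R] B, p ∘ₗ s = LinearMap.id := h _ hC _

lemma GI.injLift' (h : GI R A) {i : A →ₗ[R] B} {p : B →ₗ[R] C} (hs : ShortExactMaps i p) :
    InjLift p := h.injLift i p hs.inj hs.exact hs.surj

end ShortExactSequences

section DoubleDual

variable {R : Type u} [CommRing R]
variable {A B C D M N : Type u} [AddCommGroup A] [Module R A] [AddCommGroup B] [Module R B]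
  [AddCommGroup C] [Module R C] [AddCommGroup D] [Module R D] [AddCommGroup M] [Module R M]
  [AddCommGroup N] [Module R N]

lemma exists_character_eq_of_notMem (N : Submodule R M) {x : M} (hx : x ∉ N) :
    ∃ c : CharacterModule M, (∀ y ∈ N, c y = 0) ∧ c x ≠ 0 := by
  have : N.mkQ x ≠ 0 := by simpa using hx
  obtain ⟨c, hc⟩ := CharacterModule.exists_character_apply_ne_zero_of_ne_zero this
  refine ⟨CharacterModule.dual N.mkQ c, fun y hy => ?_, hc⟩
  change c (N.mkQ y) = 0
  rw [show N.mkQ y = 0 from (Submodule.Quotient.mk_eq_zero N).2 hy]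
  exact c.map_zero

lemma isPure_range_charEval : IsPure (LinearMap.range (charEval R M)) := by
  intro k l r x hx
  choose m hm using hx
  let ρ : (Fin l → M) →ₗ[R] (Fin k → M) :=
    LinearMap.pi fun a => ∑ b, r a b • LinearMap.proj b
  have hρ : ∀ y a, ρ y a = ∑ b, r a b • y b := fun y a => by simp [ρ]
  by_cases h : m ∈ LinearMap.range ρ
  · obtain ⟨y, hy⟩ := h
    refine ⟨fun b => charEval R M (y b), fun b => ⟨_, rfl⟩, fun a => ?_⟩
    rw [← hm a, ← hy, hρ, map_sum]
    simp
  · exfalso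
    obtain ⟨c, hc, hcm⟩ := exists_character_eq_of_notMem _ h
    let χ : Fin k → CharacterModule M := fun a =>
      CharacterModule.dual (LinearMap.single R (fun _ => M) a) c
    have hχ : ∀ z : Fin k → M, c z = ∑ a, χ a (z a) := by
      intro z
      have : z = ∑ a, LinearMap.single R (fun _ => M) a (z a) := by
        simp [Finset.univ_sum_single]
      conv_lhs => rw [this]
      exact map_sum (c : (Fin k → M) →+ _) _ _
    have hb : ∀ b, ∑ a, r a b • χ a = 0 := by
      intro b
      ext y
      have h1 := hc _ ⟨LinearMap.single R (fun _ => M) b y, rfl⟩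
      rw [hχ] at h1
      have h2 : ∀ a, ρ (LinearMap.single R (fun _ => M) b y) a = r a b • y := by
        intro a
        rw [hρ, Finset.sum_eq_single b]
        · simp
        · intro b' _ hb'; simp [Pi.single_eq_of_ne hb']
        · simp
      have h3 : (∑ a, r a b • χ a) y = ∑ a, (r a b • χ a) y :=
        AddMonoidHom.finsetSum_apply (M := M) (N := AddCircle (1:ℚ)) _ _ _
      rw [h3]
      refine Eq.trans (Finset.sum_congr rfl fun a _ => ?_) h1
      rw [h2]; rfl
    apply hcm
    rw [hχ]
    have h4 : ∀ a, χ a (m a) = ∑ b, x b (r a b • χ a) := by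
      intro a
      have := congrArg (fun f : CharacterModule (CharacterModule M) => f (χ a)) (hm a)
      refine this.trans ?_
      exact AddMonoidHom.finsetSum_apply (M := CharacterModule M) (N := AddCircle (1:ℚ)) _ _ _
    rw [Finset.sum_congr rfl fun a _ => h4 a, Finset.sum_comm]
    refine Finset.sum_eq_zero fun b _ => ?_
    rw [← map_sum, hb, map_zero]

variable [IsNoetherianRing R]

lemma Module.Injective.of_dual_dual (h : Module.Injective R (CharacterModule (CharacterModule M))) :
    Module.Injective R M :=
  (isPure_range_charEval.injective h).of_linearEquiv
    (LinearEquiv.ofInjective _ charEval_injective).symm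

lemma Module.Injective.flat_dual (h : Module.Injective R M) : Module.Flat R (CharacterModule M) := by
  refine Module.Flat.of_forall_isTrivialRelation fun {l f φ} hφ => ?_
  let s : (Fin l → R) →ₗ[R] R := ∑ i, f i • LinearMap.proj i
  have hs : ∀ v, s v = ∑ i, f i * v i := fun v => by simp [s]
  obtain ⟨k, a, ha⟩ := Submodule.fg_iff_exists_fin_generating_family.1
    (IsNoetherian.noetherian (LinearMap.ker s))
  have haK : ∀ j, a j ∈ LinearMap.ker s := fun j => by
    rw [← ha]; exact Submodule.subset_span ⟨j, rfl⟩
  let ρ : (Fin l → M) →ₗ[R] (Fin k → M) :=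
    LinearMap.pi fun j => ∑ i, a j i • LinearMap.proj i
  have hρ : ∀ y j, ρ y j = ∑ i, a j i • y i := fun y j => by simp [ρ]
  let Φ : CharacterModule (Fin l → M) :=
    ∑ i, CharacterModule.dual (LinearMap.proj (R := R) (φ := fun _ => M) i) (φ i)
  have hΦ : ∀ y, Φ y = ∑ i, φ i (y i) := fun y =>
    AddMonoidHom.finsetSum_apply (M := Fin l → M) (N := AddCircle (1:ℚ)) _ _ _
  have hker : ∀ y, ρ y = 0 → Φ y = 0 := by
    intro y hy
    let Y : (Fin l → R) →ₗ[R] M := ∑ i, (LinearMap.proj i).smulRight (y i)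
    have hY : ∀ v, Y v = ∑ i, v i • y i := fun v => by simp [Y]
    have hY0 : ∀ v, s v = 0 → Y v = 0 := by
      have hle : Submodule.span R (Set.range a) ≤ LinearMap.ker Y := by
        rw [Submodule.span_le]
        rintro _ ⟨j, rfl⟩
        change Y (a j) = 0
        rw [hY, ← hρ, hy]; rfl
      rw [ha] at hle
      exact fun v hv => hle hv
    obtain ⟨g₀, hg₀⟩ := s.rangeRestrict.exists_comp_eq_of_ker_le s.surjective_rangeRestrict Y
      fun v hv => hY0 v (congrArg Subtype.val hv)
    obtain ⟨g, hg⟩ := h.out (LinearMap.range s).subtype (Submodule.subtype_injective _) g₀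
    have hgY : ∀ v, g (s v) = Y v := fun v =>
      (hg (s.rangeRestrict v)).trans (LinearMap.congr_fun hg₀ v)
    have hy' : ∀ i, y i = f i • g 1 := by
      intro i
      have h1 := hgY (Pi.single i 1)
      rw [hY, hs] at h1
      simp only [Pi.single_apply, ite_smul, one_smul, zero_smul, mul_ite, mul_one, mul_zero,
        Finset.sum_ite_eq', Finset.mem_univ, if_true] at h1
      rw [← h1, ← map_smul, smul_eq_mul, mul_one]
    rw [hΦ]
    have h2 := congrArg (fun c : CharacterModule M => c (g 1)) hφ
    have h3 : (∑ i, f i • φ i) (g 1) = ∑ i, (f i • φ i) (g 1) :=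
      AddMonoidHom.finsetSum_apply (M := M) (N := AddCircle (1:ℚ)) _ _ _
    refine Eq.trans (Finset.sum_congr rfl fun i _ => ?_) (h3.symm.trans h2)
    rw [hy']; rfl
  obtain ⟨c₀, hc₀⟩ := (ShortExactMaps.ker ρ.rangeRestrict ρ.surjective_rangeRestrict).dual.exact Φ
    |>.1 (by ext y; exact hker y.1 (congrArg Subtype.val y.2))
  obtain ⟨c, hc⟩ := CharacterModule.dual_surjective_of_injective (LinearMap.range ρ).subtype
    (Submodule.subtype_injective _) c₀
  have hcρ : ∀ y, c (ρ y) = Φ y := by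
    intro y
    rw [← hc₀, ← hc]; rfl
  refine ⟨k, fun i j => a j i, fun j => CharacterModule.dual (LinearMap.single R (fun _ => M) j) c,
    fun i => ?_, fun j => ?_⟩
  · ext x
    have h1 := hcρ (Pi.single i x)
    rw [hΦ, Finset.sum_eq_single i (fun b _ hb => by rw [Pi.single_eq_of_ne hb, map_zero])
      (by simp), Pi.single_eq_same] at h1
    rw [← h1]
    refine Eq.trans ?_
      (AddMonoidHom.finsetSum_apply (M := M) (N := AddCircle (1:ℚ)) _ _ _).symm
    have h2 : ρ (Pi.single i x) = ∑ j, Pi.single j (a j i • x) := by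
      rw [Finset.univ_sum_single]
      ext j
      rw [hρ, Finset.sum_eq_single i (fun b _ hb => by rw [Pi.single_eq_of_ne hb, smul_zero])
        (by simp), Pi.single_eq_same]
    rw [h2, map_sum]
    rfl
  · exact (hs (a j)).symm.trans (haK j)

lemma Module.Injective.dual_dual (h : Module.Injective R M) :
    Module.Injective R (CharacterModule (CharacterModule M)) :=
  Module.Flat.iff_characterModule_injective.1 h.flat_dual

end DoubleDual

section DualGorensteinFlat

open TensorProduct

variable {R : Type u} [CommRing R]

/-- An exact complex of flat modules, exact after tensoring with injective modules. -/
structure FlatTotallyAcyclic (C : ChainComplex (ModuleCat.{u} R) ℤ) : Prop where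
  flat : ∀ n, Module.Flat R (C.X n)
  exact : ∀ (j : ℤ) (x : C.X (j+1)), C.d (j+1) j x = 0 → ∃ y, C.d (j+1+1) (j+1) y = x
  tensor_exact : ∀ (I : Type u) [AddCommGroup I] [Module R I], Module.Injective R I →
    ∀ (j : ℤ) (x : I ⊗[R] C.X (j+1)), (C.d (j+1) j).hom.lTensor I x = 0 →
      ∃ y, (C.d (j+1+1) (j+1)).hom.lTensor I y = x

lemma FlatTotallyAcyclic.shortExactMaps {C : ChainComplex (ModuleCat.{u} R) ℤ}
    (h : FlatTotallyAcyclic C) (j : ℤ) :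
    ShortExactMaps (LinearMap.ker (C.d (j+1+1) (j+1)).hom).subtype (toKer C (j+1+1) (j+1) j) where
  inj := Submodule.subtype_injective _
  exact x := ⟨fun hx => ⟨⟨x, congrArg Subtype.val hx⟩, rfl⟩, fun ⟨y, hy⟩ => by
    rw [← hy]; exact Subtype.ext y.2⟩
  surj x := by
    obtain ⟨y, hy⟩ := h.exact j x.1 x.2
    exact ⟨y, Subtype.ext hy⟩

lemma FlatTotallyAcyclic.lTensor_injective {C : ChainComplex (ModuleCat.{u} R) ℤ}
    (h : FlatTotallyAcyclic C) (I : Type u) [AddCommGroup I] [Module R I] (hI : Module.Injective R I)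
    (j : ℤ) :
    Function.Injective ((LinearMap.ker (C.d (j+1+1) (j+1)).hom).subtype.lTensor I) := by
  rw [injective_iff_map_eq_zero]
  intro x hx
  obtain ⟨y, rfl⟩ := LinearMap.lTensor_surjective I (h.shortExactMaps (j+1)).surj x
  obtain ⟨z, rfl⟩ := h.tensor_exact I hI (j+1+1) y (by
    rw [← LinearMap.lTensor_comp_apply] at hx
    exact hx)
  rw [← LinearMap.lTensor_comp_apply]
  have : toKer C (j+1+1+1) (j+1+1) (j+1) ∘ₗ (C.d (j+1+1+1+1) (j+1+1+1)).hom = 0 := by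
    refine LinearMap.ext fun x => Subtype.ext ?_
    change (C.d (j+1+1+1+1) (j+1+1+1) ≫ C.d (j+1+1+1) (j+1+1)) x = 0
    rw [C.d_comp_d]; rfl
  rw [this, LinearMap.lTensor_zero]; rfl

lemma FlatTotallyAcyclic.injStep {C : ChainComplex (ModuleCat.{u} R) ℤ}
    (h : FlatTotallyAcyclic C) (j : ℤ) :
    InjStep (CharacterModule.dual (toKer C (j+1+1) (j+1) j))
      (CharacterModule.dual (LinearMap.ker (C.d (j+1+1) (j+1)).hom).subtype) where
  inj := (h.shortExactMaps j).dual.inj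
  exact := (h.shortExactMaps j).dual.exact
  surj := (h.shortExactMaps j).dual.surj
  injective := Module.Flat.iff_characterModule_injective.1 (h.flat _)
  lift I _ _ hI f := by
    have hinj := h.lTensor_injective I hI j
    rw [LinearMap.lTensor_inj_iff_rTensor_inj, rTensor_injective_iff_lcomp_surjective] at hinj
    obtain ⟨g, hg⟩ := hinj (charSwap f)
    refine ⟨charSwap g, ?_⟩
    ext x z
    exact congrArg (fun c : CharacterModule I => c x) (LinearMap.congr_fun hg z)

lemma FlatTotallyAcyclic.gi_dual_ker {C : ChainComplex (ModuleCat.{u} R) ℤ}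
    (h : FlatTotallyAcyclic C) (j : ℤ) :
    GI R (CharacterModule (LinearMap.ker (C.d (j+1) j).hom)) := by
  refine GI.of_class (fun G => ∃ j, Nonempty (G ≃ₗ[R] CharacterModule
    (LinearMap.ker (C.d (j+1) j).hom))) ?_ ?_ ⟨j, ⟨LinearEquiv.refl _ _⟩⟩
  · rintro G ⟨j, ⟨e⟩⟩
    exact ⟨ModuleCat.of R (CharacterModule (C.X (j+1+1))), ModuleCat.of R (CharacterModule
      (LinearMap.ker (C.d (j+1+1) (j+1)).hom)), _, _,
      ⟨j+1, ⟨LinearEquiv.refl _ _⟩⟩, (h.injStep j).congr e (LinearEquiv.refl _ _)⟩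
  · rintro G ⟨j, ⟨e⟩⟩
    obtain ⟨c, rfl⟩ : ∃ c, j = c + 1 := ⟨j - 1, by ring⟩
    exact ⟨ModuleCat.of R (CharacterModule (C.X (c+1+1))), ModuleCat.of R (CharacterModule
      (LinearMap.ker (C.d (c+1) c).hom)), _, _,
      ⟨c, ⟨LinearEquiv.refl _ _⟩⟩, (h.injStep c).congr (LinearEquiv.refl _ _) e.symm⟩

/-- The character module of a Gorenstein flat module is Gorenstein injective. -/
lemma IsGorensteinFlat.gi_dual {N : ModuleCat.{u} R} (h : IsGorensteinFlat R N) :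
    GI R (CharacterModule N) := by
  obtain ⟨C, h1, h2, h3, ⟨e⟩⟩ := h
  have hC : FlatTotallyAcyclic C := by
    refine ⟨h1, fun j x hx => ?_, fun I _ _ hI j x hx => ?_⟩
    · have := (HomologicalComplex.exactAt_iff' C (j+1+1) (j+1) j (by simp) (by simp)).1 (h2 (j+1))
      rw [ShortComplex.moduleCat_exact_iff] at this
      exact this x hx
    · have := (HomologicalComplex.exactAt_iff' _ (j+1+1) (j+1) j (by simp) (by simp)).1
        (h3 (ModuleCat.of R I) ((Module.injective_iff_injective_object R I).1 hI) (j+1))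
      rw [ShortComplex.moduleCat_exact_iff] at this
      exact this x hx
  exact GI.of_equiv (CharacterModule.congr (e ≪≫ ModuleCat.kernelIsoKer _).toLinearEquiv).symm
    (by simpa using hC.gi_dual_ker (-1))

end DualGorensteinFlat

section DoubleDualReflects

variable {R : Type u} [CommRing R] [IsNoetherianRing R]
variable {M : Type u} [AddCommGroup M] [Module R M]

/-- Gorenstein injectivity descends from the double character module. -/
theorem GI.of_dual_dual
    (hdd : ∀ (A : Type u) [AddCommGroup A] [Module R A], GI R A →
      GI R (CharacterModule (CharacterModule A)))
    (hM : GI R (CharacterModule (CharacterModule M))) : GI R M := by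
  obtain ⟨G, i, hG, hi, hlift⟩ := exists_embedding_gi (R := R) M
  let L := G ⧸ LinearMap.range i
  have hs : ShortExactMaps i (LinearMap.range i).mkQ := ShortExactMaps.range_mkQ i hi
  have hL : GI R (CharacterModule (CharacterModule L)) := by
    obtain ⟨f, hf, -⟩ := hlift (ModuleCat.of R (CharacterModule (CharacterModule M)))
      (ModuleCat.of R (CharacterModule (CharacterModule M))) (ModuleCat.of R PUnit.{u+1})
      LinearMap.id 0 hM Function.injective_id
      (fun x => ⟨fun _ => ⟨x, rfl⟩, fun _ => rfl⟩) (fun x => ⟨0, rfl⟩) (charEval R M) 0 rfl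
    exact (hs.isRetract_dual_dual f hf).2.gi (hdd _ hG)
  have hLinj : Module.Injective R L := by
    obtain ⟨I, A, j, p, hA, hst⟩ := hL.exists_resolution
    obtain ⟨f, hf0, hf⟩ := hlift A I (ModuleCat.of R (CharacterModule (CharacterModule L))) j p hA
      hst.inj hst.exact hst.surj 0 (charEval R L ∘ₗ (LinearMap.range i).mkQ) (by
        refine LinearMap.ext fun x => ?_
        simp [hs.exact.apply_apply_eq_zero])
    obtain ⟨g, hg⟩ := (LinearMap.range i).mkQ.exists_comp_eq_of_ker_le hs.surj f fun x hx => by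
      obtain ⟨a, rfl⟩ := (hs.exact x).1 hx
      exact LinearMap.congr_fun hf0 a
    have hpg : p ∘ₗ g = charEval R L := by
      refine LinearMap.ext fun x => ?_
      obtain ⟨y, rfl⟩ := hs.surj x
      have h1 := LinearMap.congr_fun hg y
      have h2 := LinearMap.congr_fun hf y
      simp only [LinearMap.comp_apply] at h1 h2 ⊢
      rw [h1, h2]
    obtain ⟨E, k, hE, hk⟩ : ∃ (E : ModuleCat.{u} R) (k : L →ₗ[R] E), Module.Injective R E ∧
        Function.Injective k :=
      ⟨Injective.under (ModuleCat.of R L), (Injective.ι (ModuleCat.of R L)).hom,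
        (Module.injective_iff_injective_object R _).2 (Injective.injective_under _),
        (ModuleCat.mono_iff_injective _).1 inferInstance⟩
    obtain ⟨g', hg'⟩ := hst.injective.out k hk g
    refine Module.Injective.of_dual_dual (((ShortExactMaps.range_mkQ k hk).isRetract_dual_dual
      (p ∘ₗ g') ?_).1.injective hE.dual_dual)
    rw [← hpg]
    exact LinearMap.ext fun x => congrArg p (hg' x)
  obtain ⟨E, K, j, p, hK, hst⟩ := hG.exists_resolution
  have hsp : Function.Surjective ((LinearMap.range i).mkQ ∘ₗ p) := hs.surj.comp hst.surj
  have hdual := (⟨hst.inj, hst.exact, hst.surj⟩ : ShortExactMaps j p).dual.dual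
  obtain ⟨f, hf, -⟩ := hlift (ModuleCat.of R (CharacterModule (CharacterModule M)))
      (ModuleCat.of R (CharacterModule (CharacterModule M))) (ModuleCat.of R PUnit.{u+1})
      LinearMap.id 0 hM Function.injective_id
      (fun x => ⟨fun _ => ⟨x, rfl⟩, fun _ => rfl⟩) (fun x => ⟨0, rfl⟩) (charEval R M) 0 rfl
  obtain ⟨t, ht⟩ : ∃ t, CharacterModule.dual (CharacterModule.dual (LinearMap.range i).mkQ) ∘ₗ t =
      LinearMap.id := by
    refine hs.dual.dual.exists_section_of_retraction (CharacterModule.dual (charSwap f)) ?_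
    ext Φ c
    refine congrArg Φ ?_
    ext a
    exact congrArg (fun x : CharacterModule (CharacterModule M) => x c) (LinearMap.congr_fun hf a)
  obtain ⟨t', ht'⟩ := (hdd _ hK).injLift' hdual _ hLinj.dual_dual t
  have hP := ShortExactMaps.ker _ hsp
  obtain ⟨r, hr⟩ := hP.dual.dual.exists_retraction_of_section t' (by
    rw [← ht, ← ht', ← LinearMap.comp_assoc]
    rfl)
  have hPinj : Module.Injective R (LinearMap.ker ((LinearMap.range i).mkQ ∘ₗ p)) :=
    Module.Injective.of_dual_dual (IsRetract.injective ⟨_, _, hr⟩ hst.injective.dual_dual)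
  obtain ⟨s, hs'⟩ := (hPinj.gi.injLift' hP).exists_section hLinj
  obtain ⟨ρ, hρ⟩ := hs.exists_retraction_of_section (p ∘ₗ s) (by
    rw [← LinearMap.comp_assoc]; exact hs')
  exact GI.of_retract i ρ hρ hG

end DoubleDualReflects

section PureClosure

variable (R : Type u) [CommRing R]

/-- Gorenstein injectivity is inherited by double character modules. -/
def DoubleDualStable : Prop := ∀ (A : Type u) [AddCommGroup A] [Module R A], GI R A →
  GI R (CharacterModule (CharacterModule A))

variable {R}

lemma doubleDualStable_of_gorensteinFlat
    (hchar : ∀ M : ModuleCat.{u} R, IsGorensteinInjective M →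
      IsGorensteinFlat R (ModuleCat.of R (CharacterModule M))) : DoubleDualStable R :=
  fun A _ _ hA => (hchar (ModuleCat.of R A) hA).gi_dual

variable [IsNoetherianRing R]

variable {M : Type u} [AddCommGroup M] [Module R M]

lemma GI.of_isPure (hR : DoubleDualStable R) (hM : GI R M) {N : Submodule R M} (hN : IsPure N) :
    GI R N ∧ GI R (M ⧸ N) := by
  obtain ⟨g, hg⟩ := hN.exists_extend (charEval R N)
  have := (ShortExactMaps.mkQ N).isRetract_dual_dual g hg
  exact ⟨GI.of_dual_dual hR (this.1.gi (hR _ hM)), GI.of_dual_dual hR (this.2.gi (hR _ hM))⟩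

lemma GI.of_surjective_of_isPure_ker (hR : DoubleDualStable R) {M' : Type u} [AddCommGroup M']
    [Module R M'] (hM : GI R M) (f : M →ₗ[R] M') (hf : Function.Surjective f)
    (hp : IsPure (LinearMap.ker f)) : GI R M' :=
  GI.of_equiv (f.quotKerEquivOfSurjective hf) (hM.of_isPure hR hp).2

lemma GI.dfinsupp (hR : DoubleDualStable R) {J : Type u} (N : J → Type u)
    [∀ j, AddCommGroup (N j)] [∀ j, Module R (N j)] (h : ∀ j, GI R (N j)) : GI R (Π₀ j, N j) := by
  classical
  let c : (Π₀ j, N j) →ₗ[R] (∀ j, N j) := DFinsupp.coeFnLinearMap R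
  have hc : Function.Injective c := DFunLike.coe_injective
  refine GI.of_equiv (LinearEquiv.ofInjective c hc).symm ((GI.pi h).of_isPure hR ?_).1
  intro k l r x hx
  choose z hz using hx
  let S : Finset J := Finset.univ.biUnion fun a => (z a).support
  have hS : ∀ a, ∀ j ∉ S, ∑ b, r a b • x b j = 0 := by
    intro a j hj
    have h1 : z a j = 0 := by
      by_contra h0
      exact hj (Finset.mem_biUnion.2 ⟨a, Finset.mem_univ _, (z a).mem_support_iff.2 h0⟩)
    have h2 := congrFun (hz a) j
    rw [Finset.sum_apply] at h2
    exact h2.symm.trans h1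
  have hmk₁ : ∀ b, ∀ j ∈ S, DFinsupp.mk S (fun j => x b j) j = x b j := fun b j hj =>
    DFinsupp.mk_of_mem hj
  have hmk₂ : ∀ b, ∀ j ∉ S, DFinsupp.mk S (fun j => x b j) j = 0 := fun b j hj =>
    DFinsupp.mk_of_notMem hj
  refine ⟨fun b => c (DFinsupp.mk S fun j => x b j), fun b => ⟨_, rfl⟩, fun a => ?_⟩
  funext j
  rw [Finset.sum_apply, Finset.sum_apply]
  by_cases hj : j ∈ S
  · refine Finset.sum_congr rfl fun b _ => congrArg (fun t : N j => r a b • t) ?_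
    exact hmk₁ b j hj
  · refine Eq.trans (Finset.sum_eq_zero fun b _ => ?_) (hS a j hj).symm
    exact (congrArg (fun t : N j => r a b • t) (hmk₂ b j hj)).trans (smul_zero _)

/-- Gorenstein injective modules are closed under filtered colimits. -/
lemma GI.of_isColimit (hR : DoubleDualStable R) {J : Type u} [SmallCategory J] [IsFiltered J]
    {F : J ⥤ ModuleCat.{u} R} {c : Cocone F} (hc : IsColimit c) (h : ∀ j, GI R (F.obj j)) :
    GI R c.pt := by
  classical
  let φ : (Π₀ j, F.obj j) →ₗ[R] c.pt := DFinsupp.lsum ℕ fun j => (c.ι.app j).hom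
  have hφ : ∀ j x, φ (DFinsupp.single j x) = c.ι.app j x := fun j x =>
    DFinsupp.lsum_single _ _ _ _
  have hsurj : ∀ x : c.pt, ∃ j y, c.ι.app j y = x := Concrete.isColimit_exists_rep F hc
  have hw : ∀ {i j : J} (u : i ⟶ j) (x : F.obj i), c.ι.app j (F.map u x) = c.ι.app i x :=
    fun u x => congrArg (fun k => k x) (congrArg ModuleCat.Hom.hom (c.w u))
  refine GI.of_surjective_of_isPure_ker hR (GI.dfinsupp hR _ h) φ (fun x => ?_) ?_
  · obtain ⟨j, y, rfl⟩ := hsurj x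
    exact ⟨_, hφ j y⟩
  intro k l r x hx
  choose j y hy using fun b => hsurj (φ (x b))
  obtain ⟨m, hm⟩ := IsFiltered.sup_objs_exists (Finset.univ.image j)
  let u : ∀ b, j b ⟶ m := fun b => (hm (Finset.mem_image_of_mem j (Finset.mem_univ b))).some
  let z : Fin l → F.obj m := fun b => F.map (u b) (y b)
  have hz : ∀ b, c.ι.app m (z b) = φ (x b) := fun b => (hw (u b) _).trans (hy b)
  have h0 : ∀ a, c.ι.app m (∑ b, r a b • z b) = c.ι.app m 0 := by
    intro a
    have h1 : φ (∑ b, r a b • x b) = 0 := hx a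
    rw [map_sum, map_zero, ← h1, map_sum]
    exact Finset.sum_congr rfl fun b _ => by rw [map_smul, map_smul, hz]
  have h1 : ∀ a, ∃ (n : J) (f : m ⟶ n), F.map f (∑ b, r a b • z b) = 0 := by
    intro a
    obtain ⟨n, f, g, hfg⟩ := (Concrete.isColimit_rep_eq_iff_exists F hc _ _).1 (h0 a)
    exact ⟨n, f, hfg.trans (map_zero _)⟩
  choose n f hf using h1
  obtain ⟨p, g, hg⟩ : ∃ (p : J) (g : m ⟶ p), ∀ a, F.map g (∑ b, r a b • z b) = 0 := by
    obtain ⟨p, g, v, hv⟩ := IsFiltered.wideSpan f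
    refine ⟨p, g, fun a => ?_⟩
    rw [← hv a, F.map_comp, ModuleCat.comp_apply, hf, map_zero]
  refine ⟨fun b => x b - DFinsupp.single p (F.map g (z b)), fun b => ?_, fun a => ?_⟩
  · change φ _ = 0
    rw [map_sub, hφ, hw, hz, sub_self]
  · simp only [smul_sub, Finset.sum_sub_distrib]
    rw [sub_eq_self]
    have h2 : ∑ b, r a b • DFinsupp.single p (F.map g (z b)) =
        DFinsupp.single (β := fun j => F.obj j) p (F.map g (∑ b, r a b • z b)) := by
      rw [map_sum, ← DFinsupp.lsingle_apply (R := R), map_sum]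
      refine Finset.sum_congr rfl fun b _ => ?_
      rw [map_smul, map_smul, DFinsupp.lsingle_apply]
    rw [h2, hg, DFinsupp.single_zero]

end PureClosure

section MonoCoker

open MorphismProperty

universe w v'

variable {𝒞 : Type v'} [Category.{w} 𝒞] [Abelian 𝒞]

/-- The monomorphisms whose cokernel satisfies `P`. -/
def monoCoker (P : ObjectProperty 𝒞) : MorphismProperty 𝒞 :=
  fun _ _ f => Mono f ∧ P (cokernel f)

variable (P : ObjectProperty 𝒞)

instance [P.IsClosedUnderIsomorphisms] : (monoCoker P).IsStableUnderCobaseChange where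
  of_isPushout sq h := by
    have := isIso_cokernel_map_of_isPushout sq.flip
    exact ⟨(monomorphisms 𝒞).of_isPushout sq h.1,
      P.prop_of_iso (asIso (cokernel.map _ _ _ _ sq.w.symm)) h.2⟩

instance [P.IsStableUnderRetracts] : (monoCoker P).IsStableUnderRetracts where
  of_retract {X' Y' X Y} f' f h hf := by
    refine ⟨(monomorphisms 𝒞).of_retract h hf.1, P.prop_of_retract
      { i := cokernel.map f' f h.left.i h.right.i (by simp)
        r := cokernel.map f f' h.left.r h.right.r (by simp)
        retract := ?_ } hf.2⟩
    rw [← cancel_epi (cokernel.π f')]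
    simp

instance [P.ContainsZero] [P.IsClosedUnderIsomorphisms] [P.IsClosedUnderExtensions] :
    (monoCoker P).IsMultiplicative where
  id_mem X := ⟨inferInstance, P.prop_of_isZero (isZero_cokernel_of_epi _)⟩
  comp_mem f g hf hg := by
    have := hf.1
    have := hg.1
    refine ⟨mono_comp f g, ?_⟩
    let S := ShortComplex.mk (cokernel.map f (f ≫ g) (𝟙 _) g (by simp))
      (cokernel.map (f ≫ g) g f (𝟙 _) (by simp)) (by rw [← cancel_epi (cokernel.π _)]; simp)
    have : Epi S.g := by
      have h : cokernel.π (f ≫ g) ≫ S.g = cokernel.π g := by simp [S]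
      exact epi_of_epi_fac h
    have hm : Mono S.f := by
      have h2 := (kernelCokernelCompSequence_exact f g).exact 2
      exact h2.mono_g ((isZero_kernel_of_mono g).eq_of_src _ _)
    exact P.prop_X₂_of_shortExact (S := S)
      { exact := (kernelCokernelCompSequence_exact f g).exact 3 } hf.2 hg.2

lemma monoCoker_isStableUnderColimitsOfShape (J : Type*) [Category* J]
    [(monomorphisms 𝒞).IsStableUnderColimitsOfShape J] [P.IsClosedUnderColimitsOfShape J] :
    (monoCoker P).IsStableUnderColimitsOfShape J where
  condition X₁ X₂ c₁ c₂ h₁ h₂ f hf φ hφ := by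
    refine ⟨IsStableUnderColimitsOfShape.condition (W := monomorphisms 𝒞) X₁ X₂ c₁ c₂ h₁ h₂ f
      (fun j => (hf j).1) φ hφ, ?_⟩
    let Q : J ⥤ 𝒞 :=
      { obj j := cokernel (f.app j)
        map {i j} a := cokernel.map _ _ (X₁.map a) (X₂.map a) (f.naturality a).symm
        map_id j := by
          rw [← cancel_epi (cokernel.π _)]
          simp
        map_comp a b := by
          rw [← cancel_epi (cokernel.π _)]
          simp }
    let c : Cocone Q :=
      { pt := cokernel φ
        ι :=
          { app j := cokernel.map _ _ (c₁.ι.app j) (c₂.ι.app j) (hφ j).symm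
            naturality i j a := by
              rw [← cancel_epi (cokernel.π _)]
              simp [Q] } }
    let π (s : Cocone Q) : Cocone X₂ :=
      { pt := s.pt
        ι :=
          { app j := cokernel.π (f.app j) ≫ s.ι.app j
            naturality i j a := by
              have h := s.w a
              simp only [Functor.const_obj_obj, Functor.const_obj_map, Category.comp_id]
              rw [← h]
              simp [Q] } }
    have hπ (s : Cocone Q) : φ ≫ h₂.desc (π s) = 0 := by
      refine h₁.hom_ext fun j => ?_
      rw [← Category.assoc, hφ, Category.assoc, h₂.fac]
      simp [π]
    have hc : IsColimit c :=
      { desc s := cokernel.desc φ (h₂.desc (π s)) (hπ s)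
        fac s j := by
          rw [← cancel_epi (cokernel.π _)]
          simp [c, π]
        uniq s m hm := by
          rw [← cancel_epi (cokernel.π _), cokernel.π_desc]
          refine h₂.hom_ext fun j => ?_
          rw [h₂.fac]
          simp [π, ← hm, c] }
    have h : P c.pt := P.prop_of_isColimit hc fun j => (hf j).2
    exact h

end MonoCoker

section GIComplexes

variable (R : Type u) [CommRing R] [IsNoetherianRing R]

/-- The complexes of modules with Gorenstein injective components. -/
def giComplexes : ObjectProperty (ChainComplex (ModuleCat.{u} R) ℤ) :=
  fun K => ∀ n, GI R (K.X n)

variable {R}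

instance : (giComplexes R).IsClosedUnderIsomorphisms where
  of_iso e h n := GI.of_equiv ((HomologicalComplex.eval _ _ n).mapIso e).toLinearEquiv (h n)

instance : (giComplexes R).ContainsZero where
  exists_zero := by
    obtain ⟨Z, hZ⟩ := HasZeroObject.zero (C := ChainComplex (ModuleCat.{u} R) ℤ)
    refine ⟨Z, hZ, fun n => ?_⟩
    have : Subsingleton (Z.X n) :=
      ModuleCat.subsingleton_of_isZero ((HomologicalComplex.eval _ _ n).map_isZero hZ)
    exact Module.Injective.gi
      ⟨fun X Y _ _ _ _ f hf g => ⟨0, fun x => Subsingleton.elim (α := Z.X n) _ _⟩⟩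

instance : (giComplexes R).IsStableUnderRetracts where
  of_retract r h n := GI.of_retract (r.i.f n).hom (r.r.f n).hom
    (congrArg (fun φ => ModuleCat.Hom.hom (HomologicalComplex.Hom.f φ n)) r.retract) (h n)

instance : (giComplexes R).IsClosedUnderExtensions where
  prop_X₂_of_shortExact {S} hS h₁ h₃ n := by
    have h := (shortExact_iff_function S.f S.g S.zero).1 hS n
    exact GI.extension (S.f.f n).hom (S.g.f n).hom h.1 h.2.1 h.2.2 (h₁ n) (h₃ n)

lemma giComplexes_isClosedUnderColimitsOfShape (hR : DoubleDualStable R) (J : Type u)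
    [SmallCategory J] [IsFiltered J] : (giComplexes R).IsClosedUnderColimitsOfShape J where
  colimitsOfShape_le := by
    rintro K ⟨h⟩ n
    exact GI.of_isColimit hR (isColimitOfPreserves (HomologicalComplex.eval _ _ n) h.isColimit)
      fun j => h.prop_diag_obj j n

lemma giComplexes_isClosedUnderColimitsOfShape_discrete (hR : DoubleDualStable R) (J : Type u) :
    (giComplexes R).IsClosedUnderColimitsOfShape (Discrete J) where
  colimitsOfShape_le := by
    rintro K ⟨h⟩ n
    classical
    let Z : J → ModuleCat.{u} R := fun j => (h.diag.obj ⟨j⟩).X n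
    have e := (isColimitOfPreserves (HomologicalComplex.eval _ _ n) h.isColimit).coconePointUniqueUpToIso
      ((IsColimit.precomposeHomEquiv
        (Discrete.natIsoFunctor (F := h.diag ⋙ HomologicalComplex.eval _ _ n)) _).symm
        (ModuleCat.coproductCoconeIsColimit Z))
    exact GI.of_equiv e.toLinearEquiv.symm (GI.dfinsupp hR (fun j => Z j) fun j => h.prop_diag_obj ⟨j⟩ n)

lemma monoCoker_giComplexes_of_llp (hR : DoubleDualStable R) {T : Type u}
    {A B : T → ChainComplex (ModuleCat.{u} R) ℤ} (f : ∀ t, A t ⟶ B t) [∀ t, Mono (f t)]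
    (hf : ∀ t, monoCoker (giComplexes R) (f t)) :
    (MorphismProperty.ofHoms f).rlp.llp ≤ monoCoker (giComplexes R) := by
  have h₁ : MorphismProperty.IsStableUnderCoproducts.{u} (monoCoker (giComplexes R)) :=
    { isStableUnderCoproductsOfShape J := by
        have := giComplexes_isClosedUnderColimitsOfShape_discrete hR J
        exact monoCoker_isStableUnderColimitsOfShape _ _ }
  have h₂ : MorphismProperty.IsStableUnderFilteredColimits.{u, u} (monoCoker (giComplexes R)) :=
    { isStableUnderColimitsOfShape J _ _ := by
        have := giComplexes_isClosedUnderColimitsOfShape hR J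
        exact monoCoker_isStableUnderColimitsOfShape _ _ }
  exact llp_rlp_ofHoms_mono_le f _ hf

end GIComplexes

section Precover

variable {R : Type u} [CommRing R]

/-- The quotient of a complex by a family of submodules stable under the differentials. -/
noncomputable def quotComplex (H : ChainComplex (ModuleCat.{u} R) ℤ) (S : ∀ n, Submodule R (H.X n))
    (hS : ∀ i j, S i ≤ (S j).comap (H.d i j).hom) : ChainComplex (ModuleCat.{u} R) ℤ where
  X n := ModuleCat.of R (H.X n ⧸ S n)
  d i j := ModuleCat.ofHom ((S i).mapQ (S j) (H.d i j).hom (hS i j))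
  shape i j h := by
    ext : 1
    refine Submodule.linearMap_qext _ (LinearMap.ext fun x => ?_)
    change (S j).mkQ (H.d i j x) = 0
    rw [H.shape i j h]
    exact map_zero (S j).mkQ
  d_comp_d' i j k _ _ := by
    ext : 1
    refine Submodule.linearMap_qext _ (LinearMap.ext fun x => ?_)
    change (S k).mkQ (H.d j k (H.d i j x)) = 0
    rw [← ModuleCat.comp_apply, H.d_comp_d]
    exact map_zero (S k).mkQ

lemma Submodule.exists_linearMap_of_graph {A B C : Type*} [AddCommGroup A] [Module R A]
    [AddCommGroup B] [Module R B] [AddCommGroup C] [Module R C] (Γ : Submodule R (A × B))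
    (hΓ : ∀ y, ((0, y) : A × B) ∈ Γ → y = 0) (a : C →ₗ[R] A) (ha : ∀ c, ∃ y, (a c, y) ∈ Γ) :
    ∃ b : C →ₗ[R] B, ∀ c, (a c, b c) ∈ Γ := by
  have huniq : ∀ x y y', (x, y) ∈ Γ → (x, y') ∈ Γ → y = y' := fun x y y' h h' =>
    sub_eq_zero.1 (hΓ _ (by simpa using Γ.sub_mem h h'))
  choose b hb using ha
  exact ⟨{ toFun := b
           map_add' := fun c c' => huniq _ _ _ (hb _) (by simpa using Γ.add_mem (hb c) (hb c'))
           map_smul' := fun r c => huniq _ _ _ (hb _) (by simpa using Γ.smul_mem r (hb c)) }, hb⟩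

lemma exists_small_pure_subcomplex (Q : ChainComplex (ModuleCat.{u} R) ℤ) (n : ℤ) (x : Q.X n) :
    ∃ N : ∀ m, Submodule R (Q.X m), x ∈ N n ∧ (∀ m, IsPure (N m)) ∧
      ∃ q : diskComplex (ModuleCat.of R (SmallFree R)) ⟶ Q,
        ∀ m, LinearMap.range (q.f m).hom = N m := by
  classical
  let T : ULift.{u} (ℤ ⊕ ℤ × ℤ) → (∀ m, Q.X m) → ∀ m, Q.X m := fun t y =>
    t.down.elim (fun m => Pi.single m (y m)) fun p => Pi.single p.2 (Q.d p.1 p.2 (y p.1))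
  obtain ⟨N, hx, hN, hT, hc⟩ := exists_isPure_small (R := R) T Cardinal.mk_le_aleph0 (Pi.single n x)
  have h1 : ∀ m, ∀ y ∈ N, Pi.single m (y m) ∈ N := fun m y hy => hT ⟨.inl m⟩ y hy
  have h2 : ∀ i j, ∀ y ∈ N, Pi.single j (Q.d i j (y i)) ∈ N := fun i j y hy =>
    hT ⟨.inr (i, j)⟩ y hy
  let s : ∀ m, Q.X m →ₗ[R] ∀ m, Q.X m := fun m => LinearMap.single R (fun m => Q.X m) m
  have hs : ∀ m y, s m y = Pi.single m y := fun _ _ => rfl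
  let N' : ∀ m, Submodule R (Q.X m) := fun m => N.comap (s m)
  have hd : ∀ i j, ∀ y ∈ N' i, Q.d i j y ∈ N' j := by
    intro i j y hy
    have := h2 i j _ hy
    rwa [hs, Pi.single_eq_same] at this
  have hcard : ∀ m, Cardinal.mk (N' m) ≤ smallCard R := fun m =>
    (Cardinal.mk_le_of_injective (f := fun y : N' m => (⟨s m y, y.2⟩ : N)) fun y z h =>
      Subtype.ext (Pi.single_injective m (congrArg Subtype.val h))).trans hc
  choose p hp using fun m => exists_smallFree_surjective (hcard m)
  refine ⟨N', hx, fun m k l r y hy => ?_, diskOut (E := ModuleCat.of R (SmallFree R))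
    fun m => (N' m).subtype ∘ₗ p m, fun m => le_antisymm ?_ ?_⟩
  · obtain ⟨z, hz, hyz⟩ := hN k l r (fun b => s m (y b)) fun a => by
      have := hy a
      simpa only [N', Submodule.mem_comap, map_sum, map_smul] using this
    refine ⟨fun b => z b m, fun b => h1 m _ (hz b), fun a => ?_⟩
    have := congrFun (hyz a) m
    simpa [hs] using this
  · rintro _ ⟨⟨y, z⟩, rfl⟩
    refine (N' m).add_mem (p m y).2 (hd _ _ _ (p (m + 1) z).2)
  · intro y hy
    obtain ⟨z, hz⟩ := hp m ⟨y, hy⟩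
    refine ⟨((z, 0) : SmallFree R × SmallFree R), (diskOut_f _ _ _ _).trans ?_⟩
    have e : (p m z : Q.X m) = y := congrArg Subtype.val hz
    simp [e]

lemma giComplexes_cokernel_kernel_ι {V Q : ChainComplex (ModuleCat.{u} R) ℤ} (q : V ⟶ Q)
    (h : ∀ n, GI R (LinearMap.range (q.f n).hom)) : giComplexes R (cokernel (kernel.ι q)) := by
  intro n
  have h1 := (shortExact_iff_function (kernel.ι q) (cokernel.π _) (cokernel.condition _)).1
    { exact := ShortComplex.exact_of_g_is_cokernel _ (cokernelIsCokernel _) } n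
  have h2 : (ShortComplex.mk _ _ (kernel.condition q)).Exact :=
    ShortComplex.exact_of_f_is_kernel _ (kernelIsKernel _)
  have h3 : Function.Exact ((kernel.ι q).f n).hom (q.f n).hom :=
    (ShortComplex.ShortExact.moduleCat_exact_iff_function_exact _).1
      (h2.map (HomologicalComplex.eval _ _ n))
  have hker : LinearMap.ker ((cokernel.π (kernel.ι q)).f n).hom = LinearMap.ker (q.f n).hom := by
    rw [LinearMap.exact_iff.1 h1.2.1, LinearMap.exact_iff.1 h3]
  exact GI.of_equiv ((q.f n).hom.quotKerEquivRange.symm.trans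
    ((Submodule.quotEquivOfEq _ _ hker.symm).trans
      (LinearMap.quotKerEquivOfSurjective _ h1.2.2))) (h n)

lemma exists_disk_lift {H : ChainComplex (ModuleCat.{u} R) ℤ} (S : ∀ n, Submodule R (H.X n))
    (hS : ∀ i j, S i ≤ (S j).comap (H.d i j).hom)
    (q : diskComplex (ModuleCat.of R (SmallFree R)) ⟶ quotComplex H S hS) :
    ∃ v : diskComplex (ModuleCat.of R (SmallFree R)) ⟶ H,
      ∀ n z, (S n).mkQ (v.f n z) = q.f n z := by
  have h : ∀ m, ∃ φ : SmallFree R →ₗ[R] H.X m, ∀ x,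
      (S m).mkQ (φ x) = q.f m ((x, 0) : SmallFree R × SmallFree R) := fun m => by
    obtain ⟨φ, hφ⟩ := Module.projective_lifting_property (S m).mkQ
      ((q.f m).hom ∘ₗ LinearMap.inl R (SmallFree R) (SmallFree R)) (S m).mkQ_surjective
    exact ⟨φ, fun x => LinearMap.congr_fun hφ x⟩
  choose φ hφ using h
  let π : H ⟶ quotComplex H S hS :=
    { f n := ModuleCat.ofHom (S n).mkQ
      comm' i j _ := by
        ext : 1
        exact LinearMap.ext fun x => rfl }
  refine ⟨diskOut (E := ModuleCat.of R (SmallFree R)) φ, fun n z => ?_⟩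
  have : diskOut (E := ModuleCat.of R (SmallFree R)) φ ≫ π = q := by
    refine diskOut_ext fun m x => (Eq.trans ?_ (hφ m x))
    refine congrArg (S m).mkQ ((diskOut_f _ _ _ _).trans ?_)
    simp
  exact congrArg (fun k => ModuleCat.Hom.hom (HomologicalComplex.Hom.f k n) z) this

variable [IsNoetherianRing R]

/-- A map of complexes lifting along a family of small monomorphisms has the lifting property for
all complexes of Gorenstein injective modules. -/
lemma exists_lift_of_small (hR : DoubleDualStable R) {G X : ChainComplex (ModuleCat.{u} R) ℤ}
    (φ : G ⟶ X)
    (hφ : ∀ (Q : ChainComplex (ModuleCat.{u} R) ℤ)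
      (q : diskComplex (ModuleCat.of R (SmallFree R)) ⟶ Q),
      giComplexes R (cokernel (kernel.ι q)) → HasLiftingProperty (kernel.ι q) φ)
    {H : ChainComplex (ModuleCat.{u} R) ℤ} (hH : giComplexes R H) (ψ : H ⟶ X) :
    ∃ h : H ⟶ G, h ≫ φ = ψ := by
  let Good : Set (∀ n, Submodule R (H.X n × G.X n)) := {Γ |
    (∀ i j x y, (x, y) ∈ Γ i → (H.d i j x, G.d i j y) ∈ Γ j) ∧
    (∀ n x y, (x, y) ∈ Γ n → φ.f n y = ψ.f n x) ∧
    (∀ n y, ((0, y) : H.X n × G.X n) ∈ Γ n → y = 0) ∧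
    ∀ n, IsPure ((Γ n).map (LinearMap.fst R _ _))}
  obtain ⟨Γ, -, hΓ⟩ := zorn_le_nonempty₀ Good (fun c hc hchain Γ₀ hΓ₀ => by
    have : Nonempty c := ⟨⟨Γ₀, hΓ₀⟩⟩
    have hd : ∀ n, Directed (· ≤ ·) (fun Γ : c => Γ.1 n) := fun n a b => by
      obtain ⟨z, hz, h1, h2⟩ := hchain.directedOn a a.2 b b.2
      exact ⟨⟨z, hz⟩, h1 n, h2 n⟩
    have hmem : ∀ n z, z ∈ (⨆ Γ : c, Γ.1 n) ↔ ∃ Γ : c, z ∈ Γ.1 n := fun n z =>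
      Submodule.mem_iSup_of_directed _ (hd n)
    refine ⟨fun n => ⨆ Γ : c, Γ.1 n, ⟨fun i j x y h => ?_, fun n x y h => ?_, fun n y h => ?_,
      fun n => ?_⟩, fun Δ hΔ n => le_iSup (fun Γ : c => Γ.1 n) ⟨Δ, hΔ⟩⟩
    · obtain ⟨Δ, hΔ⟩ := (hmem _ _).1 h
      exact (hmem _ _).2 ⟨Δ, (hc Δ.2).1 i j x y hΔ⟩
    · obtain ⟨Δ, hΔ⟩ := (hmem _ _).1 h
      exact (hc Δ.2).2.1 n x y hΔ
    · obtain ⟨Δ, hΔ⟩ := (hmem _ _).1 h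
      exact (hc Δ.2).2.2.1 n y hΔ
    · rw [Submodule.map_iSup]
      refine IsPure.iSup_of_directed _ (fun a b => ?_) fun Δ => (hc Δ.2).2.2.2 n
      obtain ⟨z, h1, h2⟩ := hd n a b
      exact ⟨z, Submodule.map_mono h1, Submodule.map_mono h2⟩)
    ⊥ ⟨fun i j x y h => by
        obtain ⟨rfl, rfl⟩ := Prod.mk.inj ((Submodule.mem_bot R).1 h)
        exact Prod.ext (map_zero (H.d i j).hom) (map_zero (G.d i j).hom), fun n x y h => by
        obtain ⟨rfl, rfl⟩ := Prod.mk.inj ((Submodule.mem_bot R).1 h)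
        exact (map_zero (φ.f n).hom).trans (map_zero (ψ.f n).hom).symm,
        fun n y h => (Prod.mk.inj ((Submodule.mem_bot R).1 h)).2, fun n => by
        have : (⊥ : ∀ n, Submodule R (H.X n × G.X n)) n = ⊥ := rfl
        rw [this, Submodule.map_bot]
        exact isPure_bot⟩
  obtain ⟨hd, hφψ, hfun, hpure⟩ := hΓ.prop
  have huniq : ∀ n x y y', (x, y) ∈ Γ n → (x, y') ∈ Γ n → y = y' := fun n x y y' h h' =>
    sub_eq_zero.1 (hfun n _ (by simpa using (Γ n).sub_mem h h'))
  let S : ∀ n, Submodule R (H.X n) := fun n => (Γ n).map (LinearMap.fst R _ _)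
  have hSmem : ∀ n x, x ∈ S n ↔ ∃ y, (x, y) ∈ Γ n := fun n x => by
    simp [S]
  have hS : ∀ i j, S i ≤ (S j).comap (H.d i j).hom := fun i j x hx => by
    obtain ⟨y, hy⟩ := (hSmem i x).1 hx
    exact (hSmem j _).2 ⟨_, hd i j x y hy⟩
  have hmap : ∀ {C : ChainComplex (ModuleCat.{u} R) ℤ} (a : C ⟶ H), (∀ n x, a.f n x ∈ S n) →
      ∃ b : C ⟶ G, ∀ n x, (a.f n x, b.f n x) ∈ Γ n := by
    intro C a ha
    choose b hb using fun n => Submodule.exists_linearMap_of_graph (Γ n) (hfun n) (a.f n).hom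
      fun x => (hSmem n _).1 (ha n x)
    refine ⟨{ f := fun n => ModuleCat.ofHom (b n), comm' := fun i j _ => ?_ }, hb⟩
    ext x
    refine huniq j (a.f j (C.d i j x)) _ _ ?_ (hb j (C.d i j x))
    have h1 := hd i j _ _ (hb i x)
    have h2 : H.d i j (a.f i x) = a.f j (C.d i j x) :=
      congrArg (fun k => ModuleCat.Hom.hom k x) (a.comm i j)
    rw [← h2]
    exact h1
  have htop : ∀ n x, x ∈ S n := by
    by_contra! hne
    obtain ⟨n, x, hx⟩ := hne
    obtain ⟨N, hxN, hN, q, hq⟩ := exists_small_pure_subcomplex (quotComplex H S hS) n ((S n).mkQ x)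
    obtain ⟨v, hv⟩ := exists_disk_lift S hS q
    have hQ : giComplexes R (cokernel (kernel.ι q)) := by
      refine giComplexes_cokernel_kernel_ι q fun n => ?_
      rw [hq]
      exact (GI.of_isPure hR (GI.of_isPure hR (hH n) (hpure n)).2 (hN n)).1
    have := hφ _ q hQ
    have hι : ∀ m, Function.Exact ((kernel.ι q).f m).hom (q.f m).hom := fun m =>
      (ShortComplex.ShortExact.moduleCat_exact_iff_function_exact _).1
        ((ShortComplex.exact_of_f_is_kernel (ShortComplex.mk _ _ (kernel.condition q))
          (kernelIsKernel _)).map (HomologicalComplex.eval _ _ m))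
    have hvS : ∀ m z, v.f m z ∈ S m ↔ q.f m z = 0 := fun m z => by
      rw [← hv]
      exact (Submodule.Quotient.mk_eq_zero (S m)).symm
    obtain ⟨a, ha⟩ := hmap (kernel.ι q ≫ v) fun m u =>
      (hvS m _).2 ((hι m).apply_apply_eq_zero u)
    have sq : CommSq a (kernel.ι q) φ (v ≫ ψ) := ⟨by
      ext m u
      exact hφψ m _ _ (ha m u)⟩
    let l := sq.lift
    have hl : ∀ m u, l.f m ((kernel.ι q).f m u) = a.f m u := fun m u =>
      congrArg (fun k => ModuleCat.Hom.hom (HomologicalComplex.Hom.f k m) u) sq.fac_left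
    have hlφ : ∀ m z, φ.f m (l.f m z) = ψ.f m (v.f m z) := fun m z =>
      congrArg (fun k => ModuleCat.Hom.hom (HomologicalComplex.Hom.f k m) z) sq.fac_right
    have hvl : ∀ m z, v.f m z ∈ S m → (v.f m z, l.f m z) ∈ Γ m := fun m z hz => by
      obtain ⟨u, rfl⟩ := (hι m _).1 ((hvS m z).1 hz)
      have := ha m u
      rw [← hl] at this
      exact this
    let Γ' : ∀ m, Submodule R (H.X m × G.X m) := fun m =>
      Γ m ⊔ LinearMap.range ((v.f m).hom.prod (l.f m).hom)
    have hΓ' : ∀ m x y, (x, y) ∈ Γ' m ↔ ∃ x' y', (x', y') ∈ Γ m ∧ ∃ z, x' + v.f m z = x ∧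
        y' + l.f m z = y := by
      intro m x y
      rw [Submodule.mem_sup]
      constructor
      · rintro ⟨⟨x', y'⟩, h, _, ⟨z, rfl⟩, h'⟩
        exact ⟨x', y', h, z, (Prod.mk.inj h').1, (Prod.mk.inj h').2⟩
      · rintro ⟨x', y', h, z, rfl, rfl⟩
        exact ⟨(x', y'), h, _, ⟨z, rfl⟩, rfl⟩
    have hmapΓ' : ∀ m, (Γ' m).map (LinearMap.fst R _ _) = (N m).comap (S m).mkQ := by
      intro m
      ext x
      rw [← hq m]
      constructor
      · rintro ⟨⟨x, y⟩, h, rfl⟩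
        obtain ⟨x', y', h', z, rfl, rfl⟩ := (hΓ' m x y).1 h
        refine ⟨z, ?_⟩
        change q.f m z = (S m).mkQ (x' + v.f m z)
        have h0 : (S m).mkQ x' = 0 :=
          (Submodule.Quotient.mk_eq_zero (S m)).2 ((hSmem m x').2 ⟨y', h'⟩)
        rw [map_add, hv, h0]
        exact (zero_add (_ : (quotComplex H S hS).X m)).symm
      · rintro ⟨z, hz⟩
        have hz' : (S m).mkQ (v.f m z) = (S m).mkQ x := (hv m z).trans hz
        obtain ⟨y, hy⟩ := (hSmem m _).1 ((Submodule.Quotient.eq (S m)).1 hz'.symm)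
        exact ⟨(x, y + l.f m z), (hΓ' m _ _).2 ⟨_, _, hy, z, sub_add_cancel _ _, rfl⟩, rfl⟩
    have hgood : Γ' ∈ Good := by
      refine ⟨fun i j x y h => ?_, fun m x y h => ?_, fun m y h => ?_, fun m => ?_⟩
      · obtain ⟨x', y', h', z, rfl, rfl⟩ := (hΓ' _ _ _).1 h
        refine (hΓ' _ _ _).2 ⟨_, _, hd i j _ _ h', (diskComplex _).d i j z, ?_, ?_⟩
        · rw [map_add]
          exact congrArg _ (congrArg (fun k => ModuleCat.Hom.hom k z) (v.comm i j)).symm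
        · rw [map_add]
          exact congrArg _ (congrArg (fun k => ModuleCat.Hom.hom k z) (l.comm i j)).symm
      · obtain ⟨x', y', h', z, rfl, rfl⟩ := (hΓ' _ _ _).1 h
        rw [map_add, map_add, hlφ, hφψ m _ _ h']
      · obtain ⟨x', y', h', z, hx', rfl⟩ := (hΓ' _ _ _).1 h
        have hz : v.f m z ∈ S m := by
          rw [← neg_eq_of_add_eq_zero_right hx']
          exact (S m).neg_mem ((hSmem m x').2 ⟨y', h'⟩)
        refine hfun m _ ?_
        rw [← hx']
        exact (Γ m).add_mem h' (hvl m z hz)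
      · rw [hmapΓ']
        exact IsPure.comap _ (S m).mkQ_surjective (by rw [Submodule.ker_mkQ]; exact hpure m) (hN m)
    have hle : Γ' ≤ Γ := hΓ.le_of_ge hgood fun m => le_sup_left
    refine hx (Submodule.map_mono (hle n) ?_)
    rw [hmapΓ']
    exact hxN
  obtain ⟨b, hb⟩ := hmap (𝟙 H) fun n x => htop n x
  refine ⟨b, ?_⟩
  ext n x
  exact hφψ n _ _ (hb n x)

theorem exists_giComplexes_precover (hR : DoubleDualStable R) (X : ChainComplex (ModuleCat.{u} R) ℤ) :
    ∃ (G : ChainComplex (ModuleCat.{u} R) ℤ) (φ : G ⟶ X), giComplexes R G ∧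
      ∀ H, giComplexes R H → ∀ ψ : H ⟶ X, ∃ h : H ⟶ G, h ≫ φ = ψ := by
  let V := diskComplex (ModuleCat.of R (SmallFree R))
  let T₀ := {U : Subobject V // giComplexes R (cokernel U.arrow)}
  let e : Shrink.{u} T₀ ≃ T₀ := (equivShrink.{u} T₀).symm
  let f : ∀ t, ((e t).1 : ChainComplex (ModuleCat.{u} R) ℤ) ⟶ V :=
    fun t => (e t).1.arrow
  obtain ⟨G, i, φ, hi, hφ, -⟩ :=
    exists_factorization_ofHoms_mono f (0 : (HasZeroObject.zero' _).zero ⟶ X)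
  have hiC := (monoCoker_giComplexes_of_llp hR f (fun t => ⟨inferInstance, (e t).2⟩) _ hi).2
  obtain rfl : i = 0 := (isZero_zero _).eq_of_src _ _
  refine ⟨G, φ, (giComplexes R).prop_of_iso cokernelZeroIsoTarget hiC,
    fun H hH ψ => exists_lift_of_small hR φ (fun Q q hq => ?_) hH ψ⟩
  have a : (Subobject.mk (kernel.ι q)).arrow = (Subobject.underlyingIso (kernel.ι q)).hom ≫ kernel.ι q :=
    (Subobject.underlyingIso_hom_comp_eq_mk (kernel.ι q)).symm
  let t : T₀ := ⟨Subobject.mk (kernel.ι q), by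
    rw [a]
    exact (giComplexes R).prop_of_iso (cokernelEpiComp _ _).symm hq⟩
  have ht : HasLiftingProperty (Subobject.mk (kernel.ι q)).arrow φ := by
    have := hφ _ (MorphismProperty.ofHoms.mk (f := f) (e.symm t))
    simp only [f] at this
    rwa [e.apply_symm_apply t] at this
  let E : Arrow.mk (Subobject.mk (kernel.ι q)).arrow ≅ Arrow.mk (kernel.ι q) :=
    Arrow.isoMk (Subobject.underlyingIso (kernel.ι q)) (Iso.refl _)
      (a.symm.trans (Category.comp_id _).symm)
  exact HasLiftingProperty.of_arrow_iso_left E φ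

end Precover

section WeaklyTerminal

universe v'

lemma exists_wellOrder_not_strictMono (S : Type u) :
    ∃ (J : Type u) (_ : LinearOrder J) (_ : OrderBot J) (_ : SuccOrder J) (_ : WellFoundedLT J)
      (_ : NoMaxOrder J), ∀ f : J → S, ¬ Function.Injective f := by
  let κ : Cardinal.{u} := max Cardinal.aleph0 (Order.succ (Cardinal.mk S))
  have hκ : Cardinal.aleph0 ≤ κ := le_max_left _ _
  have : NoMaxOrder κ.ord.ToType := Cardinal.noMaxOrder hκ
  have : Nonempty κ.ord.ToType := by
    rw [Ordinal.nonempty_toType_iff]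
    exact fun h => (Cardinal.aleph0_pos.trans_le hκ).ne' (Cardinal.ord_eq_zero.1 h)
  refine ⟨κ.ord.ToType, inferInstance, WellFoundedLT.toOrderBot _, SuccOrder.ofLinearWellFoundedLT _,
    inferInstance,
    inferInstance, fun f hf => ?_⟩
  have := Cardinal.mk_le_of_injective hf
  rw [Cardinal.mk_ord_toType] at this
  exact ((Order.lt_succ (Cardinal.mk S)).trans_le (le_max_right _ _)).not_ge this

lemma strictMono_of_monotone_of_lt_succ {J A : Type*} [LinearOrder J] [SuccOrder J] [NoMaxOrder J]
    [Preorder A] {f : J → A} (hf : Monotone f) (h : ∀ j, f j < f (Order.succ j)) : StrictMono f :=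
  fun _ _ hjk => (h _).trans_le (hf (Order.succ_le_of_lt hjk))

variable {𝒟 : Type v'} [Category.{u} 𝒟]

lemma hasIterationOfShape_of_hasFilteredColimits (𝒟 : Type v') [Category.{u} 𝒟]
    [HasFilteredColimitsOfSize.{u, u} 𝒟] (J : Type u) [LinearOrder J] [Nonempty J] :
    HasIterationOfShape J 𝒟 where
  hasColimitsOfShape_of_isSuccLimit j hj := by
    have := hj.nonempty_Iio.to_subtype
    infer_instance

instance hasFilteredColimits_under [HasFilteredColimitsOfSize.{u, u} 𝒟] (G : 𝒟) :
    HasFilteredColimitsOfSize.{u, u} (Under G) where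
  HasColimitsOfShape I _ _ := by
    have := IsFiltered.isConnected I
    infer_instance

variable {R : Type u} [CommRing R] {I : Type} (U : I → 𝒟 ⥤ ModuleCat.{u} R)

/-- The pairs of elements identified by a morphism. -/
def kerPairs {G H : 𝒟} (g : G ⟶ H) : Set (Σ i, (U i).obj G × (U i).obj G) :=
  {p | (U p.1).map g p.2.1 = (U p.1).map g p.2.2}

/-- The elements in the image of a morphism. -/
def imageElems {G H : 𝒟} (g : G ⟶ H) : Set (Σ i, (U i).obj H) :=
  {p | ∃ x, (U p.1).map g x = p.2}

lemma kerPairs_le_comp {G H K : 𝒟} (g : G ⟶ H) (h : H ⟶ K) :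
    kerPairs U g ⊆ kerPairs U (g ≫ h) := by
  intro p hp
  change (U p.1).map (g ≫ h) _ = (U p.1).map (g ≫ h) _
  rw [Functor.map_comp, ModuleCat.comp_apply, ModuleCat.comp_apply]
  exact congrArg _ hp

lemma imageElems_comp_le {G H K : 𝒟} (g : G ⟶ H) (h : H ⟶ K) :
    imageElems U (g ≫ h) ⊆ imageElems U h := by
  rintro p ⟨x, hx⟩
  exact ⟨(U p.1).map g x, by rw [← hx, Functor.map_comp, ModuleCat.comp_apply]⟩

variable [HasFilteredColimitsOfSize.{u, u} 𝒟]

/-- Every object maps to some object in which no further identifications of its elements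
can be made. -/
lemma exists_kerPairs_stable (G : 𝒟) :
    ∃ (H : 𝒟) (g : G ⟶ H), ∀ (K : 𝒟) (h : H ⟶ K), kerPairs U (g ≫ h) = kerPairs U g := by
  by_contra! hG
  choose K h hK using hG
  obtain ⟨J, _, _, _, _, _, hJ⟩ :=
    exists_wellOrder_not_strictMono (Set (Σ i, (U i).obj G × (U i).obj G))
  have := hasIterationOfShape_of_hasFilteredColimits (Under G) J
  let Φ : SmallObject.SuccStruct (Under G) :=
    { X₀ := Under.mk (𝟙 G)
      succ Z := Under.mk (Z.hom ≫ h Z.right Z.hom)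
      toSucc Z := Under.homMk (h Z.right Z.hom) }
  let F := Φ.iterationFunctor J
  let f : J → Set (Σ i, (U i).obj G × (U i).obj G) := fun j => kerPairs U (F.obj j).hom
  have hle : ∀ {A B : Under G} (a : A ⟶ B), kerPairs U A.hom ⊆ kerPairs U B.hom := fun a => by
    rw [← Under.w a]
    exact kerPairs_le_comp U _ _
  refine hJ f (strictMono_of_monotone_of_lt_succ (fun i j hij => hle (F.map (homOfLE hij)))
    fun j => ?_).injective
  refine lt_of_lt_of_le (lt_of_le_of_ne (kerPairs_le_comp U _ _) (hK _ (F.obj j).hom).symm)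
    (hle (Φ.iterationFunctorObjSuccIso j (not_isMax j)).inv)

variable [∀ i, PreservesFilteredColimitsOfSize.{u, u} (U i)]

lemma exists_forall_injective (G : 𝒟) :
    ∃ (H : 𝒟) (_ : G ⟶ H), ∀ (K : 𝒟) (h : H ⟶ K) (i : I), Function.Injective ((U i).map h) := by
  choose S s hs using exists_kerPairs_stable U
  obtain ⟨J, _, _, _, _, _, -⟩ := exists_wellOrder_not_strictMono PUnit.{u + 1}
  have := hasIterationOfShape_of_hasFilteredColimits 𝒟 J
  let Φ : SmallObject.SuccStruct 𝒟 := { X₀ := G, succ := S, toSucc := s }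
  let F := Φ.iterationFunctor J
  let c := Φ.iterationCocone J
  refine ⟨c.pt, Φ.ιIteration J, fun K h i x y hxy => ?_⟩
  have hc := isColimitOfPreserves (U i) (Φ.isColimitIterationCocone J)
  obtain ⟨j₁, x, rfl⟩ := Concrete.isColimit_exists_rep _ hc x
  obtain ⟨j₂, y, rfl⟩ := Concrete.isColimit_exists_rep _ hc y
  obtain ⟨j, a, b⟩ : ∃ j : J, j₁ ≤ j ∧ j₂ ≤ j := ⟨max j₁ j₂, le_max_left _ _, le_max_right _ _⟩
  let x' := (U i).map (F.map (homOfLE a)) x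
  let y' := (U i).map (F.map (homOfLE b)) y
  have key : ∀ {A : 𝒟} (g : c.pt ⟶ A), (⟨i, x', y'⟩ : Σ i, (U i).obj (F.obj j) × (U i).obj (F.obj j)) ∈
      kerPairs U (c.ι.app j ≫ g) ↔ (U i).map g ((U i).map (c.ι.app j₁) x) =
        (U i).map g ((U i).map (c.ι.app j₂) y) := by
    intro A g
    rw [← c.w (homOfLE a), ← c.w (homOfLE b)]
    simp only [Functor.map_comp, ModuleCat.comp_apply, kerPairs]
    rfl
  have hι : ∀ {A : 𝒟} (g : c.pt ⟶ A), kerPairs U (c.ι.app j ≫ g) = kerPairs U (s (F.obj j)) := by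
    intro A g
    rw [← hs (F.obj j) _ ((Φ.iterationFunctorObjSuccIso j (not_isMax j)).inv ≫
      c.ι.app (Order.succ j) ≫ g), ← c.w (homOfLE (Order.le_succ j))]
    change kerPairs U ((F.map _ ≫ _) ≫ g) = _
    rw [Φ.iterationFunctor_map_succ j (not_isMax j)]
    simp only [Category.assoc]
    rfl
  have h₁ := (key (𝟙 _)).1 ((hι (𝟙 _)).symm ▸ hι h ▸ (key h).2 hxy)
  rwa [CategoryTheory.Functor.map_id] at h₁

/-- A weakly terminal object in a category with filtered colimits, whose objects are
determined by small sets of elements, can be replaced by one all of whose endomorphisms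
are isomorphisms. -/
theorem exists_weaklyTerminal_forall_isIso
    (hU : ∀ {G H : 𝒟} (f : G ⟶ H), (∀ i, Function.Bijective ((U i).map f)) → IsIso f)
    (G : 𝒟) (hG : ∀ Z : 𝒟, Nonempty (Z ⟶ G)) :
    ∃ H : 𝒟, (∀ Z : 𝒟, Nonempty (Z ⟶ H)) ∧ ∀ f : H ⟶ H, IsIso f := by
  obtain ⟨H, g, hH⟩ := exists_forall_injective U G
  have t : ∀ Z, Z ⟶ H := fun Z => (hG Z).some ≫ g
  refine ⟨H, fun Z => ⟨t Z⟩, fun e => hU e fun i => ⟨hH _ e i, ?_⟩⟩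
  by_contra he
  obtain ⟨J, _, _, _, _, _, hJ⟩ := exists_wellOrder_not_strictMono (Set (Σ i, (U i).obj H))
  have := hasIterationOfShape_of_hasFilteredColimits 𝒟 J
  let Φ : SmallObject.SuccStruct 𝒟 := { X₀ := H, succ _ := H, toSucc Z := t Z ≫ e }
  let F := Φ.iterationFunctor J
  let c := Φ.iterationCocone J
  let m : ∀ j, F.obj j ⟶ H := fun j => c.ι.app j ≫ t c.pt
  have hm : ∀ {j k : J} (h : j ≤ k), F.map (homOfLE h) ≫ m k = m j := fun h => by
    rw [← Category.assoc]
    exact congrArg (· ≫ t c.pt) (c.w (homOfLE h))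
  refine hJ (fun j => imageElems U (m j)) (strictMono_of_monotone_of_lt_succ (fun i j hij => ?_)
    fun j => ?_).injective
  · change imageElems U (m i) ⊆ imageElems U (m j)
    rw [← hm hij]
    exact imageElems_comp_le U _ _
  · let n : H ⟶ H := (Φ.iterationFunctorObjSuccIso j (not_isMax j)).inv ≫ m (Order.succ j)
    have hn : t (F.obj j) ≫ e ≫ n = m j := by
      rw [← hm (Order.le_succ j), Φ.iterationFunctor_map_succ j (not_isMax j)]
      exact ((Category.assoc (t (F.obj j)) e n).symm.trans
        (Category.assoc (t (F.obj j) ≫ e) _ _).symm)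
    refine ssubset_of_ssubset_of_subset ?_
      (imageElems_comp_le U (Φ.iterationFunctorObjSuccIso j (not_isMax j)).inv (m (Order.succ j)))
    change imageElems U (m j) ⊂ imageElems U n
    refine ssubset_of_subset_of_ssubset (b := imageElems U (e ≫ n)) ?_ ?_
    · rw [← hn]
      exact imageElems_comp_le U _ _
    · refine (imageElems_comp_le U e n).ssubset_of_not_subset fun h => he fun x => ?_
      obtain ⟨y, hy⟩ := h (show (⟨i, (U i).map n x⟩ : Σ i, (U i).obj H) ∈ imageElems U n from ⟨x, rfl⟩)
      replace hy : (U i).map (e ≫ n) y = (U i).map n x := hy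
      rw [Functor.map_comp, ModuleCat.comp_apply] at hy
      exact ⟨y, hH _ n i hy⟩

end WeaklyTerminal

section Cover

variable {R : Type u} [CommRing R] [IsNoetherianRing R]

theorem exists_giComplexes_cover (hR : DoubleDualStable R) (X : ChainComplex (ModuleCat.{u} R) ℤ) :
    ∃ (G : ChainComplex (ModuleCat.{u} R) ℤ) (φ : G ⟶ X), IsCover (giComplexes R) φ := by
  let P : ObjectProperty (Over X) := (giComplexes R).inverseImage (Over.forget X)
  have hP (J : Type u) [SmallCategory J] [IsFiltered J] : P.IsClosedUnderColimitsOfShape J := by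
    have := giComplexes_isClosedUnderColimitsOfShape hR J
    exact ⟨by
      rintro Y ⟨h⟩
      exact (giComplexes R).prop_of_isColimit (isColimitOfPreserves (Over.forget X) h.isColimit)
        h.prop_diag_obj⟩
  have : HasFilteredColimitsOfSize.{u, u} P.FullSubcategory := ⟨fun J _ _ => by
    have := hP J
    infer_instance⟩
  let U : ℤ → P.FullSubcategory ⥤ ModuleCat.{u} R :=
    fun n => P.ι ⋙ Over.forget X ⋙ HomologicalComplex.eval _ _ n
  have (n : ℤ) : PreservesFilteredColimitsOfSize.{u, u} (U n) := ⟨fun J _ _ => by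
    have := hP J
    infer_instance⟩
  have hU : ∀ {A B : P.FullSubcategory} (f : A ⟶ B),
      (∀ i, Function.Bijective ((U i).map f)) → IsIso f := by
    intro A B f hf
    have h₁ : ∀ n, IsIso ((P.ι.map f).left.f n) := fun n =>
      (ConcreteCategory.isIso_iff_bijective _).2 (hf n)
    have h₂ : IsIso ((Over.forget X).map (P.ι.map f)) :=
      have : ∀ n, IsIso (((Over.forget X).map (P.ι.map f)).f n) := h₁
      HomologicalComplex.Hom.isIso_of_components _
    have h₃ : IsIso (P.ι.map f) := isIso_of_reflects_iso _ (Over.forget X)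
    exact isIso_of_reflects_iso _ P.ι
  obtain ⟨G, φ, hG, hφ⟩ := exists_giComplexes_precover hR X
  obtain ⟨H, hH, hiso⟩ := exists_weaklyTerminal_forall_isIso U hU ⟨Over.mk φ, hG⟩ fun Z => by
    obtain ⟨h, w⟩ := hφ _ Z.property Z.obj.hom
    exact ⟨P.homMk (Over.homMk h w)⟩
  refine ⟨H.obj.left, H.obj.hom, ⟨H.property, fun G' hG' ψ => ?_⟩, fun f hf => ?_⟩
  · obtain ⟨k⟩ := hH ⟨Over.mk ψ, hG'⟩
    exact ⟨k.hom.left, Over.w k.hom⟩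
  · have := hiso (P.homMk (Over.homMk f hf))
    exact inferInstanceAs (IsIso ((P.ι ⋙ Over.forget X).map (P.homMk (Over.homMk f hf) : H ⟶ H)))

end Cover

/-- Let `R` be a commutative noetherian ring such that the character module
`M⁺ = Hom_ℤ(M, ℚ/ℤ)` of every Gorenstein injective `R`-module `M` is Gorenstein flat.  Then
the class of Gorenstein injective complexes is covering in `Ch(R)`. -/
theorem gorensteinInjective_complexes_covering_of_character_gorensteinFlat
    (R : Type u) [CommRing R] [IsNoetherianRing R]
    (hchar : ∀ M : ModuleCat.{u} R, IsGorensteinInjective M →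
      IsGorensteinFlat R (ModuleCat.of R (CharacterModule M))) :
    ∀ X : ChainComplex (ModuleCat.{u} R) ℤ,
      ∃ (G : ChainComplex (ModuleCat.{u} R) ℤ) (φ : G ⟶ X),
        IsCover (fun K => IsGorensteinInjective K) φ := by
  intro X
  obtain ⟨G, φ, hφ⟩ := exists_giComplexes_cover (doubleDualStable_of_gorensteinFlat hchar) X
  exact ⟨G, φ, ⟨(isGorensteinInjective_complex_iff G).2 hφ.1.1, fun G' hG' ψ =>
    hφ.1.2 G' ((isGorensteinInjective_complex_iff G').1 hG') ψ⟩, hφ.2⟩
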